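/- There exist absolute constants c, C > 0 such that, with probability 1 − o(1) for a random pair (g,h) ∈ Sym(n) × Sym(n), every element of the subgroup G = ⟨g,h⟩ can be written as a product of at most C·n²·(log n)^c elements of S = {g, h, g⁻¹, h⁻¹}; i.e., the diameter of the Cayley graph Γ(G,S) is at most C·n²·(log n)^c. -/

import Mathlib

open Equiv

set_option linter.unusedSectionVars false

namespace RandomGenerators

open Finset

section

variable {α Ω ι : Type*}

open scoped Classical in
/-- The indicator of a proposition, as a real number. -/
noncomputable def ind (P : Prop) : ℝ := if P then 1 else 0

lemma ind_pos {P : Prop} (h : P) : ind P = 1 := if_pos h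

lemma ind_neg {P : Prop} (h : ¬P) : ind P = 0 := if_neg h

lemma ind_eq_ite (P : Prop) [Decidable P] : ind P = if P then 1 else 0 := by
  unfold ind; congr

lemma ind_nonneg (P : Prop) : 0 ≤ ind P := by
  unfold ind; split_ifs <;> norm_num

lemma ind_le_one (P : Prop) : ind P ≤ 1 := by
  unfold ind; split_ifs <;> norm_num

lemma ind_mono {P Q : Prop} (h : P → Q) : ind P ≤ ind Q := by
  by_cases hP : P
  · rw [ind_pos hP, ind_pos (h hP)]
  · rw [ind_neg hP]; exact ind_nonneg Q

lemma ind_congr {P Q : Prop} (h : P ↔ Q) : ind P = ind Q := by rw [propext h]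

lemma ind_and (P Q : Prop) : ind (P ∧ Q) = ind P * ind Q := by
  by_cases hP : P
  · by_cases hQ : Q
    · rw [ind_pos hP, ind_pos hQ, ind_pos ⟨hP, hQ⟩, one_mul]
    · rw [ind_neg hQ, ind_neg fun h => hQ h.2, mul_zero]
  · rw [ind_neg hP, ind_neg fun h => hP h.1, zero_mul]

lemma ind_or_le (P Q : Prop) : ind (P ∨ Q) ≤ ind P + ind Q := by
  by_cases hP : P
  · rw [ind_pos hP, ind_pos (Or.inl hP)]; linarith [ind_nonneg Q]
  · rw [ind_neg hP, zero_add]; exact ind_mono fun h => h.resolve_left hP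

lemma ind_exists_le {s : Finset ι} (P : ι → Prop) :
    ind (∃ i ∈ s, P i) ≤ ∑ i ∈ s, ind (P i) := by
  by_cases h : ∃ i ∈ s, P i
  · rw [ind_pos h]
    obtain ⟨i, hi, hP⟩ := h
    rw [← ind_pos hP]
    exact Finset.single_le_sum (f := fun i => ind (P i)) (fun _ _ => ind_nonneg _) hi
  · rw [ind_neg h]
    exact Finset.sum_nonneg fun _ _ => ind_nonneg _

lemma ne_zero_of_ind {P : Prop} (h : ind P ≠ 0) : P := by
  by_contra hP; exact h (ind_neg hP)

lemma sum_ind (s : Finset ι) (P : ι → Prop) [DecidablePred P] :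
    ∑ i ∈ s, ind (P i) = (s.filter P).card := by
  simp only [ind_eq_ite, Finset.sum_boole]

lemma sum_reversal [Fintype Ω] (act : Ω → ι → Ω) (inv : ι → ι)
    (K : Ω → Finset ι) (f : Ω → ℝ)
    (h : ∀ ω, f ω ≠ 0 → ∀ i ∈ K ω, f (act ω i) = f ω ∧ inv i ∈ K (act ω i) ∧
      act (act ω i) (inv i) = ω ∧ inv (inv i) = i) (H : Ω → ι → ℝ) :
    ∑ ω, f ω * ∑ i ∈ K ω, H ω i = ∑ ω, f ω * ∑ i ∈ K ω, H (act ω i) (inv i) := by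
  classical
  have key : ∀ G : Ω → ι → ℝ, ∑ ω, f ω * ∑ i ∈ K ω, G ω i =
      ∑ x ∈ (univ.filter fun ω => f ω ≠ 0).sigma K, f x.1 * G x.1 x.2 := by
    intro G
    rw [Finset.sum_sigma, Finset.sum_filter]
    refine Finset.sum_congr rfl fun ω _ => ?_
    split_ifs with h0
    · rw [Finset.mul_sum]
    · simp [not_not.1 h0]
  rw [key, key]
  refine Finset.sum_nbij' (fun x => ⟨act x.1 x.2, inv x.2⟩) (fun x => ⟨act x.1 x.2, inv x.2⟩)
    ?_ ?_ ?_ ?_ ?_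
  · rintro ⟨ω, i⟩ hx
    simp only [mem_sigma, mem_filter, mem_univ, true_and] at hx ⊢
    obtain ⟨h1, h2, h3, h4⟩ := h ω hx.1 i hx.2
    exact ⟨by rw [h1]; exact hx.1, h2⟩
  · rintro ⟨ω, i⟩ hx
    simp only [mem_sigma, mem_filter, mem_univ, true_and] at hx ⊢
    obtain ⟨h1, h2, h3, h4⟩ := h ω hx.1 i hx.2
    exact ⟨by rw [h1]; exact hx.1, h2⟩
  · rintro ⟨ω, i⟩ hx
    simp only [mem_sigma, mem_filter, mem_univ, true_and] at hx ⊢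
    obtain ⟨h1, h2, h3, h4⟩ := h ω hx.1 i hx.2
    simp [h3, h4]
  · rintro ⟨ω, i⟩ hx
    simp only [mem_sigma, mem_filter, mem_univ, true_and] at hx ⊢
    obtain ⟨h1, h2, h3, h4⟩ := h ω hx.1 i hx.2
    simp [h3, h4]
  · rintro ⟨ω, i⟩ hx
    simp only [mem_sigma, mem_filter, mem_univ, true_and] at hx ⊢
    obtain ⟨h1, h2, h3, h4⟩ := h ω hx.1 i hx.2
    simp [h1, h3, h4]

/-- Averaging over a set of modifications that can be undone. -/
lemma sum_average [Fintype Ω] (act : Ω → ι → Ω) (inv : ι → ι)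
    (K : Ω → Finset ι) (f : Ω → ℝ)
    (h : ∀ ω, f ω ≠ 0 → ∀ i ∈ K ω, f (act ω i) = f ω ∧ inv i ∈ K (act ω i) ∧
      act (act ω i) (inv i) = ω ∧ inv (inv i) = i) (H : Ω → ℝ) :
    ∑ ω, f ω * ((K ω).card * H ω) = ∑ ω, f ω * ∑ i ∈ K ω, H (act ω i) := by
  have := sum_reversal act inv K f h (fun ω _ => H ω)
  simpa using this

section Reveal
variable [DecidableEq α] [Fintype Ω] (ev : Ω → Perm α) (mul : Ω → Perm α → Ω)
  (hev : ∀ ω π, ev (mul ω π) = ev ω * π) (hmul : ∀ ω π, mul (mul ω π) π⁻¹ = ω)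
  (f : Ω → ℝ) (p : Ω → α) (Z B : Ω → Finset α)
  (h : ∀ ω, f ω ≠ 0 → ∀ z ∈ Z ω, f (mul ω (swap (p ω) z)) = f ω ∧
    p (mul ω (swap (p ω) z)) = p ω ∧ Z (mul ω (swap (p ω) z)) = Z ω ∧
    B (mul ω (swap (p ω) z)) = B ω)
include hev hmul h

/-- Revealing the image of an unqueried point. -/
lemma sum_reveal :
    ∑ ω, f ω * ((Z ω).card * ind (ev ω (p ω) ∈ B ω)) =
      ∑ ω, f ω * ((Z ω).filter fun z => ev ω z ∈ B ω).card := by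
  have := sum_average (fun ω z => mul ω (swap (p ω) z)) id Z f (by
    intro ω h0 z hz
    obtain ⟨h1, h2, h3, h4⟩ := h ω h0 z hz
    refine ⟨h1, by simpa [h3] using hz, ?_, rfl⟩
    simp only [h2, id]
    have := hmul ω (swap (p ω) z)
    rwa [swap_inv] at this) (fun ω => ind (ev ω (p ω) ∈ B ω))
  rw [this]
  refine Finset.sum_congr rfl fun ω _ => ?_
  by_cases h0 : f ω = 0
  · simp [h0]
  · congr 1
    rw [← sum_ind]
    refine Finset.sum_congr rfl fun z hz => ?_
    obtain ⟨h1, h2, h3, h4⟩ := h ω h0 z hz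
    simp [h2, h4, hev]

lemma sum_reveal_le (hf : ∀ ω, 0 ≤ f ω) (m b : ℝ)
    (hm : ∀ ω, f ω ≠ 0 → m ≤ (Z ω).card) (hb : ∀ ω, f ω ≠ 0 → ((B ω).card : ℝ) ≤ b) :
    m * ∑ ω, f ω * ind (ev ω (p ω) ∈ B ω) ≤ b * ∑ ω, f ω := by
  calc m * ∑ ω, f ω * ind (ev ω (p ω) ∈ B ω)
      ≤ ∑ ω, f ω * ((Z ω).card * ind (ev ω (p ω) ∈ B ω)) := by
        rw [Finset.mul_sum]
        refine Finset.sum_le_sum fun ω _ => ?_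
        by_cases h0 : f ω = 0
        · simp [h0]
        · have := mul_le_mul_of_nonneg_left (hm ω h0)
            (mul_nonneg (hf ω) (ind_nonneg (ev ω (p ω) ∈ B ω)))
          linarith
    _ = _ := sum_reveal ev mul hev hmul f p Z B h
    _ ≤ b * ∑ ω, f ω := by
        rw [Finset.mul_sum]
        refine Finset.sum_le_sum fun ω _ => ?_
        by_cases h0 : f ω = 0
        · simp [h0]
        · have h1 : (((Z ω).filter fun z => ev ω z ∈ B ω).card : ℝ) ≤ b := by
            refine le_trans ?_ (hb ω h0)
            norm_cast
            refine Finset.card_le_card_of_injOn (ev ω) ?_ (ev ω).injective.injOn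
            intro z hz
            simpa using (Finset.mem_filter.1 hz).2
          have := mul_le_mul_of_nonneg_left h1 (hf ω)
          linarith
end Reveal

/-- Permutations fixing every point outside `F`. -/
def fixOutside [Fintype α] [DecidableEq α] (F : Finset α) : Finset (Perm α) :=
  univ.filter fun κ => ∀ p, p ∉ F → κ p = p

section FixOutside
variable [Fintype α] [DecidableEq α]

lemma mem_fixOutside {F : Finset α} {κ : Perm α} :
    κ ∈ fixOutside F ↔ ∀ p, p ∉ F → κ p = p := by simp [fixOutside]

lemma inv_mem_fixOutside {F : Finset α} {κ : Perm α} (h : κ ∈ fixOutside F) :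
    κ⁻¹ ∈ fixOutside F := by
  rw [mem_fixOutside] at h ⊢
  intro p hp
  rw [Perm.inv_eq_iff_eq, h p hp]

lemma mul_mem_fixOutside {F : Finset α} {κ φ : Perm α} (h : κ ∈ fixOutside F)
    (h' : φ ∈ fixOutside F) : κ * φ ∈ fixOutside F := by
  rw [mem_fixOutside] at h h' ⊢
  intro p hp
  rw [Perm.mul_apply, h' p hp, h p hp]

lemma card_fixOutside (F : Finset α) : (fixOutside F).card = F.card.factorial := by
  have e := Perm.subtypeEquivSubtypePerm (fun x : α => x ∈ F)
  have := Fintype.card_congr e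
  rw [Fintype.card_perm, Fintype.card_coe] at this
  rw [this, Fintype.card_subtype]
  rfl

lemma sum_fixOutside (f : Perm α → ℝ) (F : Perm α → Finset α)
    (h : ∀ σ, f σ ≠ 0 → ∀ κ ∈ fixOutside (F σ), f (σ * κ) = f σ ∧ F (σ * κ) = F σ)
    (H : Perm α → ℝ) :
    ∑ σ, f σ * ((F σ).card.factorial * H σ) =
      ∑ σ, f σ * ∑ κ ∈ fixOutside (F σ), H (σ * κ) := by
  have := sum_average (fun σ κ => σ * κ) (fun κ => κ⁻¹) (fun σ => fixOutside (F σ)) f (by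
    intro σ h0 κ hκ
    obtain ⟨h1, h2⟩ := h σ h0 κ hκ
    refine ⟨h1, ?_, by simp, by simp⟩
    rw [h2]
    exact inv_mem_fixOutside hκ) H
  simpa only [card_fixOutside] using this

end FixOutside

end

section

variable {α : Type*}

lemma sameCycle_map [Finite α] {β : Type*} {δ : Perm α} {δ' : Perm β} (c : α → β)
    (h : ∀ v, δ'.SameCycle (c v) (c (δ v))) {x y : α} (hxy : δ.SameCycle x y) :
    δ'.SameCycle (c x) (c y) := by
  obtain ⟨i, -, rfl⟩ := hxy.exists_pow_eq'
  clear hxy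
  induction i with
  | zero => exact Perm.SameCycle.refl _ _
  | succ i ih =>
    rw [pow_succ', Perm.mul_apply]
    exact ih.trans (h _)

section Bypass
variable [Fintype α] [DecidableEq α]

lemma sameCycle_bypass (δ : Perm α) {p x y : α} (hx : x ≠ p) (hy : y ≠ p) :
    (swap p (δ p) * δ).SameCycle x y ↔ δ.SameCycle x y := by
  constructor
  · intro h
    refine sameCycle_map (δ' := δ) id (fun v => ?_) h
    simp only [id, Perm.mul_apply]
    by_cases h1 : δ v = p
    · rw [h1, swap_apply_left]
      exact ⟨2, by rw [zpow_two, Perm.mul_apply, h1]⟩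
    · by_cases h2 : δ v = δ p
      · rw [h2, swap_apply_right, δ.injective h2]
      · rw [swap_apply_of_ne_of_ne h1 h2]
        exact ⟨1, by simp⟩
  · intro h
    have := sameCycle_map (δ' := swap p (δ p) * δ) (fun v => if v = p then δ p else v)
      (fun v => ?_) h
    · simpa [hx, hy] using this
    · by_cases hv : v = p
      · subst hv
        simp only [if_true]
        split_ifs <;> rfl
      · simp only [hv, if_false]
        refine ⟨1, ?_⟩
        simp only [zpow_one, Perm.mul_apply]
        split_ifs with h1
        · rw [h1, swap_apply_left]
        · exact swap_apply_of_ne_of_ne h1 (fun h => hv (δ.injective h))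

lemma exists_contract (δ : Perm α) (F : Finset α) :
    ∃ φ ∈ fixOutside F, ∀ κ ∈ fixOutside F, ∀ x ∈ F, ∀ y ∈ F,
      ((δ * κ).SameCycle x y ↔ (φ * κ).SameCycle x y) := by
  induction hm : (univ.filter fun v => δ v ≠ v ∧ v ∉ F).card using Nat.strong_induction_on
    generalizing δ with
  | _ m ih =>
    by_cases hδ : ∀ p, p ∉ F → δ p = p
    · exact ⟨δ, mem_fixOutside.2 hδ, fun _ _ _ _ _ _ => Iff.rfl⟩
    · push Not at hδ
      obtain ⟨p, hp, hδp⟩ := hδ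
      have hlt : (univ.filter fun v => (swap p (δ p) * δ) v ≠ v ∧ v ∉ F).card < m := by
        rw [← hm]
        refine Finset.card_lt_card ((Finset.ssubset_iff_of_subset ?_).2 ⟨p, ?_, ?_⟩)
        · intro v hv
          simp only [mem_filter, mem_univ, true_and] at hv ⊢
          refine ⟨fun h => hv.1 ?_, hv.2⟩
          have h1 : v ≠ p := by rintro rfl; exact hδp h
          have h2 : v ≠ δ p := fun h2 => h1 (δ.injective (by rw [h, h2]))
          rw [Perm.mul_apply, h, swap_apply_of_ne_of_ne h1 h2]
        · simp [hδp, hp]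
        · intro h
          exact (mem_filter.1 h).2.1 (by simp)
      obtain ⟨φ, hφ, H⟩ := ih _ hlt (swap p (δ p) * δ) rfl
      refine ⟨φ, hφ, fun κ hκ x hx y hy => ?_⟩
      rw [← H κ hκ x hx y hy]
      have hκp : κ p = p := mem_fixOutside.1 hκ p hp
      have := sameCycle_bypass (δ * κ) (p := p) (x := x) (y := y)
        (fun h => hp (h ▸ hx)) (fun h => hp (h ▸ hy))
      rw [← this, Perm.mul_apply, hκp, mul_assoc]

lemma card_transitive (β : Type*) [Fintype β] [DecidableEq β] [Nonempty β] :
    (univ.filter fun π : Perm β => ∀ x y, π.SameCycle x y).card =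
      (Fintype.card β - 1).factorial := by
  rcases Nat.lt_or_ge (Fintype.card β) 2 with h | h
  · have hs : Subsingleton β := Fintype.card_le_one_iff_subsingleton.1 (by omega)
    have h1 : Fintype.card β = 1 := by
      have := Fintype.card_pos (α := β); omega
    rw [Finset.filter_true_of_mem, Finset.card_univ, Fintype.card_perm, h1]
    · rfl
    · intro π _ x y
      rw [Subsingleton.elim x y]
  · have := Perm.card_of_cycleType_singleton h (le_refl (Fintype.card β))
    rw [Nat.choose_self, mul_one] at this
    rw [← this]
    congr 1
    ext π
    simp only [mem_filter, mem_univ, true_and]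
    constructor
    · intro hπ
      have hne : ∀ x, π x ≠ x := by
        intro x hx
        obtain ⟨y, hy⟩ := Fintype.exists_ne_of_one_lt_card (by omega) x
        exact hy (((hπ x y).eq_of_left hx).symm)
      have hsupp : π.support = univ := by ext x; simp [hne]
      have hc : π.IsCycle := by
        obtain ⟨x⟩ := ‹Nonempty β›
        exact ⟨x, hne x, fun y _ => hπ x y⟩
      rw [hc.cycleType, hsupp, Finset.card_univ]
    · intro hπ x y
      have hc : π.IsCycle := Perm.card_cycleType_eq_one.1 (by rw [hπ]; rfl)
      have hs : π.support = univ := by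
        rw [← Finset.card_eq_iff_eq_univ, ← Perm.sum_cycleType, hπ, Multiset.sum_singleton]
      exact hc.sameCycle (by rw [← Perm.mem_support, hs]; simp)
        (by rw [← Perm.mem_support, hs]; simp)

lemma card_fixOutside_transitive {F : Finset α} (hF : F.Nonempty) :
    ((fixOutside F).filter fun κ => ∀ x ∈ F, ∀ y ∈ F, κ.SameCycle x y).card =
      (F.card - 1).factorial := by
  have : Nonempty {x // x ∈ F} := hF.to_subtype
  rw [← Fintype.card_coe F, ← card_transitive {x // x ∈ F}]
  have hmem : ∀ κ ∈ fixOutside F, ∀ x, κ x ∈ F ↔ x ∈ F := by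
    intro κ hκ x
    rw [mem_fixOutside] at hκ
    constructor
    · intro h
      by_contra hx
      rw [hκ x hx] at h
      exact hx h
    · intro h
      by_contra hx
      have := hκ _ hx
      rw [κ.injective this] at hx
      exact hx h
  refine Finset.card_bij' (fun κ hκ => κ.subtypePerm (fun x => hmem κ (mem_filter.1 hκ).1 x))
    (fun π _ => Perm.ofSubtype π) ?_ ?_ ?_ ?_
  · intro κ hκ
    simp only [mem_filter, mem_univ, true_and]
    intro x y
    rw [Perm.sameCycle_subtypePerm]
    exact (mem_filter.1 hκ).2 x x.2 y y.2
  · intro π hπ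
    simp only [mem_filter, mem_univ, true_and] at hπ
    rw [mem_filter, mem_fixOutside]
    refine ⟨fun p hp => Perm.ofSubtype_apply_of_not_mem π hp, fun x hx y hy => ?_⟩
    exact sameCycle_map (δ := π) Subtype.val (fun v => ⟨1, by simp⟩) (hπ ⟨x, hx⟩ ⟨y, hy⟩)
  · intro κ hκ
    refine Perm.ofSubtype_subtypePerm _ ?_
    intro x hx
    by_contra hxF
    exact hx (mem_fixOutside.1 (mem_filter.1 hκ).1 x hxF)
  · intro π _
    exact Perm.subtypePerm_ofSubtype π

lemma card_fixOutside_sameCycle (δ : Perm α) {F : Finset α} (hF : F.Nonempty) :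
    ((fixOutside F).filter fun κ => ∀ x ∈ F, ∀ y ∈ F, (δ * κ).SameCycle x y).card =
      (F.card - 1).factorial := by
  obtain ⟨φ, hφ, H⟩ := exists_contract δ F
  rw [← card_fixOutside_transitive hF]
  refine Finset.card_bij' (fun κ _ => φ * κ) (fun κ _ => φ⁻¹ * κ) ?_ ?_ ?_ ?_
  · intro κ hκ
    rw [mem_filter] at hκ ⊢
    exact ⟨mul_mem_fixOutside hφ hκ.1, fun x hx y hy => (H κ hκ.1 x hx y hy).1 (hκ.2 x hx y hy)⟩
  · intro κ hκ
    rw [mem_filter] at hκ ⊢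
    have h1 := mul_mem_fixOutside (inv_mem_fixOutside hφ) hκ.1
    refine ⟨h1, fun x hx y hy => (H _ h1 x hx y hy).2 ?_⟩
    rw [mul_inv_cancel_left]
    exact hκ.2 x hx y hy
  · intro κ _; simp
  · intro κ _; simp

/-- If the points of `F` are rewired uniformly, they all lie in one cycle with probability
`1 / |F|`. -/
lemma sum_sameCycle (f : Perm α → ℝ) (F : Perm α → Finset α) (δ : Perm α → Perm α)
    (h : ∀ σ, f σ ≠ 0 → ∀ κ ∈ fixOutside (F σ), f (σ * κ) = f σ ∧ F (σ * κ) = F σ ∧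
      δ (σ * κ) = δ σ * κ) {m : ℕ} (hm : 0 < m) (hF : ∀ σ, f σ ≠ 0 → (F σ).card = m) :
    (m : ℝ) * ∑ σ, f σ * ind (∀ x ∈ F σ, ∀ y ∈ F σ, (δ σ).SameCycle x y) =
      ∑ σ, f σ := by
  have key := sum_fixOutside f F (fun σ h0 κ hκ => ⟨(h σ h0 κ hκ).1, (h σ h0 κ hκ).2.1⟩)
    (fun σ => ind (∀ x ∈ F σ, ∀ y ∈ F σ, (δ σ).SameCycle x y))
  have h1 : ∀ σ, f σ * ∑ κ ∈ fixOutside (F σ),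
      ind (∀ x ∈ F (σ * κ), ∀ y ∈ F (σ * κ), (δ (σ * κ)).SameCycle x y) =
      f σ * ((m - 1).factorial : ℝ) := by
    intro σ
    by_cases h0 : f σ = 0
    · simp [h0]
    · congr 1
      have hne : (F σ).Nonempty := Finset.card_pos.1 (by rw [hF σ h0]; exact hm)
      rw [← hF σ h0, ← card_fixOutside_sameCycle (δ σ) hne, ← sum_ind]
      refine Finset.sum_congr rfl fun κ hκ => ?_
      rw [(h σ h0 κ hκ).2.1, (h σ h0 κ hκ).2.2]
  rw [Finset.sum_congr rfl fun σ _ => h1 σ, ← Finset.sum_mul] at key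
  have h2 : ∀ σ, f σ * (((F σ).card.factorial : ℝ) *
      ind (∀ x ∈ F σ, ∀ y ∈ F σ, (δ σ).SameCycle x y)) =
      ((m - 1).factorial : ℝ) * ((m : ℝ) *
      (f σ * ind (∀ x ∈ F σ, ∀ y ∈ F σ, (δ σ).SameCycle x y))) := by
    intro σ
    by_cases h0 : f σ = 0
    · simp [h0]
    · rw [hF σ h0, ← Nat.mul_factorial_pred hm.ne']
      push_cast
      ring
  rw [Finset.sum_congr rfl fun σ _ => h2 σ, ← Finset.mul_sum, ← Finset.mul_sum] at key
  have hpos : ((m - 1).factorial : ℝ) ≠ 0 := by positivity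
  rw [mul_comm (∑ σ, f σ)] at key
  exact mul_left_cancel₀ hpos key

end Bypass

end

variable {α : Type*} [Fintype α] [DecidableEq α]

/-- The cycle of `σ` through `x`, including the case of a fixed point. -/
def cyc (σ : Perm α) (x : α) : Finset α := univ.filter fun y => σ.SameCycle x y

lemma mem_cyc {σ : Perm α} {x y : α} : y ∈ cyc σ x ↔ σ.SameCycle x y := by simp [cyc]

lemma self_mem_cyc (σ : Perm α) (x : α) : x ∈ cyc σ x := by
  rw [mem_cyc]

lemma card_cyc_pos (σ : Perm α) (x : α) : 0 < (cyc σ x).card :=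
  Finset.card_pos.2 ⟨x, self_mem_cyc σ x⟩

lemma apply_mem_cyc {σ : Perm α} {x y : α} : σ y ∈ cyc σ x ↔ y ∈ cyc σ x := by
  simp [mem_cyc]

lemma cyc_eq {σ : Perm α} {x y : α} (h : y ∈ cyc σ x) : cyc σ y = cyc σ x := by
  rw [mem_cyc] at h
  ext z
  rw [mem_cyc, mem_cyc]
  exact ⟨h.trans, h.symm.trans⟩

lemma isCycleOn_cyc (σ : Perm α) (x : α) : σ.IsCycleOn (cyc σ x : Set α) := by
  refine ⟨⟨?_, σ.injective.injOn, ?_⟩, ?_⟩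
  · intro y hy
    simpa [mem_cyc] using hy
  · intro y hy
    refine ⟨σ⁻¹ y, ?_, by simp⟩
    simpa [mem_cyc] using hy
  · intro y hy z hz
    simp only [mem_coe, mem_cyc] at hy hz
    exact hy.symm.trans hz

lemma pow_apply_eq_self_iff (σ : Perm α) (x : α) (i : ℕ) :
    (σ ^ i) x = x ↔ (cyc σ x).card ∣ i :=
  (isCycleOn_cyc σ x).pow_apply_eq (by simp [self_mem_cyc])

lemma card_cyc_eq_iff (σ : Perm α) (x : α) (j : ℕ) :
    (cyc σ x).card = j + 1 ↔ (σ ^ (j + 1)) x = x ∧ ∀ i, 0 < i → i ≤ j → (σ ^ i) x ≠ x := by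
  simp only [ne_eq, pow_apply_eq_self_iff]
  have hpos := card_cyc_pos σ x
  constructor
  · intro h
    rw [h]
    refine ⟨dvd_rfl, fun i hi hij hdvd => ?_⟩
    have := Nat.le_of_dvd hi hdvd
    omega
  · rintro ⟨h1, h2⟩
    by_contra hne
    have := Nat.le_of_dvd (by omega) h1
    exact h2 _ hpos (by omega) dvd_rfl

lemma pow_apply_mul_swap {σ : Perm α} {z p p' : α} {j : ℕ}
    (hp : ∀ i < j, (σ ^ i) z ≠ p) (hp' : ∀ i < j, (σ ^ i) z ≠ p') :
    ((σ * swap p p') ^ j) z = (σ ^ j) z := by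
  induction j with
  | zero => rfl
  | succ j ih =>
    rw [pow_succ', pow_succ', Perm.mul_apply, Perm.mul_apply, ih (fun i hi => hp i (by omega))
      (fun i hi => hp' i (by omega)), Perm.mul_apply,
      swap_apply_of_ne_of_ne (hp j (by omega)) (hp' j (by omega))]

lemma pow_apply_ne {σ : Perm α} {z : α} {j : ℕ} (h : ∀ i, 0 < i → i ≤ j → (σ ^ i) z ≠ z)
    {a b : ℕ} (hab : a < b) (hb : b ≤ j) : (σ ^ a) z ≠ (σ ^ b) z := by
  intro he
  refine h (b - a) (by omega) (by omega) ?_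
  have : (σ ^ a) ((σ ^ (b - a)) z) = (σ ^ a) z := by
    rw [← Perm.mul_apply, ← pow_add, Nat.add_sub_cancel' hab.le, he]
  exact (σ ^ a).injective this

section CycleLength
variable (f : Perm α → ℝ) (Q : Perm α → Finset α) (z : α) (q : ℕ)
  (h : ∀ σ, f σ ≠ 0 → z ∉ Q σ ∧ (Q σ).card = q ∧ (∀ p, σ p ∈ Q σ ↔ p ∈ Q σ) ∧
    ∀ p p', p ∉ Q σ → p' ∉ Q σ → f (σ * swap p p') = f σ ∧ Q (σ * swap p p') = Q σ)
include h

lemma sum_first_return (j : ℕ) (hj : j + q < Fintype.card α) :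
    ((Fintype.card α : ℝ) - q - j) * ∑ σ, (f σ * ind (∀ i, 0 < i → i ≤ j → (σ ^ i) z ≠ z))
      * ind ((σ ^ (j + 1)) z = z) =
    ∑ σ, f σ * ind (∀ i, 0 < i → i ≤ j → (σ ^ i) z ≠ z) := by
  have horb : ∀ σ, f σ ≠ 0 → ∀ i, (σ ^ i) z ∉ Q σ := by
    intro σ h0 i
    obtain ⟨h1, -, h3, -⟩ := h σ h0
    induction i with
    | zero => simpa using h1
    | succ i ih => rwa [pow_succ', Perm.mul_apply, h3]
  have key := sum_reveal (Ω := Perm α) id (fun σ π => σ * π) (fun _ _ => rfl) (by simp)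
    (fun σ => f σ * ind (∀ i, 0 < i → i ≤ j → (σ ^ i) z ≠ z))
    (fun σ => (σ ^ j) z) (fun σ => (Q σ ∪ (range j).image fun i => (σ ^ i) z)ᶜ) (fun _ => {z}) (by
      intro σ h0 p' hp'
      have hf0 : f σ ≠ 0 := left_ne_zero_of_mul h0
      have hd : ∀ i, 0 < i → i ≤ j → (σ ^ i) z ≠ z := ne_zero_of_ind (right_ne_zero_of_mul h0)
      simp only [compl_union, mem_inter, mem_compl, mem_image, mem_range, not_exists, not_and]
        at hp'
      obtain ⟨h1, h2, h3, h4⟩ := h σ hf0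
      obtain ⟨h5, h6⟩ := h4 ((σ ^ j) z) p' (horb σ hf0 j) hp'.1
      have h7 : ∀ i ≤ j, ((σ * swap ((σ ^ j) z) p') ^ i) z = (σ ^ i) z := by
        intro i hi
        refine pow_apply_mul_swap (fun a ha => pow_apply_ne hd (by omega) le_rfl)
          (fun a ha => hp'.2 a (by omega))
      have h8 : ((range j).image fun i => ((σ * swap ((σ ^ j) z) p') ^ i) z) =
          (range j).image fun i => (σ ^ i) z := by
        refine Finset.image_congr fun i hi => h7 i ?_
        simp at hi; omega
      have h9 : (∀ i, 0 < i → i ≤ j → ((σ * swap ((σ ^ j) z) p') ^ i) z ≠ z) := by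
        intro i hi hij
        rw [h7 i hij]
        exact hd i hi hij
      refine ⟨?_, h7 j le_rfl, ?_, rfl⟩
      · rw [h5, ind_pos h9, ind_pos hd]
      · rw [h8, h6])
  calc _ = _ := ?_
    _ = _ := key
    _ = _ := ?_
  · rw [Finset.mul_sum]
    refine Finset.sum_congr rfl fun σ _ => ?_
    by_cases h0 : f σ = 0
    · simp [h0]
    by_cases hd : ∀ i, 0 < i → i ≤ j → (σ ^ i) z ≠ z
    · have hcard : ((Q σ ∪ (range j).image fun i => (σ ^ i) z)ᶜ).card =
          Fintype.card α - (q + j) := by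
        rw [Finset.card_compl, Finset.card_union_of_disjoint, (h σ h0).2.1,
          Finset.card_image_of_injOn, card_range]
        · intro a ha b hb hab
          simp only [coe_range, Set.mem_Iio] at ha hb
          by_contra hne
          rcases lt_or_gt_of_ne hne with hlt | hlt
          · exact pow_apply_ne hd hlt hb.le hab
          · exact pow_apply_ne hd hlt ha.le hab.symm
        · rw [Finset.disjoint_right]
          intro a ha
          obtain ⟨i, -, rfl⟩ := mem_image.1 ha
          exact horb σ h0 i
      rw [hcard, Nat.cast_sub (by omega)]
      simp only [id, pow_succ', Perm.mul_apply, mem_singleton]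
      push_cast
      ring
    · rw [ind_neg hd]; simp
  · refine Finset.sum_congr rfl fun σ _ => ?_
    by_cases h0 : f σ = 0
    · simp [h0]
    by_cases hd : ∀ i, 0 < i → i ≤ j → (σ ^ i) z ≠ z
    · have : ((Q σ ∪ (range j).image fun i => (σ ^ i) z)ᶜ.filter
          fun w => id σ w ∈ ({z} : Finset α)) =
          {σ⁻¹ z} := by
        ext w
        simp only [mem_filter, mem_compl, mem_union, mem_image, mem_range, mem_singleton, id]
        constructor
        · rintro ⟨-, hw⟩
          rw [← hw]; simp
        · rintro rfl
          refine ⟨?_, by simp⟩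
          rintro (hw | ⟨i, hi, hw⟩)
          · rw [← (h σ h0).2.2.1] at hw
            rw [show σ (σ⁻¹ z) = z by simp] at hw
            exact (h σ h0).1 hw
          · refine hd (i + 1) (by omega) (by omega) ?_
            rw [pow_succ', Perm.mul_apply, hw]
            simp
      rw [this]
      simp
    · rw [ind_neg hd]; simp

lemma sum_no_return (j : ℕ) (hj : j + q ≤ Fintype.card α) :
    ((Fintype.card α : ℝ) - q) *
      ∑ σ, f σ * ind (∀ i, 0 < i → i ≤ j → (σ ^ i) z ≠ z) =
    ((Fintype.card α : ℝ) - q - j) * ∑ σ, f σ := by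
  induction j with
  | zero =>
    have : ∀ σ : Perm α, ∀ i, 0 < i → i ≤ 0 → (σ ^ i) z ≠ z := by intros; omega
    have h0 : ∀ σ : Perm α, ind (∀ i, 0 < i → i ≤ 0 → (σ ^ i) z ≠ z) = 1 :=
      fun σ => ind_pos (this σ)
    simp only [h0]
    simp
  | succ j ih =>
    have h1 := sum_first_return f Q z q h j (by omega)
    have h2 := ih (by omega)
    have h3 : ∑ σ, f σ * ind (∀ i, 0 < i → i ≤ j + 1 → (σ ^ i) z ≠ z) =
        (∑ σ, f σ * ind (∀ i, 0 < i → i ≤ j → (σ ^ i) z ≠ z)) -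
        ∑ σ, (f σ * ind (∀ i, 0 < i → i ≤ j → (σ ^ i) z ≠ z))
      * ind ((σ ^ (j + 1)) z = z) := by
      rw [← Finset.sum_sub_distrib]
      refine Finset.sum_congr rfl fun σ _ => ?_
      by_cases hd : ∀ i, 0 < i → i ≤ j → (σ ^ i) z ≠ z
      · by_cases hz : (σ ^ (j + 1)) z = z
        · have : ¬ ∀ i, 0 < i → i ≤ j + 1 → (σ ^ i) z ≠ z :=
            fun hc => hc (j + 1) (by omega) le_rfl hz
          simp only [ind_pos hd, ind_pos hz, ind_neg this]
          ring
        · have : ∀ i, 0 < i → i ≤ j + 1 → (σ ^ i) z ≠ z := by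
            intro i hi hij
            rcases Nat.lt_or_ge j i with h' | h'
            · have : i = j + 1 := by omega
              rwa [this]
            · exact hd i hi h'
          simp only [ind_pos hd, ind_neg hz, ind_pos this]
          ring
      · have : ¬ ∀ i, 0 < i → i ≤ j + 1 → (σ ^ i) z ≠ z := fun hc =>
          hd fun i hi hij => hc i hi (by omega)
        simp only [ind_neg hd, ind_neg this]
        ring
    have hne : ((Fintype.card α : ℝ) - q - j) ≠ 0 := by
      have : ((j + 1 + q : ℕ) : ℝ) ≤ Fintype.card α := by exact_mod_cast hj
      push_cast at this
      intro h0
      linarith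
    rw [h3]
    apply mul_left_cancel₀ hne
    push_cast
    linear_combination ((Fintype.card α : ℝ) - q - j - 1) * h2 - ((Fintype.card α : ℝ) - q) * h1

/-- The cycle length of a point outside an exposed invariant set is uniformly distributed. -/
lemma sum_card_cyc_eq (d : ℕ) (hd0 : 0 < d) (hd : d + q ≤ Fintype.card α) :
    ((Fintype.card α : ℝ) - q) * ∑ σ, f σ * ind ((cyc σ z).card = d) =
      ∑ σ, f σ := by
  obtain ⟨j, rfl⟩ : ∃ j, d = j + 1 := ⟨d - 1, by omega⟩
  have h1 := sum_first_return f Q z q h j (by omega)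
  have h2 := sum_no_return f Q z q h j (by omega)
  have hne : ((Fintype.card α : ℝ) - q - j) ≠ 0 := by
    have : ((j + 1 + q : ℕ) : ℝ) ≤ Fintype.card α := by exact_mod_cast hd
    push_cast at this
    intro h0
    linarith
  have h3 : ∑ σ, f σ * ind ((cyc σ z).card = j + 1) =
      ∑ σ, (f σ * ind (∀ i, 0 < i → i ≤ j → (σ ^ i) z ≠ z))
      * ind ((σ ^ (j + 1)) z = z) := by
    refine Finset.sum_congr rfl fun σ _ => ?_
    rw [mul_assoc]
    congr 1
    rw [← ind_and, card_cyc_eq_iff]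
    exact ind_congr and_comm
  rw [h3]
  apply mul_left_cancel₀ hne
  linear_combination ((Fintype.card α : ℝ) - q) * h1 + h2

end CycleLength

lemma sum_ind_card_cyc (z : α) (d : ℕ) (hd0 : 0 < d) (hd : d ≤ Fintype.card α) :
    (Fintype.card α : ℝ) * ∑ σ : Perm α, ind ((cyc σ z).card = d) =
      (Fintype.card α).factorial := by
  have := sum_card_cyc_eq (fun _ => 1) (fun _ => ∅) z 0 (by simp) d hd0 (by omega)
  simpa [Fintype.card_perm] using this

lemma cyc_mul_swap {σ : Perm α} {x p p' : α} (hp : p ∉ cyc σ x) (hp' : p' ∉ cyc σ x) :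
    cyc (σ * swap p p') x = cyc σ x := by
  have h : ∀ y ∈ cyc σ x, (σ * swap p p') y = σ y := by
    intro y hy
    rw [Perm.mul_apply, swap_apply_of_ne_of_ne]
    · rintro rfl; exact hp hy
    · rintro rfl; exact hp' hy
  have h2 : ∀ j, ((σ * swap p p') ^ j) x = (σ ^ j) x := by
    intro j
    refine pow_apply_mul_swap (fun i _ hi => hp ?_) (fun i _ hi => hp' ?_)
    · rw [← hi, mem_cyc]; exact ⟨i, by simp⟩
    · rw [← hi, mem_cyc]; exact ⟨i, by simp⟩
  ext y
  rw [mem_cyc, mem_cyc]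
  constructor
  · intro h
    obtain ⟨i, -, rfl⟩ := h.exists_pow_eq'
    rw [h2]; exact ⟨i, by simp⟩
  · intro h
    obtain ⟨i, -, rfl⟩ := h.exists_pow_eq'
    rw [← h2]; exact ⟨i, by simp⟩

lemma sum_two_cycles_le (x : α) (c d : ℕ) (hc0 : 0 < c) (hd0 : 0 < d) :
    (Fintype.card α : ℝ) * ∑ z, ∑ σ : Perm α,
      ind ((cyc σ x).card = c) * ind (z ∉ cyc σ x) * ind ((cyc σ z).card = d) ≤
      (Fintype.card α).factorial := by
  rcases Nat.lt_or_ge (Fintype.card α) (d + c) with hlt | hle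
  · have : ∀ z, ∀ σ : Perm α,
        ind ((cyc σ x).card = c) * ind (z ∉ cyc σ x) * ind ((cyc σ z).card = d) = 0 := by
      intro z σ
      rw [← ind_and, ← ind_and]
      refine ind_neg ?_
      rintro ⟨⟨h1, h2⟩, h3⟩
      have hdis : Disjoint (cyc σ x) (cyc σ z) := by
        rw [Finset.disjoint_left]
        intro y hy hy'
        rw [mem_cyc] at *
        exact h2 (hy.trans hy'.symm)
      have := Finset.card_le_univ (cyc σ x ∪ cyc σ z)
      rw [Finset.card_union_of_disjoint hdis] at this
      omega
    simp only [this]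
    simp
  · have hz : ∀ z, ((Fintype.card α : ℝ) - c) * ∑ σ : Perm α,
        ind ((cyc σ x).card = c) * ind (z ∉ cyc σ x) * ind ((cyc σ z).card = d) =
        ∑ σ : Perm α, ind ((cyc σ x).card = c) * ind (z ∉ cyc σ x) := by
      intro z
      refine sum_card_cyc_eq (fun σ : Perm α => ind ((cyc σ x).card = c) * ind (z ∉ cyc σ x))
        (fun σ => cyc σ x) z c (fun σ h0 => ?_) d hd0 (by omega)
      refine ⟨ne_zero_of_ind (right_ne_zero_of_mul h0), ne_zero_of_ind (left_ne_zero_of_mul h0),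
        fun p => apply_mem_cyc, fun p p' hp hp' => ?_⟩
      rw [cyc_mul_swap hp hp']
      exact ⟨rfl, rfl⟩
    have hsum : ∑ z, ∑ σ : Perm α, ind ((cyc σ x).card = c) * ind (z ∉ cyc σ x) =
        ((Fintype.card α : ℝ) - c) * ∑ σ : Perm α, ind ((cyc σ x).card = c) := by
      rw [Finset.sum_comm, Finset.mul_sum]
      refine Finset.sum_congr rfl fun σ _ => ?_
      by_cases h1 : (cyc σ x).card = c
      · rw [ind_pos h1]
        simp only [one_mul, mul_one]
        rw [sum_ind]
        have : (univ.filter fun z => z ∉ cyc σ x) = (cyc σ x)ᶜ := by ext; simp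
        rw [this, Finset.card_compl, h1, Nat.cast_sub (by omega)]
      · simp [ind_neg h1]
    have hpos : 0 < (Fintype.card α : ℝ) - c := by
      have : ((d + c : ℕ) : ℝ) ≤ Fintype.card α := by exact_mod_cast hle
      push_cast at this
      have h' : (0 : ℝ) < d := by exact_mod_cast hd0
      linarith
    rw [← Finset.sum_congr rfl fun z _ => hz z, ← Finset.mul_sum] at hsum
    rw [mul_left_cancel₀ hpos.ne' hsum, sum_ind_card_cyc x c hc0 (by omega)]

lemma sum_ind_card_cyc_le (z : α) (d : ℕ) (hd0 : 0 < d) :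
    (Fintype.card α : ℝ) * ∑ σ : Perm α, ind ((cyc σ z).card = d) ≤
      (Fintype.card α).factorial := by
  rcases Nat.lt_or_ge (Fintype.card α) d with h | h
  · have : ∀ σ : Perm α, ind ((cyc σ z).card = d) = 0 := fun σ =>
      ind_neg fun hc => by have := Finset.card_le_univ (cyc σ z); omega
    simp only [this]
    simp
  · exact (sum_ind_card_cyc z d hd0 h).le

/-- The expected number of fixed points of the `d`-th power of a random permutation. -/
lemma sum_fixed_pow_le (d : ℕ) (hd : 0 < d) :
    ∑ σ : Perm α, ∑ y, ind ((σ ^ d) y = y) ≤ d * (Fintype.card α).factorial := by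
  rcases isEmpty_or_nonempty α with hα | hα
  · simp
  have hn : (0 : ℝ) < Fintype.card α := by exact_mod_cast Fintype.card_pos
  have h1 : ∀ (σ : Perm α) (y : α), ind ((σ ^ d) y = y) ≤
      ∑ l ∈ Icc 1 d, ind ((cyc σ y).card = l) := by
    intro σ y
    refine le_trans (ind_mono fun h => ?_) (ind_exists_le _)
    rw [pow_apply_eq_self_iff] at h
    exact ⟨_, mem_Icc.2 ⟨card_cyc_pos σ y, Nat.le_of_dvd hd h⟩, rfl⟩
  calc ∑ σ : Perm α, ∑ y, ind ((σ ^ d) y = y)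
      ≤ ∑ σ : Perm α, ∑ y, ∑ l ∈ Icc 1 d, ind ((cyc σ y).card = l) :=
        Finset.sum_le_sum fun σ _ => Finset.sum_le_sum fun y _ => h1 σ y
    _ = ∑ l ∈ Icc 1 d, ∑ y : α, ∑ σ : Perm α, ind ((cyc σ y).card = l) := by
        rw [Finset.sum_comm (s := Icc 1 d), Finset.sum_comm]
        exact Finset.sum_congr rfl fun y _ => Finset.sum_comm
    _ ≤ ∑ l ∈ Icc 1 d, ∑ y : α, ((Fintype.card α).factorial : ℝ) / Fintype.card α := by
        refine Finset.sum_le_sum fun l hl => Finset.sum_le_sum fun y _ => ?_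
        rw [le_div_iff₀ hn, mul_comm]
        exact sum_ind_card_cyc_le y l (mem_Icc.1 hl).1
    _ = d * (Fintype.card α).factorial := by
        simp only [Finset.sum_const, Nat.card_Icc, Finset.card_univ, nsmul_eq_mul]
        field_simp
        simp

lemma sum_card_dvd_le (n : ℕ) :
    ∑ c ∈ Icc 1 n, (((Icc 1 n).filter fun d => d ∣ c).card : ℝ) ≤ n * (1 + Real.log n) := by
  have h1 : ∑ c ∈ Icc 1 n, (((Icc 1 n).filter fun d => d ∣ c).card : ℝ) =
      ∑ d ∈ Icc 1 n, (((Icc 1 n).filter fun c => d ∣ c).card : ℝ) := by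
    simp only [← sum_ind]
    exact Finset.sum_comm
  rw [h1]
  have h2 := harmonic_le_one_add_log n
  rw [harmonic_eq_sum_Icc] at h2
  push_cast at h2
  refine le_trans ?_ (mul_le_mul_of_nonneg_left h2 (Nat.cast_nonneg n))
  rw [Finset.mul_sum]
  refine Finset.sum_le_sum fun d _ => ?_
  have : (Icc 1 n).filter (fun c => d ∣ c) = (Ioc 0 n).filter (fun c => d ∣ c) := rfl
  rw [this, Nat.Ioc_filter_dvd_card_eq_div, ← div_eq_mul_inv]
  exact Nat.cast_div_le

/-- A random permutation is unlikely to have a long cycle whose length kills the permutation. -/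
lemma sum_trivial_power_le (r : ℕ) (hr : 0 < r) (hrn : r < Fintype.card α) :
    ∑ σ : Perm α, ind (∃ x, 3 * Fintype.card α < 4 * (cyc σ x).card ∧ σ ^ (cyc σ x).card = 1) ≤
      (Fintype.card α).factorial * ((4 / 3) * (1 + Real.log (Fintype.card α)) / r +
        r / (Fintype.card α - r)) := by
  set n := Fintype.card α with hn
  have hn0 : (0 : ℝ) < n := by exact_mod_cast (by omega : 0 < n)
  have hr0 : (0 : ℝ) < r := by exact_mod_cast hr
  have hnr : (0 : ℝ) < n - r := by
    have : (r : ℝ) < n := by exact_mod_cast hrn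
    linarith
  let A : Perm α → ℝ := fun σ => ∑ x, ∑ c ∈ Ioc (n - r) n, ind ((cyc σ x).card = c)
  let G : Perm α → ℝ := fun σ => ∑ x, ∑ z, ∑ c ∈ Icc 1 n, ∑ d ∈ (Icc 1 n).filter (fun d => d ∣ c),
    ind ((cyc σ x).card = c) * ind (z ∉ cyc σ x) * ind ((cyc σ z).card = d)
  have hA0 : ∀ σ, 0 ≤ A σ := fun σ =>
    Finset.sum_nonneg fun _ _ => Finset.sum_nonneg fun _ _ => ind_nonneg _
  have hT0 : ∀ (σ : Perm α) (x z : α) (c d : ℕ), 0 ≤ ind ((cyc σ x).card = c) * ind (z ∉ cyc σ x) *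
      ind ((cyc σ z).card = d) := fun σ x z c d =>
    mul_nonneg (mul_nonneg (ind_nonneg _) (ind_nonneg _)) (ind_nonneg _)
  have hG0 : ∀ σ, 0 ≤ G σ := fun σ =>
    Finset.sum_nonneg fun _ _ => Finset.sum_nonneg fun _ _ => Finset.sum_nonneg fun _ _ =>
      Finset.sum_nonneg fun _ _ => hT0 _ _ _ _ _
  have hpt : ∀ σ : Perm α,
      ind (∃ x, 3 * n < 4 * (cyc σ x).card ∧ σ ^ (cyc σ x).card = 1) ≤
      (1 / (n - r)) * A σ + 4 / (3 * n * r) * G σ := by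
    intro σ
    by_cases h : ∃ x, 3 * n < 4 * (cyc σ x).card ∧ σ ^ (cyc σ x).card = 1
    swap
    · rw [ind_neg h]
      have := hA0 σ; have := hG0 σ
      positivity
    rw [ind_pos h]
    obtain ⟨x, hx, hσ⟩ := h
    have hcn : (cyc σ x).card ≤ n := Finset.card_le_univ _
    rcases Nat.lt_or_ge (n - r) (cyc σ x).card with hc | hc
    · have h1 : (n : ℝ) - r ≤ A σ := by
        calc (n : ℝ) - r ≤ ((cyc σ x).card : ℝ) := by
              rw [← Nat.cast_sub hrn.le]; exact_mod_cast hc.le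
          _ = ∑ y ∈ cyc σ x, (1 : ℝ) := by simp
          _ ≤ ∑ y ∈ cyc σ x, ∑ c ∈ Ioc (n - r) n, ind ((cyc σ y).card = c) := by
              refine Finset.sum_le_sum fun y hy => ?_
              rw [cyc_eq hy, ← ind_pos (rfl : (cyc σ x).card = (cyc σ x).card)]
              exact Finset.single_le_sum (f := fun c => ind ((cyc σ x).card = c))
                (fun _ _ => ind_nonneg _) (mem_Ioc.2 ⟨hc, hcn⟩)
          _ ≤ A σ := Finset.sum_le_sum_of_subset_of_nonneg (subset_univ _)
              fun _ _ _ => Finset.sum_nonneg fun _ _ => ind_nonneg _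
      have h2 : 1 ≤ 1 / ((n : ℝ) - r) * A σ := by
        rw [one_div_mul_eq_div, le_div_iff₀ hnr]; linarith
      have : 0 ≤ 4 / (3 * n * r) * G σ := by have := hG0 σ; positivity
      linarith
    · have h1 : 3 * n / 4 * r ≤ G σ := by
        calc 3 * (n : ℝ) / 4 * r ≤ ((cyc σ x).card : ℝ) * ((cyc σ x)ᶜ.card : ℝ) := by
              rw [Finset.card_compl]
              have h1 : (3 * n : ℝ) ≤ 4 * (cyc σ x).card := by exact_mod_cast hx.le
              have h2 : (r : ℝ) ≤ ((Fintype.card α - (cyc σ x).card : ℕ) : ℝ) := by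
                exact_mod_cast (by omega)
              exact mul_le_mul (by linarith) h2 hr0.le (by positivity)
          _ = ∑ y ∈ cyc σ x, ∑ z ∈ (cyc σ x)ᶜ, (1 : ℝ) := by simp
          _ ≤ ∑ y ∈ cyc σ x, ∑ z ∈ (cyc σ x)ᶜ, ∑ c ∈ Icc 1 n,
                ∑ d ∈ (Icc 1 n).filter (fun d => d ∣ c),
                ind ((cyc σ y).card = c) * ind (z ∉ cyc σ y) * ind ((cyc σ z).card = d) := by
              refine Finset.sum_le_sum fun y hy => Finset.sum_le_sum fun z hz => ?_
              have hz' : z ∉ cyc σ y := by rw [cyc_eq hy]; exact mem_compl.1 hz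
              have hd : (cyc σ z).card ∣ (cyc σ y).card := by
                rw [← pow_apply_eq_self_iff, cyc_eq hy, hσ]; rfl
              have hyn : (cyc σ y).card ∈ Icc 1 n := mem_Icc.2 ⟨card_cyc_pos _ _, card_le_univ _⟩
              have hzn : (cyc σ z).card ∈ (Icc 1 n).filter (fun d => d ∣ (cyc σ y).card) :=
                mem_filter.2 ⟨mem_Icc.2 ⟨card_cyc_pos _ _, card_le_univ _⟩, hd⟩
              refine le_trans ?_ (Finset.single_le_sum (f := fun c =>
                ∑ d ∈ (Icc 1 n).filter (fun d => d ∣ c),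
                ind ((cyc σ y).card = c) * ind (z ∉ cyc σ y) * ind ((cyc σ z).card = d))
                (fun _ _ => Finset.sum_nonneg fun _ _ => hT0 _ _ _ _ _) hyn)
              refine le_trans ?_ (Finset.single_le_sum (f := fun d =>
                ind ((cyc σ y).card = (cyc σ y).card) * ind (z ∉ cyc σ y) *
                  ind ((cyc σ z).card = d)) (fun _ _ => hT0 _ _ _ _ _) hzn)
              simp only [ind_pos hz', ind_pos]
              norm_num
          _ ≤ ∑ y ∈ cyc σ x, ∑ z, ∑ c ∈ Icc 1 n,
                ∑ d ∈ (Icc 1 n).filter (fun d => d ∣ c),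
                ind ((cyc σ y).card = c) * ind (z ∉ cyc σ y) * ind ((cyc σ z).card = d) :=
              Finset.sum_le_sum fun y _ => Finset.sum_le_sum_of_subset_of_nonneg (subset_univ _)
                fun _ _ _ => Finset.sum_nonneg fun _ _ => Finset.sum_nonneg fun _ _ =>
                  hT0 _ _ _ _ _
          _ ≤ G σ := Finset.sum_le_sum_of_subset_of_nonneg (subset_univ _)
                fun _ _ _ => Finset.sum_nonneg fun _ _ => Finset.sum_nonneg fun _ _ =>
                  Finset.sum_nonneg fun _ _ => hT0 _ _ _ _ _
      have h2 : 1 ≤ 4 / (3 * n * r) * G σ := by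
        rw [div_mul_eq_mul_div, le_div_iff₀ (by positivity)]; linarith
      have : 0 ≤ 1 / ((n : ℝ) - r) * A σ := by have := hA0 σ; positivity
      linarith
  have hAs : ∑ σ, A σ ≤ n.factorial * r := by
    calc ∑ σ, A σ = ∑ x : α, ∑ c ∈ Ioc (n - r) n, ∑ σ : Perm α, ind ((cyc σ x).card = c) := by
          rw [Finset.sum_comm]
          exact Finset.sum_congr rfl fun x _ => Finset.sum_comm
      _ ≤ ∑ x : α, ∑ c ∈ Ioc (n - r) n, (n.factorial / n : ℝ) := by
          refine Finset.sum_le_sum fun x _ => Finset.sum_le_sum fun c hc => ?_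
          rw [le_div_iff₀ hn0, mul_comm]
          exact sum_ind_card_cyc_le x c (by have := (mem_Ioc.1 hc).1; omega)
      _ = n.factorial * r := by
          simp only [Finset.sum_const, Nat.card_Ioc, Finset.card_univ, nsmul_eq_mul, ← hn]
          rw [Nat.sub_sub_self hrn.le]
          field_simp
  have hGs : ∑ σ, G σ ≤ n.factorial * (n * (1 + Real.log n)) := by
    calc ∑ σ, G σ = ∑ c ∈ Icc 1 n, ∑ d ∈ (Icc 1 n).filter (fun d => d ∣ c), ∑ x : α, ∑ z,
            ∑ σ : Perm α, ind ((cyc σ x).card = c) * ind (z ∉ cyc σ x) *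
              ind ((cyc σ z).card = d) := by
          have h1 : ∀ σ, G σ = ∑ c ∈ Icc 1 n, ∑ d ∈ (Icc 1 n).filter (fun d => d ∣ c), ∑ x : α, ∑ z,
            ind ((cyc σ x).card = c) * ind (z ∉ cyc σ x) * ind ((cyc σ z).card = d) := by
            intro σ
            simp only [G]
            simp only [Finset.sum_comm (s := (univ : Finset α)) (t := Icc 1 n)]
            refine Finset.sum_congr rfl fun c _ => ?_
            simp only [Finset.sum_comm (s := (univ : Finset α))
              (t := (Icc 1 n).filter (fun d => d ∣ c))]
          simp only [h1]
          rw [Finset.sum_comm]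
          refine Finset.sum_congr rfl fun c _ => ?_
          rw [Finset.sum_comm]
          refine Finset.sum_congr rfl fun d _ => ?_
          rw [Finset.sum_comm]
          exact Finset.sum_congr rfl fun x _ => Finset.sum_comm
      _ ≤ ∑ c ∈ Icc 1 n, ∑ d ∈ (Icc 1 n).filter (fun d => d ∣ c), ∑ x : α,
            (n.factorial / n : ℝ) := by
          refine Finset.sum_le_sum fun c hc => Finset.sum_le_sum fun d hd =>
            Finset.sum_le_sum fun x _ => ?_
          rw [le_div_iff₀ hn0, mul_comm]
          exact sum_two_cycles_le x c d (mem_Icc.1 hc).1 (mem_Icc.1 (mem_filter.1 hd).1).1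
      _ = n.factorial * ∑ c ∈ Icc 1 n, (((Icc 1 n).filter fun d => d ∣ c).card : ℝ) := by
          simp only [Finset.sum_const, Finset.card_univ, nsmul_eq_mul, ← hn]
          rw [Finset.mul_sum]
          refine Finset.sum_congr rfl fun c _ => ?_
          field_simp
      _ ≤ _ := mul_le_mul_of_nonneg_left (sum_card_dvd_le n) (by positivity)
  calc _ ≤ ∑ σ, ((1 / (n - r)) * A σ + 4 / (3 * n * r) * G σ) := Finset.sum_le_sum fun σ _ => hpt σ
    _ = (1 / (n - r)) * ∑ σ, A σ + 4 / (3 * n * r) * ∑ σ, G σ := by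
        rw [Finset.sum_add_distrib, Finset.mul_sum, Finset.mul_sum]
    _ ≤ (1 / (n - r)) * (n.factorial * r) +
          4 / (3 * n * r) * (n.factorial * (n * (1 + Real.log n))) := by gcongr
    _ = _ := by field_simp; ring

omit [Fintype α] [DecidableEq α] in
lemma pow_mul_apply_of_fixed {γ κ : Perm α} {z : α} {j : ℕ}
    (h : ∀ i < j, κ ((γ ^ i) z) = (γ ^ i) z) : ((γ * κ) ^ j) z = (γ ^ j) z := by
  induction j with
  | zero => rfl
  | succ j ih =>
    rw [pow_succ', pow_succ', Perm.mul_apply, Perm.mul_apply, ih (fun i hi => h i (by omega)),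
      Perm.mul_apply, h j (by omega)]

/-- Values that the next point of the orbit of `y` under `γ` should avoid, so that the points
`γ ^ i y` and `τ⁻¹ (γ ^ (i + 1) y)` are all distinct. -/
def collisions (τ γ : Perm α) (y : α) (j : ℕ) : Finset α :=
  ((range (j + 1)).image fun i => (γ ^ i) y) ∪
    ((range j).image fun i => τ⁻¹ ((γ ^ (i + 1)) y)) ∪
    ((range (j + 1)).image fun i => τ ((γ ^ i) y)) ∪ univ.filter fun p => τ p = p

lemma card_collisions_le (τ γ : Perm α) (y : α) (j : ℕ) :
    (collisions τ γ y j).card ≤ 3 * (j + 1) + (univ.filter fun p => τ p = p).card := by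
  unfold collisions
  refine (card_union_le _ _).trans (Nat.add_le_add_right ?_ _)
  refine (card_union_le _ _).trans ?_
  have h1 := card_union_le ((range (j + 1)).image fun i => (γ ^ i) y)
    ((range j).image fun i => τ⁻¹ ((γ ^ (i + 1)) y))
  have h2 := card_image_le (s := range (j + 1)) (f := fun i => (γ ^ i) y)
  have h3 := card_image_le (s := range j) (f := fun i => τ⁻¹ ((γ ^ (i + 1)) y))
  have h4 := card_image_le (s := range (j + 1)) (f := fun i => τ ((γ ^ i) y))
  rw [card_range] at h2 h3 h4
  omega

lemma collisions_congr {τ γ γ' : Perm α} {y : α} {j : ℕ}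
    (h : ∀ i ≤ j, (γ' ^ i) y = (γ ^ i) y) : collisions τ γ' y j = collisions τ γ y j := by
  unfold collisions
  congr 1
  congr 1
  congr 1
  · exact Finset.image_congr fun i hi => h i (by simp at hi; omega)
  · refine Finset.image_congr fun i hi => ?_
    have : i < j := by simpa using hi
    simp only [h (i + 1) (by omega)]
  · refine Finset.image_congr fun i hi => ?_
    have : i < j + 1 := by simpa using hi
    simp only [h i (by omega)]

lemma notMem_collisions {τ γ : Perm α} {y : α} {j : ℕ} (h : (γ ^ (j + 1)) y ∉ collisions τ γ y j) :
    (∀ i ≤ j, (γ ^ (j + 1)) y ≠ (γ ^ i) y) ∧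
    (∀ i < j, (γ ^ (j + 1)) y ≠ τ⁻¹ ((γ ^ (i + 1)) y)) ∧
    (∀ i ≤ j, τ⁻¹ ((γ ^ (j + 1)) y) ≠ (γ ^ i) y) ∧ τ⁻¹ ((γ ^ (j + 1)) y) ≠ (γ ^ (j + 1)) y := by
  simp only [collisions, mem_union, mem_image, mem_range, mem_filter, mem_univ, true_and,
    not_or, not_exists, not_and] at h
  obtain ⟨⟨⟨h1, h2⟩, h3⟩, h4⟩ := h
  refine ⟨fun i hi he => h1 i (by omega) he.symm, fun i hi he => h2 i hi he.symm,
    fun i hi he => h3 i (by omega) ?_, fun he => h4 ?_⟩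
  · rw [← he]; simp
  · rw [Perm.inv_eq_iff_eq] at he; exact he.symm

lemma orbit_ne {τ γ : Perm α} {y : α} {T : ℕ}
    (h : ∀ j < T, (γ ^ (j + 1)) y ∉ collisions τ γ y j) {a b : ℕ} (hab : a < b) (hb : b ≤ T) :
    (γ ^ a) y ≠ (γ ^ b) y := by
  obtain ⟨j, rfl⟩ : ∃ j, b = j + 1 := ⟨b - 1, by omega⟩
  exact ((notMem_collisions (h j (by omega))).1 a (by omega)).symm

lemma orbit_ne_inv {τ γ : Perm α} {y : α} {T : ℕ}
    (h : ∀ j < T, (γ ^ (j + 1)) y ∉ collisions τ γ y j) {a b : ℕ} (ha : a ≤ T) (hb : b < T) :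
    (γ ^ a) y ≠ τ⁻¹ ((γ ^ (b + 1)) y) := by
  have hbb := notMem_collisions (h b hb)
  rcases Nat.lt_trichotomy a (b + 1) with hlt | heq | hlt
  · exact (hbb.2.2.1 a (by omega)).symm
  · rw [heq]; exact hbb.2.2.2.symm
  · obtain ⟨j, rfl⟩ : ∃ j, a = j + 1 := ⟨a - 1, by omega⟩
    exact (notMem_collisions (h j (by omega))).2.1 b (by omega)

lemma sum_collision_le (τ : Perm α) (y : α) (T : ℕ) (hT : T < Fintype.card α) :
    ∑ σ : Perm α, ind (∃ j ∈ range T, ((τ * σ) ^ (j + 1)) y ∈ collisions τ (τ * σ) y j) ≤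
      (Fintype.card α).factorial * (T * (3 * T + (univ.filter fun p => τ p = p).card) /
        (Fintype.card α - T)) := by
  have hpos : (0 : ℝ) < Fintype.card α - T := by
    have : (T : ℝ) < Fintype.card α := by exact_mod_cast hT
    linarith
  have hstep : ∀ j ∈ range T, ∑ σ : Perm α,
      ind (∀ i < j, ((τ * σ) ^ (i + 1)) y ∉ collisions τ (τ * σ) y i) *
        ind (((τ * σ) ^ (j + 1)) y ∈ collisions τ (τ * σ) y j) ≤
      (Fintype.card α).factorial * ((3 * T + (univ.filter fun p => τ p = p).card) /
        (Fintype.card α - T)) := by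
    intro j hj
    rw [mem_range] at hj
    have key := sum_reveal_le (Ω := Perm α) (fun σ => τ * σ) (fun σ π => σ * π)
      (fun _ _ => (mul_assoc _ _ _).symm) (by simp)
      (fun σ => ind (∀ i < j, ((τ * σ) ^ (i + 1)) y ∉ collisions τ (τ * σ) y i))
      (fun σ => ((τ * σ) ^ j) y) (fun σ => ((range j).image fun i => ((τ * σ) ^ i) y)ᶜ)
      (fun σ => collisions τ (τ * σ) y j) (by
        intro σ h0 z hz
        have hg := ne_zero_of_ind h0
        simp only [mem_compl, mem_image, mem_range, not_exists, not_and] at hz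
        have h1 : ∀ i ≤ j, ((τ * (σ * swap (((τ * σ) ^ j) y) z)) ^ i) y = ((τ * σ) ^ i) y := by
          intro i hi
          rw [← mul_assoc]
          exact pow_apply_mul_swap (fun a ha => orbit_ne hg (by omega) le_rfl)
            (fun a ha => hz a (by omega))
        refine ⟨ind_congr ?_, h1 j le_rfl, ?_, collisions_congr h1⟩
        · refine forall₂_congr fun i hi => ?_
          rw [h1 (i + 1) (by omega), collisions_congr fun a ha => h1 a (by omega)]
        · congr 1
          refine Finset.image_congr fun i hi => h1 i ?_
          simp at hi; omega) (fun _ => ind_nonneg _) (Fintype.card α - T)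
      (3 * T + (univ.filter fun p => τ p = p).card) (by
        intro σ _
        rw [card_compl]
        have h1 := card_image_le (s := range j) (f := fun i => ((τ * σ) ^ i) y)
        rw [card_range] at h1
        rw [← Nat.cast_sub hT.le]
        exact_mod_cast (by omega)) (by
        intro σ _
        have := card_collisions_le τ (τ * σ) y j
        exact_mod_cast (by omega : _ ≤ 3 * T + (univ.filter fun p => τ p = p).card))
    rw [← mul_div_assoc, le_div_iff₀ hpos, mul_comm]
    simp only [pow_succ' _ j, Perm.mul_apply τ, Perm.mul_apply (τ * _)] at key ⊢
    refine key.trans ?_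
    rw [mul_comm]
    refine mul_le_mul_of_nonneg_right ?_ (by positivity)
    calc _ ≤ ∑ σ : Perm α, (1 : ℝ) := Finset.sum_le_sum fun _ _ => ind_le_one _
      _ = _ := by simp [Fintype.card_perm]
  calc _ ≤ ∑ σ : Perm α, ∑ j ∈ range T,
      ind (∀ i < j, ((τ * σ) ^ (i + 1)) y ∉ collisions τ (τ * σ) y i) *
        ind (((τ * σ) ^ (j + 1)) y ∈ collisions τ (τ * σ) y j) := by
        refine Finset.sum_le_sum fun σ _ => ?_
        simp only [← ind_and]
        refine le_trans (ind_mono ?_) (ind_exists_le _)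
        rintro ⟨j, hj, hc⟩
        classical
        have hex : ∃ j, ((τ * σ) ^ (j + 1)) y ∈ collisions τ (τ * σ) y j := ⟨j, hc⟩
        refine ⟨Nat.find hex, ?_, fun i hi => Nat.find_min hex hi, Nat.find_spec hex⟩
        rw [mem_range] at hj ⊢
        exact (Nat.find_min' hex hc).trans_lt hj
    _ ≤ ∑ j ∈ range T, ((Fintype.card α).factorial *
          ((3 * T + (univ.filter fun p => τ p = p).card) / (Fintype.card α - T)) : ℝ) := by
        rw [Finset.sum_comm]
        exact Finset.sum_le_sum hstep
    _ = _ := by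
        rw [Finset.sum_const, card_range, nsmul_eq_mul]
        ring

/-- A long stretch of a `τ σ`-orbit is unlikely to stay inside one `σ`-cycle. -/
lemma sum_orbit_in_cycle_le (τ : Perm α) (y : α) (T : ℕ) (hT0 : 0 < T) (hT : T < Fintype.card α) :
    ∑ σ : Perm α, ind (∀ i < T, ∀ j < T, σ.SameCycle (((τ * σ) ^ i) y) (((τ * σ) ^ j) y)) ≤
      (Fintype.card α).factorial * (1 / T +
        T * (3 * T + (univ.filter fun p => τ p = p).card) / (Fintype.card α - T)) := by
  let good : Perm α → Prop := fun σ => ∀ j < T, ((τ * σ) ^ (j + 1)) y ∉ collisions τ (τ * σ) y j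
  let F : Perm α → Finset α := fun σ => (range T).image fun j => τ⁻¹ (((τ * σ) ^ (j + 1)) y)
  have key := sum_sameCycle (fun σ => ind (good σ)) F (fun σ => σ) (by
    intro σ h0 κ hκ
    have hg := ne_zero_of_ind h0
    rw [mem_fixOutside] at hκ
    have h1 : ∀ j ≤ T, ((τ * (σ * κ)) ^ j) y = ((τ * σ) ^ j) y := by
      intro j hj
      rw [← mul_assoc]
      refine pow_mul_apply_of_fixed fun i hi => hκ _ ?_
      simp only [F, mem_image, mem_range, not_exists, not_and]
      exact fun b hb he => orbit_ne_inv hg (by omega) hb he.symm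
    refine ⟨ind_congr ?_, ?_, rfl⟩
    · refine forall₂_congr fun j hj => ?_
      rw [h1 (j + 1) (by omega), collisions_congr fun a ha => h1 a (by omega)]
    · refine Finset.image_congr fun j hj => ?_
      have : j < T := by simpa using hj
      simp only [h1 (j + 1) (by omega)]) hT0 (by
    intro σ h0
    have hg := ne_zero_of_ind h0
    rw [Finset.card_image_of_injOn, card_range]
    intro a ha b hb hab
    simp only [coe_range, Set.mem_Iio] at ha hb
    have hab' : ((τ * σ) ^ (a + 1)) y = ((τ * σ) ^ (b + 1)) y := τ⁻¹.injective hab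
    by_contra hne
    rcases lt_or_gt_of_ne hne with hlt | hlt
    · exact orbit_ne hg (Nat.succ_lt_succ hlt) (by omega) hab'
    · exact orbit_ne hg (Nat.succ_lt_succ hlt) (by omega) hab'.symm)
  have hle : ∑ σ : Perm α, ind (good σ) ≤ (Fintype.card α).factorial := by
    calc _ ≤ ∑ σ : Perm α, (1 : ℝ) := Finset.sum_le_sum fun _ _ => ind_le_one _
      _ = _ := by simp [Fintype.card_perm]
  have hT' : (0 : ℝ) < T := by exact_mod_cast hT0
  calc _ ≤ ∑ σ : Perm α, (ind (good σ) * ind (∀ x ∈ F σ, ∀ y ∈ F σ, σ.SameCycle x y) +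
        ind (∃ j ∈ range T, ((τ * σ) ^ (j + 1)) y ∈ collisions τ (τ * σ) y j)) := by
        refine Finset.sum_le_sum fun σ _ => ?_
        rw [← ind_and]
        refine le_trans (ind_mono fun h => ?_) (ind_or_le _ _)
        by_cases hg : good σ
        · refine Or.inl ⟨hg, ?_⟩
          have hF : ∀ j, τ⁻¹ (((τ * σ) ^ (j + 1)) y) = σ (((τ * σ) ^ j) y) := by
            intro j
            rw [pow_succ', Perm.mul_apply, Perm.mul_apply]
            simp
          intro a ha b hb
          obtain ⟨i, hi, rfl⟩ := mem_image.1 ha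
          obtain ⟨j, hj, rfl⟩ := mem_image.1 hb
          rw [hF, hF, Perm.sameCycle_apply_left, Perm.sameCycle_apply_right]
          exact h i (mem_range.1 hi) j (mem_range.1 hj)
        · right
          by_contra hc
          push Not at hc
          exact hg fun j hj => hc j (mem_range.2 hj)
    _ ≤ (Fintype.card α).factorial / T + _ := by
        rw [Finset.sum_add_distrib]
        refine add_le_add ?_ (sum_collision_le τ y T hT)
        rw [le_div_iff₀ hT', mul_comm, key]
        exact hle
    _ = _ := by ring

/-- The image of a point under a power of a random permutation is close to uniform. -/
lemma sum_pow_apply_eq_le (a : ℕ) {y y' : α} (hy : y ≠ y') (hn : 2 ≤ Fintype.card α) :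
    ∑ γ : Perm α, ind ((γ ^ a) y = y') ≤
      (Fintype.card α).factorial / (Fintype.card α - 1) := by
  have h1 : ∀ z ∈ univ.erase y, ∑ γ : Perm α, ind ((γ ^ a) y = z) =
      ∑ γ : Perm α, ind ((γ ^ a) y = y') := by
    intro z hz
    have hz' : z ≠ y := (mem_erase.1 hz).1
    refine Fintype.sum_equiv (MulAut.conj (swap z y')).toEquiv _ _ fun γ => ind_congr ?_
    change _ ↔ ((MulAut.conj (swap z y') γ) ^ a) y = y'
    rw [← map_pow, MulAut.conj_apply, swap_inv, Perm.mul_apply, Perm.mul_apply,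
      swap_apply_of_ne_of_ne hz'.symm hy, swap_apply_eq_iff, swap_apply_right]
  have h2 : ∑ z ∈ univ.erase y, ∑ γ : Perm α, ind ((γ ^ a) y = z) ≤ (Fintype.card α).factorial := by
    rw [Finset.sum_comm]
    calc _ ≤ ∑ γ : Perm α, ∑ z, ind ((γ ^ a) y = z) := Finset.sum_le_sum fun γ _ =>
          Finset.sum_le_sum_of_subset_of_nonneg (subset_univ _) fun _ _ _ => ind_nonneg _
      _ = _ := by simp [ind_eq_ite, Fintype.card_perm]
  rw [Finset.sum_congr rfl h1, Finset.sum_const, card_erase_of_mem (mem_univ _), nsmul_eq_mul,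
    card_univ, Nat.cast_sub (by omega)] at h2
  have : (2 : ℝ) ≤ Fintype.card α := by exact_mod_cast hn
  rw [le_div_iff₀ (by linarith), mul_comm]
  simpa using h2

/-- All entries of the tuple lie in a single cycle. -/
def Tied {s : ℕ} (γ : Perm α) (y : Fin (s + 1) → α) : Prop := ∀ i, γ.SameCycle (y 0) (y i)

omit [Fintype α] [DecidableEq α] in
lemma Tied.sameCycle {s : ℕ} {γ : Perm α} {y : Fin (s + 1) → α} (h : Tied γ y) (i j) :
    γ.SameCycle (y i) (y j) := (h i).symm.trans (h j)

lemma sum_ind_tied {s : ℕ} {x : Fin (s + 1) → α} (hx : Function.Injective x) :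
    ((s + 1 : ℕ) : ℝ) * ∑ σ : Perm α, ind (Tied σ x) = (Fintype.card α).factorial := by
  have := sum_sameCycle (fun _ => 1) (fun _ => univ.image x) (fun σ => σ) (by simp)
    (Nat.succ_pos s) (fun σ _ => by rw [card_image_of_injective _ hx]; simp)
  simp only [one_mul, sum_const, card_univ, Fintype.card_perm, nsmul_eq_mul, mul_one] at this
  rw [← this]
  congr 1
  refine Finset.sum_congr rfl fun σ _ => ind_congr ?_
  constructor
  · intro h a ha b hb
    obtain ⟨i, -, rfl⟩ := mem_image.1 ha
    obtain ⟨j, -, rfl⟩ := mem_image.1 hb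
    exact h.sameCycle i j
  · intro h i
    exact h _ (mem_image_of_mem _ (mem_univ _)) _ (mem_image_of_mem _ (mem_univ _))

/-- The orbit of `y` first leaves `X` after exactly `j` steps. -/
def Exits (γ : Perm α) (X : Finset α) (y : α) (j : ℕ) : Prop :=
  (γ ^ j) y ∉ X ∧ ∀ i < j, (γ ^ i) y ∈ X

omit [Fintype α] [DecidableEq α] in
lemma Exits.unique {γ : Perm α} {X : Finset α} {y : α} {i j : ℕ} (hi : Exits γ X y i)
    (hj : Exits γ X y j) : i = j := by
  rcases Nat.lt_trichotomy i j with h | h | h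
  · exact absurd (hj.2 i h) hi.1
  · exact h
  · exact absurd (hi.2 j h) hj.1

lemma cyc_mul_of_fixed {σ κ : Perm α} {x : α} (h : ∀ p ∈ cyc σ x, κ p = p) :
    cyc (σ * κ) x = cyc σ x := by
  have h2 : ∀ j, ((σ * κ) ^ j) x = (σ ^ j) x := fun j =>
    pow_mul_apply_of_fixed fun i _ => h _ (mem_cyc.2 ⟨i, by simp⟩)
  ext y
  rw [mem_cyc, mem_cyc]
  constructor
  · intro h
    obtain ⟨i, -, rfl⟩ := h.exists_pow_eq'
    rw [h2]; exact ⟨i, by simp⟩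
  · intro h
    obtain ⟨i, -, rfl⟩ := h.exists_pow_eq'
    rw [← h2]; exact ⟨i, by simp⟩

lemma sum_tied_exits {s : ℕ} (τ : Perm α) (x y : Fin (s + 1) → α) (T : ℕ)
    (hx : Function.Injective x) :
    ((s + 1 : ℕ) : ℝ) ^ 2 * ∑ σ : Perm α, ind (Tied σ x ∧ Tied (τ * σ) y ∧
      ∃ J : Fin (s + 1) → ℕ, (∀ i, J i < T ∧ Exits (τ * σ) (cyc σ (x 0)) (y i) (J i)) ∧
        Function.Injective fun i => ((τ * σ) ^ J i) (y i)) ≤ (Fintype.card α).factorial := by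
  classical
  let good : Perm α → Prop := fun σ =>
    ∃ J : Fin (s + 1) → ℕ, (∀ i, J i < T ∧ Exits (τ * σ) (cyc σ (x 0)) (y i) (J i)) ∧
        Function.Injective fun i => ((τ * σ) ^ J i) (y i)
  let F : Perm α → Finset α := fun σ => univ.filter fun z => ∃ i j, j < T ∧
    Exits (τ * σ) (cyc σ (x 0)) (y i) j ∧ z = ((τ * σ) ^ j) (y i)
  have hF : ∀ σ z, z ∈ F σ ↔ ∃ i j, j < T ∧
    Exits (τ * σ) (cyc σ (x 0)) (y i) j ∧ z = ((τ * σ) ^ j) (y i) := by simp [F]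
  have hFX : ∀ σ, ∀ p ∈ cyc σ (x 0), p ∉ F σ := by
    intro σ p hp hpF
    obtain ⟨i, j, -, hj, rfl⟩ := (hF _ _).1 hpF
    exact hj.1 hp
  have key := sum_sameCycle (fun σ => ind (Tied σ x ∧ good σ)) F (fun σ => τ * σ) (by
    intro σ h0 κ hκ
    obtain ⟨hx, hg⟩ := ne_zero_of_ind h0
    rw [mem_fixOutside] at hκ
    have hX : cyc (σ * κ) (x 0) = cyc σ (x 0) :=
      cyc_mul_of_fixed fun p hp => hκ p (hFX σ p hp)
    obtain ⟨J, hJ, hinj⟩ := hg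
    have hpath : ∀ i, ∀ j ≤ J i, ((τ * (σ * κ)) ^ j) (y i) = ((τ * σ) ^ j) (y i) := by
      intro i j hj
      rw [← mul_assoc]
      exact pow_mul_apply_of_fixed fun a ha => hκ _ (hFX σ _ ((hJ i).2.2 a (by omega)))
    have hJ' : ∀ i, Exits (τ * (σ * κ)) (cyc (σ * κ) (x 0)) (y i) (J i) := by
      intro i
      rw [hX]
      refine ⟨?_, fun a ha => ?_⟩
      · rw [hpath i _ le_rfl]; exact (hJ i).2.1
      · rw [hpath i a ha.le]; exact (hJ i).2.2 a ha
    refine ⟨?_, ?_, (mul_assoc _ _ _).symm⟩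
    · rw [ind_pos (⟨hx, J, hJ, hinj⟩ : Tied σ x ∧ good σ), ind_pos]
      refine ⟨fun i => ?_, J, fun i => ⟨(hJ i).1, hJ' i⟩, ?_⟩
      · rw [← mem_cyc, hX, mem_cyc]; exact hx i
      · simpa only [hpath _ _ le_rfl] using hinj
    · ext z
      rw [hF, hF]
      refine exists_congr fun i => exists_congr fun j => and_congr_right fun _ => ?_
      constructor
      · rintro ⟨h1, h2⟩
        obtain rfl := h1.unique (hJ' i)
        exact ⟨(hJ i).2, h2.trans (hpath i _ le_rfl)⟩
      · rintro ⟨h1, h2⟩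
        obtain rfl := h1.unique (hJ i).2
        exact ⟨hJ' i, h2.trans (hpath i _ le_rfl).symm⟩) (Nat.succ_pos s) (by
    intro σ h0
    obtain ⟨-, J, hJ, hinj⟩ := ne_zero_of_ind h0
    have : F σ = univ.image fun i => ((τ * σ) ^ J i) (y i) := by
      ext z
      rw [hF, mem_image]
      constructor
      · rintro ⟨i, j, -, h1, rfl⟩
        obtain rfl := h1.unique (hJ i).2
        exact ⟨i, mem_univ _, rfl⟩
      · rintro ⟨i, -, rfl⟩
        exact ⟨i, J i, (hJ i).1, (hJ i).2, rfl⟩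
    rw [this, card_image_of_injective _ hinj]
    simp)
  have h1 : ∑ σ : Perm α, ind (Tied σ x ∧ Tied (τ * σ) y ∧ good σ) ≤
      ∑ σ : Perm α, ind (Tied σ x ∧ good σ) *
        ind (∀ a ∈ F σ, ∀ b ∈ F σ, (τ * σ).SameCycle a b) := by
    refine Finset.sum_le_sum fun σ _ => ?_
    rw [← ind_and]
    refine ind_mono ?_
    rintro ⟨h1, h2, h3⟩
    refine ⟨⟨h1, h3⟩, fun a ha b hb => ?_⟩
    obtain ⟨i, j, -, -, rfl⟩ := (hF _ _).1 ha
    obtain ⟨i', j', -, -, rfl⟩ := (hF _ _).1 hb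
    rw [Perm.sameCycle_pow_left, Perm.sameCycle_pow_right]
    exact h2.sameCycle i i'
  have h2 : ∑ σ : Perm α, ind (Tied σ x ∧ good σ) ≤ ∑ σ : Perm α, ind (Tied σ x) :=
    Finset.sum_le_sum fun σ _ => ind_mono fun h => h.1
  calc _ ≤ ((s + 1 : ℕ) : ℝ) ^ 2 * _ := mul_le_mul_of_nonneg_left h1 (by positivity)
    _ = ((s + 1 : ℕ) : ℝ) * ∑ σ : Perm α, ind (Tied σ x ∧ good σ) := by rw [← key]; ring
    _ ≤ ((s + 1 : ℕ) : ℝ) * ∑ σ : Perm α, ind (Tied σ x) :=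
        mul_le_mul_of_nonneg_left h2 (by positivity)
    _ = _ := sum_ind_tied hx

/-- Error term in the near independence of cycle structures of `σ` and `τ σ`. -/
noncomputable def corrError (s T n fix : ℝ) : ℝ :=
  (s + 1) * (1 / T + T * (3 * T + fix) / (n - T)) + (s + 1) ^ 2 * T / (n - 1)

lemma sum_tied_tied_le {s : ℕ} (τ : Perm α) (x y : Fin (s + 1) → α) (T : ℕ) (hT0 : 0 < T)
    (hT : T < Fintype.card α) (hx : Function.Injective x) (hy : Function.Injective y)
    (hn : 2 ≤ Fintype.card α) :
    ∑ σ : Perm α, ind (Tied σ x) * ind (Tied (τ * σ) y) ≤ (Fintype.card α).factorial *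
      (1 / ((s : ℝ) + 1) ^ 2 + corrError s T (Fintype.card α)
        (univ.filter fun p => τ p = p).card) := by
  set n := Fintype.card α
  set φ := (univ.filter fun p => τ p = p).card
  have hsplit : ∀ σ : Perm α, ind (Tied σ x) * ind (Tied (τ * σ) y) ≤
      ind (Tied σ x ∧ Tied (τ * σ) y ∧
      ∃ J : Fin (s + 1) → ℕ, (∀ i, J i < T ∧ Exits (τ * σ) (cyc σ (x 0)) (y i) (J i)) ∧
        Function.Injective fun i => ((τ * σ) ^ J i) (y i)) +
      (∑ i, ind (∀ a < T, ∀ b < T, σ.SameCycle (((τ * σ) ^ a) (y i)) (((τ * σ) ^ b) (y i))) +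
       ∑ i, ∑ i', ∑ a ∈ range T, ind (y i ≠ y i') * ind (((τ * σ) ^ a) (y i) = y i')) := by
    intro σ
    rw [← ind_and]
    refine le_trans (ind_mono (Q := _ ∨ ((∃ i ∈ univ, _) ∨ ∃ i ∈ univ, ∃ i' ∈ univ,
      ∃ a ∈ range T, (y i ≠ y i' ∧ ((τ * σ) ^ a) (y i) = y i'))) ?_)
      ((ind_or_le _ _).trans (add_le_add le_rfl ((ind_or_le _ _).trans
      (add_le_add (ind_exists_le (fun i => ∀ a < T, ∀ b < T, σ.SameCycle (((τ * σ) ^ a) (y i))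
        (((τ * σ) ^ b) (y i)))) ?_))))
    · rintro ⟨h1, h2⟩
      by_cases hex : ∀ i, ∃ a < T, ((τ * σ) ^ a) (y i) ∉ cyc σ (x 0)
      · have hex' : ∀ i, ∃ j, j < T ∧ Exits (τ * σ) (cyc σ (x 0)) (y i) j := by
          intro i
          classical
          obtain ⟨a, ha, hc⟩ := hex i
          have he : ∃ a, ((τ * σ) ^ a) (y i) ∉ cyc σ (x 0) := ⟨a, hc⟩
          exact ⟨Nat.find he, (Nat.find_min' he hc).trans_lt ha, Nat.find_spec he,
            fun b hb => not_not.1 (Nat.find_min he hb)⟩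
        choose J hJ using hex'
        by_cases hinj : Function.Injective fun i => ((τ * σ) ^ J i) (y i)
        · exact Or.inl ⟨h1, h2, J, hJ, hinj⟩
        · right; right
          simp only [Function.Injective] at hinj
          push Not at hinj
          have main : ∀ i i', i ≠ i' → J i' ≤ J i →
              ((τ * σ) ^ J i) (y i) = ((τ * σ) ^ J i') (y i') →
              ∃ i ∈ univ, ∃ i' ∈ univ,
                ∃ a ∈ range T, (y i ≠ y i' ∧ ((τ * σ) ^ a) (y i) = y i') := by
            intro i i' hne hle he
            refine ⟨i, mem_univ _, i', mem_univ _, J i - J i', mem_range.2 ?_,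
              fun hc => hne (hy hc), ?_⟩
            · have := (hJ i).1; omega
            · apply ((τ * σ) ^ J i').injective
              rw [← Perm.mul_apply, ← pow_add, Nat.add_sub_cancel' hle, he]
          obtain ⟨i, i', he, hne⟩ := hinj
          rcases le_total (J i') (J i) with hle | hle
          · exact main i i' hne hle he
          · exact main i' i hne.symm hle he.symm
      · right; left
        push Not at hex
        obtain ⟨i, hi⟩ := hex
        refine ⟨i, mem_univ _, fun a ha b hb => ?_⟩
        have ha' := mem_cyc.1 (hi a ha)
        exact ha'.symm.trans (mem_cyc.1 (hi b hb))
    · simp only [← ind_and]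
      refine (ind_exists_le _).trans (Finset.sum_le_sum fun i _ => ?_)
      refine (ind_exists_le _).trans (Finset.sum_le_sum fun i' _ => ?_)
      exact ind_exists_le _
  have hmain := sum_tied_exits τ x y T hx
  have hs : (0 : ℝ) < (s : ℝ) + 1 := by positivity
  have hn1 : (0 : ℝ) < (n : ℝ) - 1 := by
    have : (2 : ℝ) ≤ n := by exact_mod_cast hn
    linarith
  have hc : ∑ σ : Perm α, ∑ i, ∑ i', ∑ a ∈ range T,
      ind (y i ≠ y i') * ind (((τ * σ) ^ a) (y i) = y i') ≤
      n.factorial * ((s + 1) ^ 2 * T / (n - 1)) := by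
    calc _ = ∑ i, ∑ i', ∑ a ∈ range T, ∑ σ : Perm α,
          ind (y i ≠ y i') * ind (((τ * σ) ^ a) (y i) = y i') := by
          rw [Finset.sum_comm]
          refine Finset.sum_congr rfl fun i _ => ?_
          rw [Finset.sum_comm]
          exact Finset.sum_congr rfl fun i' _ => Finset.sum_comm
      _ ≤ ∑ i : Fin (s + 1), ∑ i' : Fin (s + 1), ∑ a ∈ range T, (n.factorial / (n - 1) : ℝ) := by
          refine Finset.sum_le_sum fun i _ => Finset.sum_le_sum fun i' _ =>
            Finset.sum_le_sum fun a _ => ?_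
          rw [← Finset.mul_sum]
          by_cases hne : y i = y i'
          · rw [ind_neg (not_not.2 hne), zero_mul]; positivity
          · rw [ind_pos hne, one_mul]
            exact (Fintype.sum_equiv (Equiv.mulLeft τ) _
              (fun γ : Perm α => ind ((γ ^ a) (y i) = y i')) (fun _ => rfl)).trans_le
              (sum_pow_apply_eq_le a hne hn)
      _ = _ := by
          simp only [sum_const, card_univ, Fintype.card_fin, card_range, nsmul_eq_mul]
          push_cast
          ring
  calc _ ≤ ∑ σ : Perm α, _ := Finset.sum_le_sum fun σ _ => hsplit σ
    _ ≤ n.factorial / ((s : ℝ) + 1) ^ 2 + (∑ _i : Fin (s + 1), (n.factorial : ℝ) * (1 / (T : ℝ) +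
        (T : ℝ) * (3 * (T : ℝ) + (φ : ℝ)) / ((n : ℝ) - (T : ℝ))) +
          n.factorial * ((s + 1) ^ 2 * T / (n - 1))) := by
        rw [Finset.sum_add_distrib, Finset.sum_add_distrib]
        refine add_le_add ?_ (add_le_add ?_ hc)
        · rw [le_div_iff₀ (by positivity), mul_comm]
          push_cast at hmain
          exact hmain
        · rw [Finset.sum_comm]
          exact Finset.sum_le_sum fun i _ => sum_orbit_in_cycle_le τ (y i) T hT0 hT
    _ = _ := by
        simp only [sum_const, card_univ, Fintype.card_fin, nsmul_eq_mul, corrError]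
        push_cast
        ring

/-- Normalised and centred count of the `s + 1`-tuples contained in a cycle of `σ`. -/
noncomputable def tiedDev (s : ℕ) (σ : Perm α) : ℝ :=
  (∑ x : Fin (s + 1) ↪ α, ind (Tied σ x)) / Fintype.card (Fin (s + 1) ↪ α) - 1 / ((s : ℝ) + 1)

lemma card_emb_pos {s : ℕ} (hs : s < Fintype.card α) :
    0 < Fintype.card (Fin (s + 1) ↪ α) := by
  rw [Fintype.card_embedding_eq, Fintype.card_fin]
  exact Nat.descFactorial_pos.2 hs

lemma sum_tied_eq {s : ℕ} :
    ∑ σ : Perm α, ∑ x : Fin (s + 1) ↪ α, ind (Tied σ x) =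
      Fintype.card (Fin (s + 1) ↪ α) * ((Fintype.card α).factorial / ((s : ℝ) + 1)) := by
  have hx : ∀ x : Fin (s + 1) ↪ α, ∑ σ : Perm α, ind (Tied σ x) =
      (Fintype.card α).factorial / ((s : ℝ) + 1) := by
    intro x
    have := sum_ind_tied (α := α) x.injective
    rw [eq_div_iff (by positivity), mul_comm]
    exact_mod_cast this
  rw [Finset.sum_comm, Finset.sum_congr rfl fun x _ => hx x, sum_const, card_univ, nsmul_eq_mul]

lemma sum_tiedDev_mul_le {s : ℕ} (τ : Perm α) (T : ℕ) (hT0 : 0 < T)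
    (hT : T < Fintype.card α) (hs : s < Fintype.card α) (hn : 2 ≤ Fintype.card α) :
    ∑ σ : Perm α, tiedDev s σ * tiedDev s (τ * σ) ≤ (Fintype.card α).factorial *
      corrError s T (Fintype.card α) (univ.filter fun p => τ p = p).card := by
  have hN : (0 : ℝ) < Fintype.card (Fin (s + 1) ↪ α) := by exact_mod_cast card_emb_pos hs
  set N : ℝ := (Fintype.card (Fin (s + 1) ↪ α) : ℝ) with hNdef
  set f : ℝ := ((Fintype.card α).factorial : ℝ)
  set err := corrError s T (Fintype.card α) (univ.filter fun p => τ p = p).card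
  have hs1 : (0 : ℝ) < (s : ℝ) + 1 := by positivity
  set Y : Perm α → ℝ := fun σ => ∑ x : Fin (s + 1) ↪ α, ind (Tied σ x) with hY
  have h1 : ∑ σ, Y σ = N * (f / (s + 1)) := sum_tied_eq
  have h2 : ∑ σ, Y (τ * σ) = N * (f / (s + 1)) := by
    rw [← h1]; exact Fintype.sum_equiv (Equiv.mulLeft τ) _ _ fun _ => rfl
  have h3 : ∑ σ, Y σ * Y (τ * σ) ≤ N ^ 2 * (f * (1 / ((s : ℝ) + 1) ^ 2 + err)) := by
    calc _ = ∑ x : Fin (s + 1) ↪ α, ∑ y : Fin (s + 1) ↪ α, ∑ σ : Perm α,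
          ind (Tied σ x) * ind (Tied (τ * σ) y) := by
          simp only [hY, Finset.sum_mul_sum]
          rw [Finset.sum_comm]
          exact Finset.sum_congr rfl fun x _ => Finset.sum_comm
      _ ≤ ∑ x : Fin (s + 1) ↪ α, ∑ y : Fin (s + 1) ↪ α, f * (1 / ((s : ℝ) + 1) ^ 2 + err) :=
          Finset.sum_le_sum fun x _ => Finset.sum_le_sum fun y _ =>
            sum_tied_tied_le τ x y T hT0 hT x.injective y.injective hn
      _ = _ := by
          simp only [sum_const, card_univ, nsmul_eq_mul, ← hNdef]; ring
  have hcard : ∑ _σ : Perm α, (1 : ℝ) = f := by simp [f, Fintype.card_perm]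
  calc ∑ σ : Perm α, tiedDev s σ * tiedDev s (τ * σ)
      = (∑ σ, Y σ * Y (τ * σ)) / N ^ 2 - (∑ σ, Y σ) / (N * (s + 1)) -
        (∑ σ, Y (τ * σ)) / (N * (s + 1)) + (∑ _σ : Perm α, (1 : ℝ)) / ((s : ℝ) + 1) ^ 2 := by
        simp only [Finset.sum_div, ← Finset.sum_sub_distrib, ← Finset.sum_add_distrib]
        refine Finset.sum_congr rfl fun σ _ => ?_
        simp only [tiedDev, ← hNdef, hY]
        field_simp
        ring
    _ ≤ (N ^ 2 * (f * (1 / ((s : ℝ) + 1) ^ 2 + err))) / N ^ 2 - (∑ σ, Y σ) / (N * (s + 1)) -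
        (∑ σ, Y (τ * σ)) / (N * (s + 1)) + (∑ _σ : Perm α, (1 : ℝ)) / ((s : ℝ) + 1) ^ 2 := by
        gcongr
    _ = _ := by
        rw [h1, h2, hcard]
        field_simp
        ring

lemma tiedDev_sq_le {s : ℕ} (σ : Perm α) (hs : s < Fintype.card α) : tiedDev s σ ^ 2 ≤ 1 := by
  have hN : (0 : ℝ) < Fintype.card (Fin (s + 1) ↪ α) := by exact_mod_cast card_emb_pos hs
  have h0 : 0 ≤ ∑ x : Fin (s + 1) ↪ α, ind (Tied σ x) := sum_nonneg fun _ _ => ind_nonneg _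
  have h1 : ∑ x : Fin (s + 1) ↪ α, ind (Tied σ x) ≤ Fintype.card (Fin (s + 1) ↪ α) := by
    refine (sum_le_sum fun x _ => ind_le_one _).trans ?_
    simp
  have h2 := div_nonneg h0 hN.le
  have h3 := (div_le_one hN).2 h1
  have h4 : 0 ≤ 1 / ((s : ℝ) + 1) := by positivity
  have h5 : 1 / ((s : ℝ) + 1) ≤ 1 := by
    rw [div_le_one (by positivity)]; linarith [s.cast_nonneg (α := ℝ)]
  rw [sq_le_one_iff_abs_le_one, abs_le, tiedDev]
  constructor <;> linarith

lemma sum_sq_tiedDev_le {s : ℕ} (k T : ℕ) (hT0 : 0 < T)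
    (hT : T < Fintype.card α) (hs : s < Fintype.card α) (hn : 2 ≤ Fintype.card α) :
    ∑ h : Perm α, ∑ g : Perm α, (∑ i ∈ range k, tiedDev s (h ^ i * g)) ^ 2 ≤
      ((Fintype.card α).factorial : ℝ) ^ 2 *
        (k + (k : ℝ) ^ 2 * corrError s T (Fintype.card α) k) := by
  set f : ℝ := ((Fintype.card α).factorial : ℝ) with hf
  have hcard : (Fintype.card (Perm α) : ℝ) = f := by simp [f, Fintype.card_perm]
  have hnT : (0 : ℝ) < (Fintype.card α : ℝ) - T := by
    have : (T : ℝ) < Fintype.card α := by exact_mod_cast hT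
    linarith
  have hn1 : (0 : ℝ) < (Fintype.card α : ℝ) - 1 := by
    have : (2 : ℝ) ≤ Fintype.card α := by exact_mod_cast hn
    linarith
  have herr : 0 ≤ corrError s T (Fintype.card α) k := by
    unfold corrError; positivity
  have hlt : ∀ i j, i < j → j < k →
      ∑ h : Perm α, ∑ g : Perm α, tiedDev s (h ^ i * g) * tiedDev s (h ^ j * g) ≤
        f ^ 2 * corrError s T (Fintype.card α) k := by
    intro i j hij hjk
    calc _ = ∑ h : Perm α, ∑ σ : Perm α, tiedDev s σ * tiedDev s (h ^ (j - i) * σ) := by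
          refine Finset.sum_congr rfl fun h _ =>
            Fintype.sum_equiv (Equiv.mulLeft (h ^ i)) _ _ fun g => ?_
          simp only [Equiv.coe_mulLeft]
          rw [← mul_assoc, ← pow_add, Nat.sub_add_cancel hij.le]
      _ ≤ ∑ h : Perm α, f * corrError s T (Fintype.card α)
            (univ.filter fun p => (h ^ (j - i)) p = p).card :=
          Finset.sum_le_sum fun h _ => sum_tiedDev_mul_le _ T hT0 hT hs hn
      _ = f * (f * corrError s T (Fintype.card α) 0 +
            (s + 1) * T / (Fintype.card α - T) *
              ∑ h : Perm α, ∑ y, ind ((h ^ (j - i)) y = y)) := by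
          have h0 : f * corrError s T (Fintype.card α) 0 =
              ∑ _h : Perm α, corrError s T (Fintype.card α) 0 := by
            rw [sum_const, card_univ, nsmul_eq_mul, hcard]
          rw [← Finset.mul_sum, h0, Finset.mul_sum univ _ ((s + 1) * T / _ : ℝ),
            ← Finset.sum_add_distrib]
          congr 1
          refine Finset.sum_congr rfl fun h _ => ?_
          rw [sum_ind]
          simp only [corrError]
          ring
      _ ≤ f * (f * corrError s T (Fintype.card α) 0 +
            (s + 1) * T / (Fintype.card α - T) * (k * f)) := by
          have h1 := sum_fixed_pow_le (α := α) (j - i) (by omega)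
          have h2 : ((j - i : ℕ) : ℝ) ≤ k := by exact_mod_cast (by omega)
          gcongr
          exact h1.trans (by gcongr)
      _ = _ := by
          simp only [corrError]
          ring
  calc _ = ∑ i ∈ range k, ∑ j ∈ range k,
        ∑ h : Perm α, ∑ g : Perm α, tiedDev s (h ^ i * g) * tiedDev s (h ^ j * g) := by
        simp only [sq, Finset.sum_mul_sum]
        rw [Finset.sum_congr rfl fun h _ => Finset.sum_comm, Finset.sum_comm]
        refine Finset.sum_congr rfl fun i _ => ?_
        rw [Finset.sum_congr rfl fun h _ => Finset.sum_comm, Finset.sum_comm]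
    _ ≤ ∑ i ∈ range k, ∑ j ∈ range k, f ^ 2 * (ind (i = j) +
          corrError s T (Fintype.card α) k) := by
        refine Finset.sum_le_sum fun i hi => Finset.sum_le_sum fun j hj => ?_
        rw [mem_range] at hi hj
        rcases lt_trichotomy i j with hij | rfl | hij
        · rw [ind_neg hij.ne, zero_add]; exact hlt i j hij hj
        · rw [ind_pos rfl]
          calc _ ≤ ∑ h : Perm α, ∑ g : Perm α, (1 : ℝ) :=
                Finset.sum_le_sum fun h _ => Finset.sum_le_sum fun g _ => by
                  rw [← sq]; exact tiedDev_sq_le _ hs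
            _ = f ^ 2 * 1 := by simp [Fintype.card_perm, f, sq]
            _ ≤ _ := by gcongr; linarith
        · rw [ind_neg hij.ne', zero_add]
          simp only [mul_comm (tiedDev s (_ ^ i * _))]
          exact hlt j i hij hi
    _ = _ := by
        simp only [← Finset.mul_sum, Finset.sum_add_distrib, sum_const, card_range, nsmul_eq_mul]
        congr 1
        have : ∀ i ∈ range k, ∑ j ∈ range k, ind (i = j) = 1 := by
          intro i hi
          simp [ind_eq_ite, mem_range.1 hi]
        rw [Finset.sum_congr rfl this]
        simp
        ring

lemma tiedDev_le_of_short {σ : Perm α} (hn : 1000 ≤ Fintype.card α)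
    (h : ∀ x, 4 * (cyc σ x).card ≤ 3 * Fintype.card α) : tiedDev 9 σ ≤ -(1 / 100) := by
  have hs : 9 < Fintype.card α := by omega
  have hN : (0 : ℝ) < Fintype.card (Fin (9 + 1) ↪ α) := by exact_mod_cast card_emb_pos hs
  set n := Fintype.card α with hndef
  have hn0 : (1000 : ℝ) ≤ n := by exact_mod_cast hn
  have hY : ∑ x : Fin (9 + 1) ↪ α, ind (Tied σ x) ≤ (n : ℝ) * (3 / 4 * n) ^ 9 := by
    classical
    rw [sum_ind]
    have h1 : (univ.filter fun x : Fin (9 + 1) ↪ α => Tied σ x).card ≤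
        (univ.sigma fun a : α => Fintype.piFinset fun _ : Fin 9 => cyc σ a).card := by
      refine card_le_card_of_injOn (fun x => ⟨x 0, fun i => x i.succ⟩) ?_ ?_
      · intro x hx
        have hx := (mem_filter.1 hx).2
        simp only [coe_sigma, Set.mem_sigma_iff, mem_coe, mem_univ, true_and,
          Fintype.mem_piFinset]
        exact fun i => mem_cyc.2 (hx i.succ)
      · intro x _ y _ hxy
        simp only [Sigma.mk.injEq, heq_eq_eq] at hxy
        ext i
        refine Fin.cases hxy.1 (fun j => congrFun hxy.2 j) i
    rw [card_sigma] at h1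
    simp only [Fintype.card_piFinset, prod_const, card_univ, Fintype.card_fin] at h1
    calc _ ≤ ((∑ a : α, (cyc σ a).card ^ 9 : ℕ) : ℝ) := by exact_mod_cast h1
      _ = ∑ a : α, ((cyc σ a).card : ℝ) ^ 9 := by push_cast; rfl
      _ ≤ ∑ a : α, (3 / 4 * (n : ℝ)) ^ 9 := by
          refine Finset.sum_le_sum fun a _ => ?_
          gcongr
          have : (4 : ℝ) * (cyc σ a).card ≤ 3 * n := by exact_mod_cast h a
          linarith
      _ = _ := by simp [hndef]
  have hNn : ((n : ℝ) - 9) ^ 10 ≤ Fintype.card (Fin (9 + 1) ↪ α) := by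
    rw [Fintype.card_embedding_eq, Fintype.card_fin]
    have := Nat.pow_sub_le_descFactorial n 10
    have h2 : ((n - 9 : ℕ) : ℝ) = (n : ℝ) - 9 := by push_cast [Nat.cast_sub (by omega : 9 ≤ n)]; rfl
    rw [← h2]
    have h3 : n + 1 - 10 = n - 9 := by omega
    rw [h3] at this
    exact_mod_cast this
  have hB : (1 - 90 / (n : ℝ)) * (n : ℝ) ^ 10 ≤ ((n : ℝ) - 9) ^ 10 := by
    have h0 : (n : ℝ) - 9 = n * (1 + -(9 / n)) := by field_simp; ring
    have h1 : -2 ≤ -(9 / (n : ℝ)) := by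
      rw [neg_le_neg_iff, div_le_iff₀ (by linarith)]; linarith
    have := one_add_mul_le_pow h1 10
    rw [h0, mul_pow, mul_comm]
    gcongr
    refine le_trans (le_of_eq ?_) this
    push_cast; ring
  have h90 : 90 / (n : ℝ) ≤ 9 / 100 := by
    rw [div_le_iff₀ (by linarith)]; linarith
  have hle : ∑ x : Fin (9 + 1) ↪ α, ind (Tied σ x) ≤
      9 / 100 * (Fintype.card (Fin (9 + 1) ↪ α) : ℝ) := by
    have hp : (0 : ℝ) ≤ (n : ℝ) ^ 10 := by positivity
    have : (91 / 100 : ℝ) * (n : ℝ) ^ 10 ≤ Fintype.card (Fin (9 + 1) ↪ α) :=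
      le_trans (by gcongr; linarith) (hB.trans hNn)
    have e : (n : ℝ) * (3 / 4 * n) ^ 9 = (3 / 4) ^ 9 * (n : ℝ) ^ 10 := by ring
    rw [e] at hY
    refine hY.trans (le_trans ?_ (mul_le_mul_of_nonneg_left this (by norm_num)))
    rw [← mul_assoc]
    exact mul_le_mul_of_nonneg_right (by norm_num) hp
  have := (div_le_iff₀ hN).2 hle
  rw [tiedDev]
  push_cast
  linarith

lemma sum_no_long_cycle_le (k T : ℕ) (hk : 0 < k) (hT0 : 0 < T) (hT : T < Fintype.card α)
    (hn : 1000 ≤ Fintype.card α) :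
    ∑ h : Perm α, ∑ g : Perm α,
        ind (∀ i < k, ∀ x, 4 * (cyc (h ^ i * g) x).card ≤ 3 * Fintype.card α) ≤
      ((Fintype.card α).factorial : ℝ) ^ 2 *
        (10 ^ 4 * (1 / k + corrError 9 T (Fintype.card α) k)) := by
  have hk' : (0 : ℝ) < k := by exact_mod_cast hk
  have key : ∀ h g : Perm α, (k : ℝ) ^ 2 / 10 ^ 4 *
      ind (∀ i < k, ∀ x, 4 * (cyc (h ^ i * g) x).card ≤ 3 * Fintype.card α) ≤
      (∑ i ∈ range k, tiedDev 9 (h ^ i * g)) ^ 2 := by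
    intro h g
    by_cases hP : ∀ i < k, ∀ x, 4 * (cyc (h ^ i * g) x).card ≤ 3 * Fintype.card α
    · rw [ind_pos hP, mul_one]
      have : ∑ i ∈ range k, tiedDev 9 (h ^ i * g) ≤ ∑ _i ∈ range k, -(1 / 100 : ℝ) :=
        Finset.sum_le_sum fun i hi => tiedDev_le_of_short hn (hP i (mem_range.1 hi))
      simp only [sum_const, card_range, nsmul_eq_mul] at this
      nlinarith
    · rw [ind_neg hP, mul_zero]; positivity
  have h1 := (Finset.sum_le_sum fun h (_ : h ∈ univ) => Finset.sum_le_sum fun g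
    (_ : g ∈ univ) => key h g).trans
    (sum_sq_tiedDev_le (α := α) (s := 9) k T hT0 hT (by omega) (by omega))
  simp only [← Finset.mul_sum] at h1
  have h2 := (le_div_iff₀' (by positivity : (0 : ℝ) < (k : ℝ) ^ 2 / 10 ^ 4)).2 h1
  refine h2.trans (le_of_eq ?_)
  push_cast
  field_simp

lemma support_pow_card_cyc_le (σ : Perm α) (x : α) :
    (σ ^ (cyc σ x).card).support.card + (cyc σ x).card ≤ Fintype.card α := by
  rw [← card_union_of_disjoint, ← card_univ]
  · exact card_le_card (subset_univ _)
  · rw [Finset.disjoint_right]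
    intro y hy
    rw [Perm.mem_support, not_not, pow_apply_eq_self_iff, cyc_eq hy]

/-- A short word of the shape `(h ^ i * g) ^ c` is a nontrivial permutation of small support. -/
def HasSmallPower (k : ℕ) (g h : Perm α) : Prop :=
  ∃ i < k, ∃ c ≤ Fintype.card α, (h ^ i * g) ^ c ≠ 1 ∧
    4 * ((h ^ i * g) ^ c).support.card ≤ Fintype.card α

lemma sum_not_hasSmallPower_le (k T r : ℕ) (hk : 0 < k) (hT0 : 0 < T) (hT : T < Fintype.card α)
    (hn : 1000 ≤ Fintype.card α) (hr : 0 < r) (hrn : r < Fintype.card α) :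
    ∑ h : Perm α, ∑ g : Perm α, ind (¬ HasSmallPower k g h) ≤
      ((Fintype.card α).factorial : ℝ) ^ 2 *
        (10 ^ 4 * (1 / k + corrError 9 T (Fintype.card α) k) +
          k * ((4 / 3) * (1 + Real.log (Fintype.card α)) / r + r / (Fintype.card α - r))) := by
  set n := Fintype.card α with hndef
  have key : ∀ h g : Perm α, ind (¬ HasSmallPower k g h) ≤
      ind (∀ i < k, ∀ x, 4 * (cyc (h ^ i * g) x).card ≤ 3 * n) +
      ∑ i ∈ range k, ind (∃ x, 3 * n < 4 * (cyc (h ^ i * g) x).card ∧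
        (h ^ i * g) ^ (cyc (h ^ i * g) x).card = 1) := by
    intro h g
    refine (ind_mono ?_).trans ((ind_or_le _ (∃ i ∈ range k, _)).trans
      (add_le_add le_rfl (ind_exists_le _)))
    intro hS
    by_contra hc
    push Not at hc
    obtain ⟨⟨i, hi, x, hx⟩, hc⟩ := hc
    have h1 := hc i (mem_range.2 hi) x hx
    have h2 := support_pow_card_cyc_le (h ^ i * g) x
    exact hS ⟨i, hi, _, card_le_univ _, h1, by omega⟩
  calc _ ≤ _ := Finset.sum_le_sum fun h _ => Finset.sum_le_sum fun g _ => key h g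
    _ = ∑ h : Perm α, ∑ g : Perm α, ind (∀ i < k, ∀ x, 4 * (cyc (h ^ i * g) x).card ≤ 3 * n) +
        ∑ h : Perm α, ∑ i ∈ range k, ∑ σ : Perm α, ind (∃ x, 3 * n < 4 * (cyc σ x).card ∧
          σ ^ (cyc σ x).card = 1) := by
        simp only [Finset.sum_add_distrib]
        congr 1
        refine Finset.sum_congr rfl fun h _ => ?_
        rw [Finset.sum_comm]
        exact Finset.sum_congr rfl fun i _ =>
          Fintype.sum_equiv (Equiv.mulLeft (h ^ i)) _ _ fun g => rfl
    _ ≤ _ := by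
        rw [mul_add]
        refine add_le_add (sum_no_long_cycle_le k T hk hT0 hT hn) ?_
        have := sum_trivial_power_le (α := α) r hr hrn
        calc _ ≤ ∑ _h : Perm α, ∑ _i ∈ range k, _ :=
              Finset.sum_le_sum fun h _ => Finset.sum_le_sum fun i _ => this
          _ = _ := by
              simp only [sum_const, card_univ, card_range, nsmul_eq_mul, Fintype.card_perm]
              ring

/-- A sequence of points `pt F 0, pt F 1, …` explored by querying the permutations `F true` and
`F false`: the first `m` points do not depend on `F`, and the point `m + k` is the image of the
point `k` under `F (b k)`. -/
structure Exploration (m : ℕ) (b : ℕ → Bool) (pt : (Bool → Perm α) → ℕ → α) : Prop where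
  pos : 0 < m
  base : ∀ F F' j, j < m → pt F j = pt F' j
  step : ∀ F k, pt F (m + k) = F (b k) (pt F k)

/-- The queries made in the first `k` steps. -/
def queries (b : ℕ → Bool) (pt : ℕ → α) (k : ℕ) : Finset (Bool × α) :=
  (range k).image fun j => (b j, pt j)

/-- The points seen before step `k`. -/
def seen (pt : ℕ → α) (m k : ℕ) : Finset α := (range (m + k)).image pt

/-- Right multiplication of one of the two permutations. -/
def modify (β : Bool) (F : Bool → Perm α) (π : Perm α) : Bool → Perm α :=
  Function.update F β (F β * π)

lemma card_queries_le (b : ℕ → Bool) (pt : ℕ → α) (k : ℕ) : (queries b pt k).card ≤ k :=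
  card_image_le.trans (card_range k).le

lemma card_seen_le (pt : ℕ → α) (m k : ℕ) : (seen pt m k).card ≤ m + k :=
  card_image_le.trans (card_range _).le

namespace Exploration

variable {m : ℕ} {b : ℕ → Bool} {pt : (Bool → Perm α) → ℕ → α}

lemma local_eq (hE : Exploration m b pt) {F : Bool → Perm α} {β : Bool} {p z : α} {k : ℕ}
    (hp : (β, p) ∉ queries b (pt F) k) (hz : (β, z) ∉ queries b (pt F) k) :
    ∀ j < m + k, pt (modify β F (swap p z)) j = pt F j := by
  intro j
  induction j using Nat.strong_induction_on with
  | _ j ih =>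
    intro hj
    by_cases hjm : j < m
    · exact hE.base _ _ j hjm
    · obtain ⟨i, rfl⟩ := Nat.exists_eq_add_of_le (not_lt.1 hjm)
      have hm := hE.pos
      have hi : i < k := by omega
      rw [hE.step, hE.step, ih i (by omega) (by omega)]
      have hmem : (b i, pt F i) ∈ queries b (pt F) k := mem_image_of_mem _ (mem_range.2 hi)
      unfold modify
      by_cases hb : b i = β
      · rw [hb, Function.update_self, Perm.mul_apply, swap_apply_of_ne_of_ne]
        · rintro h; rw [hb, h] at hmem; exact hp hmem
        · rintro h; rw [hb, h] at hmem; exact hz hmem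
      · rw [Function.update_of_ne hb]

/-- A fresh query lands in a given set with probability about its density. -/
lemma sum_fresh_le (hE : Exploration m b pt) (k : ℕ) (f : (Bool → Perm α) → ℝ)
    (B : (Bool → Perm α) → Finset α) (c : ℝ) (hf0 : ∀ F, 0 ≤ f F)
    (hf : ∀ F F', (∀ j < m + k, pt F' j = pt F j) → f F' = f F)
    (hB : ∀ F F', (∀ j < m + k, pt F' j = pt F j) → B F' = B F)
    (hc : ∀ F, ((B F).card : ℝ) ≤ c) :
    ((Fintype.card α : ℝ) - k) * ∑ F, f F * ind ((b k, pt F k) ∉ queries b (pt F) k ∧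
      pt F (m + k) ∈ B F) ≤ c * ∑ F, f F := by
  have hc0 : 0 ≤ c := (Nat.cast_nonneg _).trans (hc fun _ => 1)
  have hq : ∀ F F', (∀ j < m + k, pt F' j = pt F j) →
      queries b (pt F') k = queries b (pt F) k := by
    intro F F' h
    refine image_congr fun j hj => ?_
    rw [h j (by have := mem_range.1 hj; omega)]
  have hk : k < m + k := by have := hE.pos; omega
  have key := sum_reveal_le (fun F : Bool → Perm α => F (b k)) (modify (b k))
    (by intro F π; simp [modify])
    (by intro F π; simp [modify, mul_assoc])
    (fun F => f F * ind ((b k, pt F k) ∉ queries b (pt F) k)) (fun F => pt F k)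
    (fun F => univ.filter fun z => (b k, z) ∉ queries b (pt F) k) B
    (by
      intro F hF z hz
      have hz := (mem_filter.1 hz).2
      have hp := ne_zero_of_ind (right_ne_zero_of_mul hF)
      have hl := hE.local_eq hp hz
      simp only [hf _ _ hl, hB _ _ hl, hq _ _ hl, hl k hk, and_self])
    (fun F => mul_nonneg (hf0 F) (ind_nonneg _)) ((Fintype.card α : ℝ) - k) c
    (by
      intro F _
      rw [sub_le_iff_le_add]
      have h1 : (univ.filter fun z => ¬ (b k, z) ∉ queries b (pt F) k).card ≤ k := by
        refine le_trans (card_le_card_of_injOn (fun z => (b k, z)) ?_ ?_)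
          (card_queries_le b (pt F) k)
        · intro z hz; simpa using hz
        · intro z _ z' _ h; simpa using h
      have h2 := card_filter_add_card_filter_not (s := (univ : Finset α))
        (fun z => (b k, z) ∉ queries b (pt F) k)
      rw [card_univ] at h2
      exact_mod_cast (by omega))
    (fun F _ => hc F)
  calc _ = ((Fintype.card α : ℝ) - k) * ∑ F, f F * ind ((b k, pt F k) ∉ queries b (pt F) k) *
        ind (F (b k) (pt F k) ∈ B F) := by
        congr 1
        refine Finset.sum_congr rfl fun F _ => ?_
        rw [mul_assoc, ← ind_and, hE.step]
    _ ≤ _ := key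
    _ ≤ _ := by
        gcongr with F
        exact mul_le_of_le_one_right (hf0 F) (ind_le_one _)

end Exploration

/-- The number of fresh queries among the first `k` whose answer is an old point. -/
noncomputable def excess (b : ℕ → Bool) (pt : ℕ → α) (m : ℕ) : ℕ → ℕ
  | 0 => 0
  | k + 1 => excess b pt m k +
      if (b k, pt k) ∉ queries b pt k ∧ pt (m + k) ∈ seen pt m k then 1 else 0

lemma queries_succ (b : ℕ → Bool) (pt : ℕ → α) (k : ℕ) :
    queries b pt (k + 1) = insert (b k, pt k) (queries b pt k) := by
  simp [queries, range_add_one]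

lemma seen_succ (pt : ℕ → α) (m k : ℕ) :
    seen pt m (k + 1) = insert (pt (m + k)) (seen pt m k) := by
  simp [seen, ← add_assoc, range_add_one]

namespace Exploration

variable {m : ℕ} {b : ℕ → Bool} {pt : (Bool → Perm α) → ℕ → α}

lemma card_queries_add (hE : Exploration m b pt) (F : Bool → Perm α) (k : ℕ) :
    (queries b (pt F) k).card + (seen (pt F) m 0).card =
      (seen (pt F) m k).card + excess b (pt F) m k := by
  induction k with
  | zero => simp [queries, excess]
  | succ k ih =>
    rw [queries_succ, seen_succ, excess]
    by_cases h1 : (b k, pt F k) ∈ queries b (pt F) k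
    · have h2 : pt F (m + k) ∈ seen (pt F) m k := by
        obtain ⟨j, hj, he⟩ := mem_image.1 h1
        rw [Prod.mk.injEq] at he
        rw [hE.step, ← he.1, ← he.2, ← hE.step]
        exact mem_image_of_mem _ (by have := mem_range.1 hj; simpa using this)
      simp only [insert_eq_of_mem h1, insert_eq_of_mem h2, not_true, false_and, if_false, h1]
      omega
    · by_cases h2 : pt F (m + k) ∈ seen (pt F) m k
      · simp only [card_insert_of_notMem h1, insert_eq_of_mem h2, h1, h2, not_false_iff,
          and_self, if_true]
        omega
      · simp only [card_insert_of_notMem h1, card_insert_of_notMem h2, h1, h2, not_false_iff,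
          and_false, if_false]
        omega

lemma excess_congr {F F' : Bool → Perm α} (hm : 0 < m) {k : ℕ}
    (h : ∀ j < m + k, pt F' j = pt F j) : excess b (pt F') m k = excess b (pt F) m k := by
  induction k with
  | zero => rfl
  | succ k ih =>
    have h1 : queries b (pt F') k = queries b (pt F) k := by
      refine image_congr fun j hj => ?_
      rw [h j (by have := mem_range.1 hj; omega)]
    have h2 : seen (pt F') m k = seen (pt F) m k := by
      refine image_congr fun j hj => ?_
      rw [h j (by have := mem_range.1 hj; omega)]
    rw [excess, excess, ih fun j hj => h j (by omega), h1, h2, h k (by omega),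
      h (m + k) (by omega)]

lemma sum_pow_excess_le (hE : Exploration m b pt) {K : ℕ} (hK : K < Fintype.card α) {t : ℝ}
    (ht : 0 ≤ t) (k : ℕ) (hk : k ≤ K) :
    ∑ F, t ^ excess b (pt F) m k ≤
      (1 + t * ((m + K) / (Fintype.card α - K))) ^ k * Fintype.card (Bool → Perm α) := by
  have hnK : (0 : ℝ) < (Fintype.card α : ℝ) - K := by
    have : (K : ℝ) < Fintype.card α := by exact_mod_cast hK
    linarith
  induction k with
  | zero => simp [excess]
  | succ k ih =>
    have hkK : (k : ℝ) ≤ K := by exact_mod_cast (by omega)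
    have h1 := hE.sum_fresh_le k (fun F => t ^ excess b (pt F) m k) (fun F => seen (pt F) m k)
      (m + K) (fun F => by positivity)
      (fun F F' h => by simp only [excess_congr hE.pos h])
      (fun F F' h => image_congr fun j hj => h j (mem_range.1 hj))
      (fun F => by
        have := card_seen_le (pt F) m k
        calc ((seen (pt F) m k).card : ℝ) ≤ ((m + k : ℕ) : ℝ) := by exact_mod_cast this
          _ ≤ _ := by push_cast; linarith)
    set S := ∑ F, t ^ excess b (pt F) m k with hS
    have hS0 : 0 ≤ S := by positivity
    set R := ∑ F, t ^ excess b (pt F) m k * ind ((b k, pt F k) ∉ queries b (pt F) k ∧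
      pt F (m + k) ∈ seen (pt F) m k) with hR
    have hR0 : 0 ≤ R := sum_nonneg fun F _ => mul_nonneg (by positivity) (ind_nonneg _)
    have h2 : R ≤ (m + K) / (Fintype.card α - K) * S := by
      rw [div_mul_eq_mul_div, le_div_iff₀ hnK, mul_comm]
      refine le_trans ?_ h1
      gcongr
    calc ∑ F, t ^ excess b (pt F) m (k + 1) ≤ S + t * R := by
          rw [hS, hR, Finset.mul_sum, ← Finset.sum_add_distrib]
          refine Finset.sum_le_sum fun F _ => ?_
          rw [excess]
          split_ifs with h
          · rw [ind_pos h, pow_succ]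
            have : 0 ≤ t ^ excess b (pt F) m k := by positivity
            linarith
          · rw [ind_neg h]; simp
      _ ≤ S + t * ((m + K) / (Fintype.card α - K) * S) := by gcongr
      _ = (1 + t * ((m + K) / (Fintype.card α - K))) * S := by ring
      _ ≤ (1 + t * ((m + K) / (Fintype.card α - K))) *
          ((1 + t * ((m + K) / (Fintype.card α - K))) ^ k * Fintype.card (Bool → Perm α)) := by
          gcongr
          exact ih (by omega)
      _ = _ := by ring

/-- Having `r` excess collisions is as unlikely as `r` independent collisions. -/
lemma sum_excess_ge_le (hE : Exploration m b pt) {K : ℕ} (hK0 : 0 < K)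
    (hK : K < Fintype.card α) (hq : (K : ℝ) * ((m + K) / (Fintype.card α - K)) ≤ 1) (r : ℕ) :
    ∑ F, ind (r ≤ excess b (pt F) m K) ≤
      3 * ((K : ℝ) * ((m + K) / (Fintype.card α - K))) ^ r *
        Fintype.card (Bool → Perm α) := by
  have hnK : (0 : ℝ) < (Fintype.card α : ℝ) - K := by
    have : (K : ℝ) < Fintype.card α := by exact_mod_cast hK
    linarith
  have hK' : (0 : ℝ) < K := by exact_mod_cast hK0
  set q : ℝ := ((m : ℝ) + K) / (Fintype.card α - K) with hqdef
  have hq0 : 0 < q := by positivity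
  set t : ℝ := 1 / (K * q) with ht
  have ht1 : 1 ≤ t := by rw [ht, le_div_iff₀ (by positivity)]; linarith
  have h1 := hE.sum_pow_excess_le hK (by linarith : 0 ≤ t) K le_rfl
  have h2 : t ^ r * ∑ F, ind (r ≤ excess b (pt F) m K) ≤ ∑ F, t ^ excess b (pt F) m K := by
    rw [Finset.mul_sum]
    refine Finset.sum_le_sum fun F _ => ?_
    by_cases h : r ≤ excess b (pt F) m K
    · rw [ind_pos h, mul_one]; exact pow_le_pow_right₀ ht1 h
    · rw [ind_neg h, mul_zero]; positivity
  have h3 : (1 + t * q) ^ K ≤ 3 := by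
    have : t * q = 1 / K := by rw [ht]; field_simp
    rw [this]
    have h4 : 1 + 1 / (K : ℝ) ≤ Real.exp (1 / K) := by
      linarith [Real.add_one_le_exp (1 / (K : ℝ))]
    calc (1 + 1 / (K : ℝ)) ^ K ≤ Real.exp (1 / K) ^ K := by gcongr
      _ = Real.exp 1 := by rw [← Real.exp_nat_mul]; congr 1; field_simp
      _ ≤ 3 := by linarith [Real.exp_one_lt_d9]
  have h5 : ∑ F, ind (r ≤ excess b (pt F) m K) = (K * q) ^ r *
      (t ^ r * ∑ F, ind (r ≤ excess b (pt F) m K)) := by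
    rw [← mul_assoc, ← mul_pow, ht]
    rw [mul_one_div_cancel (by positivity), one_pow, one_mul]
  rw [h5]
  calc _ ≤ (K * q) ^ r * (3 * Fintype.card (Bool → Perm α)) := by
        exact mul_le_mul_of_nonneg_left (h2.trans (h1.trans
          (mul_le_mul_of_nonneg_right h3 (by positivity)))) (by positivity)
    _ = _ := by ring

end Exploration

/-- The product of the first `t` letters of the word `W`, the first letter acting first. -/
def walk (F : Bool → Perm α) (W : ℕ → Bool) : ℕ → Perm α
  | 0 => 1
  | t + 1 => F (W t) * walk F W t

/-- The points on two families of walks, run in parallel. -/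
def node {ℓ : ℕ} [NeZero ℓ] (W : Bool → ℕ → Bool) (x : Fin ℓ → α) (F : Bool → Perm α)
    (k : ℕ) : α :=
  walk F (W (Nat.bodd k)) (k / (2 * ℓ)) (x (Fin.ofNat ℓ (k / 2)))

/-- The letter read at step `k` of the parallel walks. -/
def letter (ℓ : ℕ) (W : Bool → ℕ → Bool) (k : ℕ) : Bool := W (Nat.bodd k) (k / (2 * ℓ))

/-- The time at which the walk `W s` started from the point `i` is at its step `t`. -/
def index (ℓ i : ℕ) (s : Bool) (t : ℕ) : ℕ := 2 * ℓ * t + (2 * i + s.toNat)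

section
variable {ℓ : ℕ} [NeZero ℓ] (W : Bool → ℕ → Bool) (x : Fin ℓ → α) (F : Bool → Perm α)

lemma bodd_index (ℓ i : ℕ) (s : Bool) (t : ℕ) : Nat.bodd (index ℓ i s t) = s := by
  cases s <;> simp [index]

lemma index_div (i : ℕ) (hi : i < ℓ) (s : Bool) (t : ℕ) : index ℓ i s t / (2 * ℓ) = t := by
  have : s.toNat ≤ 1 := Bool.toNat_le s
  rw [index, Nat.mul_add_div (by omega), Nat.div_eq_of_lt (by omega), add_zero]

lemma index_div_two (i : ℕ) (s : Bool) (t : ℕ) : index ℓ i s t / 2 = ℓ * t + i := by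
  have : s.toNat ≤ 1 := Bool.toNat_le s
  rw [index, mul_assoc]; omega

omit [NeZero ℓ] in
lemma letter_index (i : Fin ℓ) (s : Bool) (t : ℕ) : letter ℓ W (index ℓ i s t) = W s t := by
  have : NeZero ℓ := ⟨by have := i.2; omega⟩
  rw [letter, bodd_index, index_div _ i.2]

omit [Fintype α] [DecidableEq α] in
lemma node_index (i : Fin ℓ) (s : Bool) (t : ℕ) :
    node W x F (index ℓ i s t) = walk F (W s) t (x i) := by
  rw [node, bodd_index, index_div _ i.2, index_div_two]
  congr 2
  ext
  simp [Nat.mod_eq_of_lt i.2]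

lemma exists_index (k : ℕ) : ∃ (i : Fin ℓ) (s : Bool), k = index ℓ i s (k / (2 * ℓ)) := by
  have hℓ : 0 < ℓ := Nat.pos_of_ne_zero (NeZero.ne ℓ)
  have h1 := Nat.div_add_mod k (2 * ℓ)
  have h2 := Nat.mod_lt k (by omega : 0 < 2 * ℓ)
  set r := k % (2 * ℓ)
  refine ⟨⟨r / 2, by omega⟩, Nat.bodd r, ?_⟩
  have h3 := Nat.bodd_add_div2 r
  rw [Nat.div2_val] at h3
  simp only [index]
  omega

omit [NeZero ℓ] in
lemma index_lt {i : Fin ℓ} {s : Bool} {t L : ℕ} (h : t < L) : index ℓ i s t < 2 * ℓ * L := by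
  have h1 : s.toNat ≤ 1 := Bool.toNat_le s
  have h2 : 2 * ℓ * (t + 1) ≤ 2 * ℓ * L := Nat.mul_le_mul_left _ h
  have := i.2
  rw [index]; rw [mul_add] at h2; omega

omit [NeZero ℓ] in
lemma index_succ (i : ℕ) (s : Bool) (t : ℕ) : index ℓ i s (t + 1) = 2 * ℓ + index ℓ i s t := by
  simp only [index]; ring

lemma exploration_node : Exploration (2 * ℓ) (letter ℓ W) (node W x) where
  pos := by have := Nat.pos_of_ne_zero (NeZero.ne ℓ); omega
  base F F' j hj := by
    simp only [node, Nat.div_eq_of_lt hj, walk]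
  step F k := by
    obtain ⟨i, s, hk⟩ := exists_index (ℓ := ℓ) k
    rw [hk, ← index_succ, letter_index, node_index, node_index]
    rfl

variable {W x F}

lemma mem_queries_node {L : ℕ} {e : Bool × α} :
    e ∈ queries (letter ℓ W) (node W x F) (2 * ℓ * L) ↔
      ∃ (i : Fin ℓ) (s : Bool) (t : ℕ), t < L ∧ (W s t, walk F (W s) t (x i)) = e := by
  have hℓ : 0 < ℓ := Nat.pos_of_ne_zero (NeZero.ne ℓ)
  simp only [queries, mem_image, mem_range]
  constructor
  · rintro ⟨k, hk, rfl⟩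
    obtain ⟨i, s, h⟩ := exists_index (ℓ := ℓ) k
    refine ⟨i, s, k / (2 * ℓ), Nat.div_lt_of_lt_mul hk, ?_⟩
    generalize k / (2 * ℓ) = t at h
    rw [h, letter_index, node_index]
  · rintro ⟨i, s, t, ht, rfl⟩
    exact ⟨index ℓ i s t, index_lt ht, by rw [letter_index, node_index]⟩

lemma mem_seen_node {L : ℕ} {v : α} :
    v ∈ seen (node W x F) (2 * ℓ) (2 * ℓ * L) ↔
      ∃ (i : Fin ℓ) (s : Bool) (t : ℕ), t ≤ L ∧ walk F (W s) t (x i) = v := by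
  have hℓ : 0 < ℓ := Nat.pos_of_ne_zero (NeZero.ne ℓ)
  have he : 2 * ℓ + 2 * ℓ * L = 2 * ℓ * (L + 1) := by ring
  simp only [seen, mem_image, mem_range, he]
  constructor
  · rintro ⟨k, hk, rfl⟩
    obtain ⟨i, s, h⟩ := exists_index (ℓ := ℓ) k
    refine ⟨i, s, k / (2 * ℓ), Nat.lt_succ_iff.1 (Nat.div_lt_of_lt_mul hk), ?_⟩
    generalize k / (2 * ℓ) = t at h
    rw [h, node_index]
  · rintro ⟨i, s, t, ht, rfl⟩
    exact ⟨index ℓ i s t, index_lt (Nat.lt_succ_iff.2 ht), by rw [node_index]⟩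

/-- When the two families of walks start and end with different letters and have the same end
points, every point has degree at least two in the union of the walks. -/
lemma card_seen_le_card_queries {L : ℕ} (hL : 0 < L) (h0 : W false 0 ≠ W true 0)
    (h1 : W false (L - 1) ≠ W true (L - 1))
    (hcl : ∀ i, walk F (W false) L (x i) = walk F (W true) L (x i)) (hx : Function.Injective x) :
    (seen (node W x F) (2 * ℓ) (2 * ℓ * L)).card ≤
        (queries (letter ℓ W) (node W x F) (2 * ℓ * L)).card ∧
      ((queries (letter ℓ W) (node W x F) (2 * ℓ * L)).card ≤
        (seen (node W x F) (2 * ℓ) (2 * ℓ * L)).card →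
        ∀ (i i' : Fin ℓ) (s : Bool) (t : ℕ), t < L →
          (W true (L - 1), walk F (W true) (L - 1) (x i)) = (W s t, walk F (W s) t (x i')) →
          i' = i ∧ s = true ∧ t = L - 1) := by
  set E := queries (letter ℓ W) (node W x F) (2 * ℓ * L) with hE
  set V := seen (node W x F) (2 * ℓ) (2 * ℓ * L) with hV
  obtain ⟨M, rfl⟩ : ∃ M, L = M + 1 := ⟨L - 1, by omega⟩
  simp only [Nat.add_sub_cancel] at h1 ⊢
  set T := E.image fun e => (e.1, F e.1 e.2) with hT
  have hTcard : T.card = E.card := by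
    refine card_image_of_injective _ ?_
    rintro ⟨a, p⟩ ⟨b, q⟩ h
    simp only [Prod.mk.injEq] at h
    obtain ⟨rfl, h⟩ := h
    simpa using h
  have memE : ∀ (i : Fin ℓ) (s : Bool) (t : ℕ), t < M + 1 →
      (W s t, walk F (W s) t (x i)) ∈ E := fun i s t ht => mem_queries_node.2 ⟨i, s, t, ht, rfl⟩
  have memT : ∀ (i : Fin ℓ) (s : Bool) (t : ℕ), t < M + 1 →
      (W s t, walk F (W s) (t + 1) (x i)) ∈ T := fun i s t ht =>
    mem_image.2 ⟨_, memE i s t ht, rfl⟩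
  have hEV : ∀ e ∈ E, e.2 ∈ V := by
    intro e he
    obtain ⟨i, s, t, ht, rfl⟩ := mem_queries_node.1 he
    exact mem_seen_node.2 ⟨i, s, t, ht.le, rfl⟩
  have hTV : ∀ e ∈ T, e.2 ∈ V := by
    intro e he
    obtain ⟨e', he', rfl⟩ := mem_image.1 he
    obtain ⟨i, s, t, ht, rfl⟩ := mem_queries_node.1 he'
    exact mem_seen_node.2 ⟨i, s, t + 1, ht, rfl⟩
  have hsum : ∑ v ∈ V, ((E.filter fun e => e.2 = v).card + (T.filter fun e => e.2 = v).card) =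
      2 * E.card := by
    rw [Finset.sum_add_distrib, ← card_eq_sum_card_fiberwise hEV,
      ← card_eq_sum_card_fiberwise hTV, hTcard, two_mul]
  have two : ∀ (A : Finset (Bool × α)) (v : α) (b b' : Bool), b ≠ b' → (b, v) ∈ A → (b', v) ∈ A →
      2 ≤ (A.filter fun e => e.2 = v).card := by
    intro A v b b' hb h h'
    rw [← card_pair (a := (b, v)) (b := (b', v)) (by simpa using hb)]
    refine card_le_card ?_
    intro e he
    rcases mem_insert.1 he with rfl | he
    · simp [h]
    · rw [mem_singleton.1 he]; simp [h']
  have one : ∀ (A : Finset (Bool × α)) (v : α) (b : Bool), (b, v) ∈ A →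
      1 ≤ (A.filter fun e => e.2 = v).card := fun A v b h =>
    card_pos.2 ⟨(b, v), by simp [h]⟩
  have endT : ∀ i, 2 ≤ (T.filter fun e => e.2 = walk F (W true) (M + 1) (x i)).card := by
    intro i
    refine two T _ _ _ h1 ?_ (memT i true M (by omega))
    rw [← hcl i]; exact memT i false M (by omega)
  have hdeg : ∀ v ∈ V, 2 ≤ (E.filter fun e => e.2 = v).card + (T.filter fun e => e.2 = v).card := by
    intro v hv
    obtain ⟨i, s, t, ht, rfl⟩ := mem_seen_node.1 hv
    rcases Nat.eq_zero_or_pos t with rfl | ht0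
    · refine (two E _ _ _ h0 ?_ ?_).trans (Nat.le_add_right _ _)
      · exact memE i false 0 (by omega)
      · exact memE i true 0 (by omega)
    · rcases ht.eq_or_lt with rfl | hlt
      · refine le_trans ?_ (Nat.le_add_left _ _)
        cases s
        · rw [hcl]; exact endT i
        · exact endT i
      · obtain ⟨t, rfl⟩ : ∃ t', t = t' + 1 := ⟨t - 1, by omega⟩
        exact add_le_add (one E _ _ (memE i s (t + 1) hlt)) (one T _ _ (memT i s t (by omega)))
  constructor
  · have := Finset.sum_le_sum hdeg
    rw [hsum, sum_const, smul_eq_mul] at this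
    omega
  · intro hle i i' s t ht heq
    rw [Prod.mk.injEq] at heq
    obtain ⟨hl, hp⟩ := heq
    have hnext : walk F (W s) (t + 1) (x i') = walk F (W true) (M + 1) (x i) := by
      simp only [walk, Perm.mul_apply, ← hl, ← hp]
    rcases Nat.lt_or_ge (t + 1) (M + 1) with hlt | hge
    · exfalso
      have hv : walk F (W true) (M + 1) (x i) ∈ V := mem_seen_node.2 ⟨i, true, M + 1, le_rfl, rfl⟩
      have hbig : 2 < (E.filter fun e => e.2 = walk F (W true) (M + 1) (x i)).card +
          (T.filter fun e => e.2 = walk F (W true) (M + 1) (x i)).card := by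
        have h3 := one E _ _ (memE i' s (t + 1) hlt)
        rw [hnext] at h3
        have := endT i
        omega
      have := Finset.sum_lt_sum hdeg ⟨_, hv, hbig⟩
      rw [hsum, sum_const, smul_eq_mul] at this
      omega
    · obtain rfl : t = M := by omega
      have hs : s = true := by
        cases s
        · exact absurd hl.symm h1
        · rfl
      subst hs
      exact ⟨(hx ((walk F (W true) t).injective hp)).symm, rfl, rfl⟩

end

section
variable {ℓ : ℕ} [NeZero ℓ] {W : Bool → ℕ → Bool} {x : Fin ℓ → α}

/-- The last step of the `i`-th walk of the second family is fresh and hits the end point of the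
`i`-th walk of the first family. -/
def FreshClosing (W : Bool → ℕ → Bool) (x : Fin ℓ → α) (M : ℕ) (F : Bool → Perm α) (i : ℕ) :
    Prop :=
  (letter ℓ W (index ℓ i true M), node W x F (index ℓ i true M)) ∉
      queries (letter ℓ W) (node W x F) (index ℓ i true M) ∧
    node W x F (2 * ℓ + index ℓ i true M) ∈
      ({node W x F (2 * ℓ + index ℓ i false M)} : Finset α)

lemma FreshClosing.congr {M : ℕ} {F F' : Bool → Perm α} {i N : ℕ}
    (hN : 2 * ℓ + index ℓ i true M < N)
    (h : ∀ j < N, node W x F' j = node W x F j) :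
    FreshClosing W x M F' i ↔ FreshClosing W x M F i := by
  have h1 : index ℓ i false M < index ℓ i true M := by simp [index]
  have h2 : queries (letter ℓ W) (node W x F') (index ℓ i true M) =
      queries (letter ℓ W) (node W x F) (index ℓ i true M) := by
    refine image_congr fun j hj => ?_
    rw [h j (by have := mem_range.1 hj; omega)]
  rw [FreshClosing, FreshClosing, h2, h _ (by omega), h _ hN, h _ (by omega)]

lemma sum_freshClosing_le (M : ℕ) (hK : 2 * ℓ * (M + 1) < Fintype.card α) (j : ℕ) (hj : j ≤ ℓ) :
    ((Fintype.card α : ℝ) - (2 * ℓ * (M + 1) : ℕ)) ^ j *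
      ∑ F, ind (∀ i < j, FreshClosing W x M F i) ≤ Fintype.card (Bool → Perm α) := by
  have hnK : (0 : ℝ) < (Fintype.card α : ℝ) - (2 * ℓ * (M + 1) : ℕ) := by
    rw [sub_pos]; exact_mod_cast hK
  induction j with
  | zero =>
    rw [pow_zero, one_mul]
    refine (Finset.sum_le_sum fun F _ => ind_le_one _).trans (by simp)
  | succ j ih =>
    have hlt : index ℓ j true M < 2 * ℓ * (M + 1) := index_lt (i := ⟨j, hj⟩) (by simp)
    have hmono : ∀ i < j, index ℓ i true M < index ℓ j true M := fun i hi => by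
      simp [index]; omega
    have h1 : index ℓ j false M < index ℓ j true M := by simp [index]
    have key := (exploration_node W x).sum_fresh_le (index ℓ j true M)
      (fun F => ind (∀ i < j, FreshClosing W x M F i))
      (fun F => {node W x F (2 * ℓ + index ℓ j false M)}) 1 (fun F => ind_nonneg _)
      (fun F F' h => ind_congr (forall₂_congr fun i hi => FreshClosing.congr
        (by have := hmono i hi; omega) h))
      (fun F F' h => by simp only [h _ (by omega : 2 * ℓ + index ℓ j false M < _)])
      (fun F => by simp)
    have hle : ((Fintype.card α : ℝ) - (2 * ℓ * (M + 1) : ℕ)) ≤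
        (Fintype.card α : ℝ) - (index ℓ j true M : ℕ) := by
      have : ((index ℓ j true M : ℕ) : ℝ) ≤ (2 * ℓ * (M + 1) : ℕ) := by exact_mod_cast hlt.le
      linarith
    have heq : ∑ F, ind (∀ i < j + 1, FreshClosing W x M F i) =
        ∑ F, ind (∀ i < j, FreshClosing W x M F i) * ind (FreshClosing W x M F j) := by
      refine Finset.sum_congr rfl fun F _ => ?_
      rw [← ind_and]
      exact ind_congr Nat.forall_lt_succ_right
    have hnn : 0 ≤ ∑ F, ind (∀ i < j + 1, FreshClosing W x M F i) :=
      sum_nonneg fun _ _ => ind_nonneg _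
    rw [one_mul] at key
    calc _ = ((Fintype.card α : ℝ) - (2 * ℓ * (M + 1) : ℕ)) ^ j *
          (((Fintype.card α : ℝ) - (2 * ℓ * (M + 1) : ℕ)) *
            ∑ F, ind (∀ i < j + 1, FreshClosing W x M F i)) := by ring
      _ ≤ ((Fintype.card α : ℝ) - (2 * ℓ * (M + 1) : ℕ)) ^ j *
          ∑ F, ind (∀ i < j, FreshClosing W x M F i) := by
          refine mul_le_mul_of_nonneg_left ?_ (by positivity)
          refine (mul_le_mul_of_nonneg_right hle hnn).trans ?_
          rw [heq]
          exact key
      _ ≤ _ := ih (by omega)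

/-- Two walks with different first and last letters have the same effect on an `ℓ`-tuple with
probability at most about `n ^ (-ℓ)`. -/
lemma sum_ind_closed_le {L : ℕ} (hL : 0 < L) (h0 : W false 0 ≠ W true 0)
    (h1 : W false (L - 1) ≠ W true (L - 1)) (hx : Function.Injective x) {K : ℕ}
    (hLK : 2 * ℓ * L ≤ K) (hK : K < Fintype.card α)
    (hq : (K : ℝ) * (2 * K / (Fintype.card α - K)) ≤ 1) :
    ∑ F : Bool → Perm α, ind (∀ i, walk F (W false) L (x i) = walk F (W true) L (x i)) ≤
      (3 * ((K : ℝ) * (2 * K / (Fintype.card α - K))) ^ (ℓ + 1) +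
        1 / ((Fintype.card α : ℝ) - K) ^ ℓ) * Fintype.card (Bool → Perm α) := by
  have hℓ : 0 < ℓ := Nat.pos_of_ne_zero (NeZero.ne ℓ)
  obtain ⟨M, rfl⟩ : ∃ M, L = M + 1 := ⟨L - 1, by omega⟩
  simp only [Nat.add_sub_cancel] at h1
  set K' := 2 * ℓ * (M + 1) with hK'
  have hK'0 : 0 < K' := by positivity
  have hmK' : 2 * ℓ ≤ K' := Nat.le_mul_of_pos_right _ (by omega)
  have hnK : (0 : ℝ) < (Fintype.card α : ℝ) - K := by rw [sub_pos]; exact_mod_cast hK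
  have hKK : (K' : ℝ) ≤ K := by exact_mod_cast hLK
  have hmKr : ((2 * ℓ : ℕ) : ℝ) ≤ K' := by exact_mod_cast hmK'
  have hqle : (K' : ℝ) * (((2 * ℓ : ℕ) + K') / (Fintype.card α - K')) ≤
      K * (2 * K / (Fintype.card α - K)) :=
    mul_le_mul hKK (div_le_div₀ (by positivity) (by linarith) hnK (by linarith))
      (div_nonneg (by positivity) (by linarith)) (by positivity)
  have hq0 : 0 ≤ (K' : ℝ) * (((2 * ℓ : ℕ) + K') / (Fintype.card α - K')) := by
    have : (0 : ℝ) ≤ (Fintype.card α : ℝ) - K' := by linarith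
    positivity
  have hE := exploration_node W x
  have hcases : ∀ F : Bool → Perm α,
      ind (∀ i, walk F (W false) (M + 1) (x i) = walk F (W true) (M + 1) (x i)) ≤
      ind (ℓ + 1 ≤ excess (letter ℓ W) (node W x F) (2 * ℓ) K') +
        ind (∀ i < ℓ, FreshClosing W x M F i) := by
    intro F
    refine (ind_mono ?_).trans (ind_or_le _ _)
    intro hcl
    obtain ⟨hle, hfresh⟩ := card_seen_le_card_queries (by omega) h0 (by simpa using h1) hcl hx
    have hadd := hE.card_queries_add F K'
    have hv0 : ℓ ≤ (seen (node W x F) (2 * ℓ) 0).card := by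
      calc ℓ = (univ.image x).card := by rw [card_image_of_injective _ hx]; simp
        _ ≤ _ := by
          refine card_le_card ?_
          intro v hv
          obtain ⟨i, -, rfl⟩ := mem_image.1 hv
          have := mem_seen_node (W := W) (x := x) (F := F) (L := 0) (v := x i)
          rw [mul_zero] at this
          exact this.2 ⟨i, false, 0, le_rfl, rfl⟩
    rcases Nat.lt_or_ge (seen (node W x F) (2 * ℓ) K').card
      (queries (letter ℓ W) (node W x F) K').card with hlt | hge
    · left; omega
    · right
      intro i hi
      have hfi := hfresh hge ⟨i, hi⟩
      have e1 := node_index W x F ⟨i, hi⟩ true M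
      have e2 := letter_index W ⟨i, hi⟩ true M
      simp only at e1 e2
      constructor
      · intro hmem
        obtain ⟨k, hk, he⟩ := mem_image.1 hmem
        rw [mem_range] at hk
        obtain ⟨i', s, hki⟩ := exists_index (ℓ := ℓ) k
        have hkt : k / (2 * ℓ) < M + 1 :=
          Nat.div_lt_of_lt_mul (hk.trans (index_lt (i := ⟨i, hi⟩) (by simp)))
        generalize k / (2 * ℓ) = t at hki hkt
        rw [hki, letter_index, node_index, e1, e2] at he
        obtain ⟨h3, h4, h5⟩ := hfi i' s t hkt (by simpa using he.symm)
        rw [h3, h4, h5] at hki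
        simp at hki
        omega
      · rw [mem_singleton, ← index_succ, ← index_succ]
        have e3 := node_index W x F ⟨i, hi⟩ true (M + 1)
        have e4 := node_index W x F ⟨i, hi⟩ false (M + 1)
        simp only at e3 e4
        rw [e3, e4]
        exact (hcl _).symm
  have hA := hE.sum_excess_ge_le (K := K') hK'0 (by omega) (hqle.trans hq) (ℓ + 1)
  have hB := sum_freshClosing_le (W := W) (x := x) M (by omega) ℓ le_rfl
  rw [← hK'] at hB
  have hB' : ∑ F, ind (∀ i < ℓ, FreshClosing W x M F i) ≤
      1 / ((Fintype.card α : ℝ) - K) ^ ℓ * Fintype.card (Bool → Perm α) := by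
    rw [one_div_mul_eq_div, le_div_iff₀ (by positivity), mul_comm]
    refine le_trans ?_ hB
    have : 0 ≤ ∑ F, ind (∀ i < ℓ, FreshClosing W x M F i) :=
      sum_nonneg fun _ _ => ind_nonneg _
    gcongr
  calc _ ≤ _ := Finset.sum_le_sum fun F _ => hcases F
    _ = _ := Finset.sum_add_distrib
    _ ≤ 3 * ((K' : ℝ) * (((2 * ℓ : ℕ) + K') / (Fintype.card α - K'))) ^ (ℓ + 1) *
        Fintype.card (Bool → Perm α) + 1 / ((Fintype.card α : ℝ) - K) ^ ℓ *
        Fintype.card (Bool → Perm α) := add_le_add hA hB'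
    _ ≤ _ := by
        rw [add_mul]
        gcongr

end

omit [Fintype α] [DecidableEq α] in
lemma walk_add (F : Bool → Perm α) (W : ℕ → Bool) (a b : ℕ) :
    walk F W (a + b) = walk F (fun t => W (a + t)) b * walk F W a := by
  induction b with
  | zero => simp [walk]
  | succ b ih => rw [← add_assoc, walk, ih, walk, mul_assoc]

omit [Fintype α] [DecidableEq α] in
lemma walk_congr {F : Bool → Perm α} {W W' : ℕ → Bool} {k : ℕ} (h : ∀ t < k, W t = W' t) :
    walk F W k = walk F W' k := by
  induction k with
  | zero => rfl
  | succ k ih => rw [walk, walk, ih fun t ht => h t (by omega), h k (by omega)]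

lemma exists_strip {W W' : ℕ → Bool} {L : ℕ} (h : ∃ t < L, W t ≠ W' t) :
    ∃ a k c, 0 < k ∧ a + k + c = L ∧ W a ≠ W' a ∧ W (a + (k - 1)) ≠ W' (a + (k - 1)) ∧
      (∀ t < a, W t = W' t) ∧ ∀ t < c, W (a + k + t) = W' (a + k + t) := by
  classical
  have h2 : ∃ c, c < L ∧ W (L - 1 - c) ≠ W' (L - 1 - c) := by
    obtain ⟨t, ht, hne⟩ := h
    refine ⟨L - 1 - t, by omega, ?_⟩
    rwa [show L - 1 - (L - 1 - t) = t by omega]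
  have ha := Nat.find_spec h
  have ha' := fun t => Nat.find_min h (m := t)
  have hc := Nat.find_spec h2
  have hc' := fun t => Nat.find_min h2 (m := t)
  set a := Nat.find h
  set c := Nat.find h2
  have hle : a + c ≤ L - 1 := by
    by_contra hlt
    have := ha' (L - 1 - c) (by omega)
    exact this ⟨by omega, hc.2⟩
  refine ⟨a, L - a - c, c, by omega, by omega, ha.2, ?_, ?_, ?_⟩
  · rw [show a + (L - a - c - 1) = L - 1 - c by omega]; exact hc.2
  · intro t ht
    by_contra hne
    exact ha' t ht ⟨by omega, hne⟩
  · intro t ht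
    by_contra hne
    refine hc' (c - 1 - t) (by omega) ⟨by omega, ?_⟩
    rwa [show L - 1 - (c - 1 - t) = a + (L - a - c) + t by omega]

lemma sum_smul_emb {ℓ : ℕ} (π : Perm α) (f : (Fin ℓ ↪ α) → ℝ) :
    ∑ x : Fin ℓ ↪ α, f (π • x) = ∑ x, f x :=
  Fintype.sum_equiv (MulAction.toPerm π) _ _ fun _ => rfl

lemma sum_sum_ind_closed_le {ℓ : ℕ} [NeZero ℓ] {W W' : ℕ → Bool} {L K : ℕ}
    (h : ∃ t < L, W t ≠ W' t) (hLK : 2 * ℓ * L ≤ K) (hK : K < Fintype.card α)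
    (hq : (K : ℝ) * (2 * K / (Fintype.card α - K)) ≤ 1) :
    ∑ F : Bool → Perm α, ∑ x : Fin ℓ ↪ α, ind (walk F W L • x = walk F W' L • x) ≤
      Fintype.card (Fin ℓ ↪ α) * ((3 * ((K : ℝ) * (2 * K / (Fintype.card α - K))) ^ (ℓ + 1) +
        1 / ((Fintype.card α : ℝ) - K) ^ ℓ) * Fintype.card (Bool → Perm α)) := by
  obtain ⟨a, k, c, hk, rfl, h0, h1, hpre, hsuf⟩ := exists_strip h
  let V : Bool → ℕ → Bool := fun s t => (if s then W' else W) (a + t)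
  have hstrip : ∀ (F : Bool → Perm α) (x : Fin ℓ ↪ α),
      ind (walk F W (a + k + c) • x = walk F W' (a + k + c) • x) =
        ind (∀ i, walk F (V false) k ((walk F W a • x) i) =
          walk F (V true) k ((walk F W a • x) i)) := by
    intro F x
    refine ind_congr ?_
    rw [walk_add F W (a + k), walk_add F W' (a + k), walk_congr hsuf, mul_smul _ (walk F W _),
      mul_smul _ (walk F W' _), smul_left_cancel_iff, walk_add F W a, walk_add F W' a,
      ← walk_congr hpre, mul_smul, mul_smul, DFunLike.ext_iff]
    rfl
  calc _ = ∑ F : Bool → Perm α, ∑ x : Fin ℓ ↪ α,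
        ind (∀ i, walk F (V false) k (x i) = walk F (V true) k (x i)) := by
        refine Finset.sum_congr rfl fun F _ => ?_
        rw [Finset.sum_congr rfl fun x _ => hstrip F x]
        exact sum_smul_emb (walk F W a) fun x =>
          ind (∀ i, walk F (V false) k (x i) = walk F (V true) k (x i))
    _ = _ := Finset.sum_comm
    _ ≤ ∑ x : Fin ℓ ↪ α, ((3 * ((K : ℝ) * (2 * K / (Fintype.card α - K))) ^ (ℓ + 1) +
        1 / ((Fintype.card α : ℝ) - K) ^ ℓ) * Fintype.card (Bool → Perm α)) :=
        Finset.sum_le_sum fun x _ => sum_ind_closed_le hk (by simpa [V] using h0)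
          (by simpa [V] using h1) x.injective
          (le_trans (Nat.mul_le_mul_left _ (by omega)) hLK) hK hq
    _ = _ := by simp

/-- A finite word as an infinite one. -/
def pad {L : ℕ} (W : Fin L → Bool) (t : ℕ) : Bool := if h : t < L then W ⟨t, h⟩ else false

/-- The action of a finite word. -/
def word {L : ℕ} (F : Bool → Perm α) (W : Fin L → Bool) : Perm α := walk F (pad W) L

/-- Transition probabilities of the random walk of length `L` on `ℓ`-tuples. -/
noncomputable def trans (ℓ L : ℕ) (F : Bool → Perm α) (x y : Fin ℓ ↪ α) : ℝ :=
  (∑ W : Fin L → Bool, ind (word F W • x = y)) / 2 ^ L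

omit [Fintype α] [DecidableEq α] in
lemma word_append {L L' : ℕ} (F : Bool → Perm α) (U : Fin L → Bool) (V : Fin L' → Bool) :
    word F (Fin.append U V) = word F V * word F U := by
  rw [word, walk_add, word, word]
  congr 1
  · refine walk_congr fun t ht => ?_
    simp only [pad, ht, Nat.add_lt_add_iff_left, dif_pos]
    exact Fin.append_right U V ⟨t, ht⟩
  · refine walk_congr fun t ht => ?_
    simp only [pad, ht, dif_pos, Nat.lt_add_right L' ht]
    exact Fin.append_left U V ⟨t, ht⟩

lemma sum_ind_eq {ι : Type*} [Fintype ι] [DecidableEq ι] (a : ι) :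
    ∑ z, ind (a = z) = 1 := by
  simp [ind_eq_ite]

lemma sum_trans_right (ℓ L : ℕ) (F : Bool → Perm α) (x : Fin ℓ ↪ α) :
    ∑ y, trans ℓ L F x y = 1 := by
  simp only [trans]
  rw [← Finset.sum_div, Finset.sum_comm, Finset.sum_congr rfl fun W _ => sum_ind_eq _]
  simp

lemma sum_trans_left (ℓ L : ℕ) (F : Bool → Perm α) (y : Fin ℓ ↪ α) :
    ∑ x, trans ℓ L F x y = 1 := by
  simp only [trans]
  rw [← Finset.sum_div, Finset.sum_comm]
  have : ∀ W : Fin L → Bool, ∑ x : Fin ℓ ↪ α, ind (word F W • x = y) = 1 := fun W => by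
    rw [sum_smul_emb (word F W) fun x => ind (x = y)]
    simp [ind_eq_ite]
  rw [Finset.sum_congr rfl fun W _ => this W]
  simp

lemma trans_add (ℓ L L' : ℕ) (F : Bool → Perm α) (x y : Fin ℓ ↪ α) :
    trans ℓ (L + L') F x y = ∑ z, trans ℓ L F x z * trans ℓ L' F z y := by
  simp only [trans]
  rw [← Fintype.sum_equiv (Fin.appendEquiv L L') (fun p : (Fin L → Bool) × (Fin L' → Bool) =>
    ind (word F p.2 • word F p.1 • x = y)) _ (fun p => by
      simp only [Fin.appendEquiv, Equiv.coe_fn_mk, word_append, mul_smul])]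
  have : ∀ z : Fin ℓ ↪ α, (∑ W : Fin L → Bool, ind (word F W • x = z)) / 2 ^ L *
      ((∑ W : Fin L' → Bool, ind (word F W • z = y)) / 2 ^ L') =
      (∑ p : (Fin L → Bool) × (Fin L' → Bool), ind (word F p.1 • x = z) *
        ind (word F p.2 • z = y)) / 2 ^ (L + L') := by
    intro z
    rw [div_mul_div_comm, Finset.sum_mul_sum, ← pow_add, Fintype.sum_prod_type]
  rw [Finset.sum_congr rfl fun z _ => this z, ← Finset.sum_div, Finset.sum_comm]
  congr 1
  refine Finset.sum_congr rfl fun p _ => ?_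
  rw [Finset.sum_eq_single (word F p.1 • x)]
  · rw [ind_pos rfl, one_mul]
  · intro z _ hz
    rw [ind_neg (Ne.symm hz), zero_mul]
  · simp

/-- Deviation of the transition probabilities from the uniform distribution. -/
noncomputable def dev (ℓ L : ℕ) (F : Bool → Perm α) (x y : Fin ℓ ↪ α) : ℝ :=
  trans ℓ L F x y - 1 / Fintype.card (Fin ℓ ↪ α)

/-- Squared Hilbert–Schmidt norm of the deviation. -/
noncomputable def devSq (ℓ L : ℕ) (F : Bool → Perm α) : ℝ := ∑ x, ∑ y, dev ℓ L F x y ^ 2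

lemma devSq_nonneg (ℓ L : ℕ) (F : Bool → Perm α) : 0 ≤ devSq ℓ L F := by
  unfold devSq; positivity

section
variable {ℓ : ℕ} (hN : 0 < Fintype.card (Fin ℓ ↪ α))
include hN

lemma dev_add (L L' : ℕ) (F : Bool → Perm α) (x y : Fin ℓ ↪ α) :
    dev ℓ (L + L') F x y = ∑ z, dev ℓ L F x z * dev ℓ L' F z y := by
  have hN' : (Fintype.card (Fin ℓ ↪ α) : ℝ) ≠ 0 := by exact_mod_cast hN.ne'
  have h1 := sum_trans_right ℓ L F x
  have h2 := sum_trans_left ℓ L' F y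
  simp only [dev, sub_mul, mul_sub, Finset.sum_sub_distrib, ← Finset.sum_mul, ← Finset.mul_sum,
    trans_add, h1, h2, sum_const, card_univ, nsmul_eq_mul]
  field_simp
  ring

lemma devSq_add_le (L L' : ℕ) (F : Bool → Perm α) :
    devSq ℓ (L + L') F ≤ devSq ℓ L F * devSq ℓ L' F := by
  unfold devSq
  calc _ ≤ ∑ x, ∑ y, (∑ z, dev ℓ L F x z ^ 2) * ∑ z, dev ℓ L' F z y ^ 2 := by
        refine Finset.sum_le_sum fun x _ => Finset.sum_le_sum fun y _ => ?_
        rw [dev_add hN]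
        exact Finset.sum_mul_sq_le_sq_mul_sq _ _ _
    _ = (∑ x, ∑ z, dev ℓ L F x z ^ 2) * ∑ y, ∑ z, dev ℓ L' F z y ^ 2 := by
        rw [Finset.sum_mul_sum]
    _ = _ := by rw [Finset.sum_comm (f := fun y z => dev ℓ L' F z y ^ 2)]

lemma devSq_mul_le (L R : ℕ) (F : Bool → Perm α) :
    devSq ℓ (L * (R + 1)) F ≤ devSq ℓ L F ^ (R + 1) := by
  induction R with
  | zero => simp
  | succ R ih =>
    rw [mul_add, mul_one, pow_succ]
    exact (devSq_add_le hN _ _ F).trans (mul_le_mul_of_nonneg_right ih (devSq_nonneg _ _ _))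

lemma devSq_eq (L : ℕ) (F : Bool → Perm α) :
    devSq ℓ L F = (∑ W : Fin L → Bool, ∑ W' : Fin L → Bool, ∑ x : Fin ℓ ↪ α,
      ind (word F W • x = word F W' • x)) / 4 ^ L - 1 := by
  have hN' : (Fintype.card (Fin ℓ ↪ α) : ℝ) ≠ 0 := by exact_mod_cast hN.ne'
  have h1 : ∑ x : Fin ℓ ↪ α, ∑ y, trans ℓ L F x y ^ 2 =
      (∑ W : Fin L → Bool, ∑ W' : Fin L → Bool, ∑ x : Fin ℓ ↪ α,
        ind (word F W • x = word F W' • x)) / 4 ^ L := by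
    have h4 : (4 : ℝ) ^ L = (2 ^ L) ^ 2 := by rw [← pow_mul, mul_comm, pow_mul]; norm_num
    simp only [trans, div_pow, h4]
    simp only [← Finset.sum_div, sq (∑ W : Fin L → Bool, _), Finset.sum_mul_sum]
    congr 1
    calc _ = ∑ x : Fin ℓ ↪ α, ∑ W : Fin L → Bool, ∑ W' : Fin L → Bool, ∑ y,
          ind (word F W • x = y) * ind (word F W' • x = y) := by
          refine Finset.sum_congr rfl fun x _ => ?_
          rw [Finset.sum_comm]
          exact Finset.sum_congr rfl fun W _ => Finset.sum_comm
      _ = ∑ x : Fin ℓ ↪ α, ∑ W : Fin L → Bool, ∑ W' : Fin L → Bool,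
          ind (word F W • x = word F W' • x) := by
          refine Finset.sum_congr rfl fun x _ => Finset.sum_congr rfl fun W _ =>
            Finset.sum_congr rfl fun W' _ => ?_
          rw [Finset.sum_eq_single (word F W' • x)]
          · rw [ind_pos (rfl : word F W' • x = _), mul_one]
          · intro z _ hz
            rw [ind_neg (P := word F W' • x = z) (Ne.symm hz), mul_zero]
          · simp
      _ = _ := by
          rw [Finset.sum_comm]
          exact Finset.sum_congr rfl fun W _ => Finset.sum_comm
  have h2 : ∀ x y : Fin ℓ ↪ α, dev ℓ L F x y ^ 2 = trans ℓ L F x y ^ 2 -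
      2 / Fintype.card (Fin ℓ ↪ α) * trans ℓ L F x y +
      1 / (Fintype.card (Fin ℓ ↪ α) : ℝ) ^ 2 := fun x y => by
    rw [dev]; field_simp; ring
  simp only [devSq, h2, Finset.sum_add_distrib, Finset.sum_sub_distrib, h1, ← Finset.mul_sum,
    sum_trans_right, sum_const, card_univ, nsmul_eq_mul]
  field_simp
  ring

lemma sum_devSq_le [NeZero ℓ] {L K : ℕ} (hLK : 2 * ℓ * L ≤ K) (hK : K < Fintype.card α)
    (hq : (K : ℝ) * (2 * K / (Fintype.card α - K)) ≤ 1) :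
    ∑ F : Bool → Perm α, devSq ℓ L F ≤ (Fintype.card (Fin ℓ ↪ α) / 2 ^ L +
      (Fintype.card (Fin ℓ ↪ α) * (3 * ((K : ℝ) * (2 * K / (Fintype.card α - K))) ^ (ℓ + 1) +
        1 / ((Fintype.card α : ℝ) - K) ^ ℓ) - 1)) * Fintype.card (Bool → Perm α) := by
  set κ := 3 * ((K : ℝ) * (2 * K / (Fintype.card α - K))) ^ (ℓ + 1) +
        1 / ((Fintype.card α : ℝ) - K) ^ ℓ with hκ
  set N : ℝ := (Fintype.card (Fin ℓ ↪ α) : ℝ) with hNd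
  set Ω : ℝ := (Fintype.card (Bool → Perm α) : ℝ) with hΩ
  have hnK : (0 : ℝ) < (Fintype.card α : ℝ) - K := by rw [sub_pos]; exact_mod_cast hK
  have hκ0 : 0 ≤ κ := by positivity
  have h1 : ∀ W W' : Fin L → Bool, ∑ F : Bool → Perm α, ∑ x : Fin ℓ ↪ α,
      ind (word F W • x = word F W' • x) ≤ ind (W = W') * (N * Ω) + N * (κ * Ω) := by
    intro W W'
    by_cases h : W = W'
    · subst h
      rw [ind_pos rfl, one_mul]
      calc _ ≤ ∑ F : Bool → Perm α, ∑ x : Fin ℓ ↪ α, (1 : ℝ) :=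
            Finset.sum_le_sum fun _ _ => Finset.sum_le_sum fun _ _ => ind_le_one _
        _ = N * Ω := by simp [hNd, hΩ, mul_comm]
        _ ≤ _ := le_add_of_nonneg_right (by positivity)
    · rw [ind_neg h, zero_mul, zero_add]
      refine sum_sum_ind_closed_le ?_ hLK hK hq
      obtain ⟨t, ht⟩ := Function.ne_iff.1 h
      exact ⟨t, t.2, by simpa [pad] using ht⟩
  calc _ = (∑ W : Fin L → Bool, ∑ W' : Fin L → Bool, ∑ F : Bool → Perm α, ∑ x : Fin ℓ ↪ α,
        ind (word F W • x = word F W' • x)) / 4 ^ L - Ω := by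
        simp only [devSq_eq hN, Finset.sum_sub_distrib, ← Finset.sum_div]
        congr 2
        · rw [Finset.sum_comm]
          exact Finset.sum_congr rfl fun W _ => Finset.sum_comm
        · simp [hΩ]
    _ ≤ (∑ W : Fin L → Bool, ∑ W' : Fin L → Bool, (ind (W = W') * (N * Ω) + N * (κ * Ω))) / 4 ^ L
        - Ω := by
        gcongr with W _ W' _
        exact h1 W W'
    _ = _ := by
        simp only [Finset.sum_add_distrib, ← Finset.sum_mul, sum_ind_eq]
        simp only [sum_const, card_univ, Fintype.card_pi, Fintype.card_bool, prod_const,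
          Fintype.card_fin, nsmul_eq_mul]
        push_cast
        have h4 : (4 : ℝ) ^ L = 2 ^ L * 2 ^ L := by rw [← mul_pow]; norm_num
        rw [h4]
        field_simp
        ring

end

/-- The random walk of length `K` on triples is close to uniform. -/
def Mixing (K : ℕ) (F : Bool → Perm α) : Prop :=
  ∀ x y : Fin 3 ↪ α, |dev 3 K F x y| ≤ 1 / (Fintype.card α : ℝ) ^ 5

lemma card_triples (h : 3 ≤ Fintype.card α) :
    (Fintype.card (Fin 3 ↪ α) : ℝ) =
      (Fintype.card α : ℝ) * ((Fintype.card α : ℝ) - 1) * ((Fintype.card α : ℝ) - 2) := by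
  rw [Fintype.card_embedding_eq, Fintype.card_fin]
  obtain ⟨m, hm⟩ := Nat.exists_eq_add_of_le h
  rw [hm]
  simp only [Nat.descFactorial, Nat.sub_zero]
  rw [show 3 + m - 2 = m + 1 by omega, show 3 + m - 1 = m + 2 by omega]
  push_cast
  ring

lemma mixing_of_devSq_le {L : ℕ} {F : Bool → Perm α} (hn : 3 ≤ Fintype.card α)
    (h : devSq 3 L F ≤ 1 / Real.sqrt (Fintype.card α)) : Mixing (L * 20) F := by
  have hn' : (0 : ℝ) < Fintype.card α := by exact_mod_cast (by omega)
  have hN : 0 < Fintype.card (Fin 3 ↪ α) := card_emb_pos (s := 2) (by omega)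
  intro x y
  have h1 : dev 3 (L * 20) F x y ^ 2 ≤ devSq 3 (L * 20) F := by
    unfold devSq
    exact (single_le_sum (f := fun y => dev 3 (L * 20) F x y ^ 2)
      (fun _ _ => sq_nonneg _) (mem_univ y)).trans
      (single_le_sum (f := fun x => ∑ y, dev 3 (L * 20) F x y ^ 2)
      (fun _ _ => sum_nonneg fun _ _ => sq_nonneg _) (mem_univ x))
  have h2 : devSq 3 (L * 20) F ≤ (1 / Real.sqrt (Fintype.card α)) ^ 20 :=
    (devSq_mul_le hN L 19 F).trans (pow_le_pow_left₀ (devSq_nonneg _ _ _) h 20)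
  have h3 : (1 / Real.sqrt (Fintype.card α)) ^ 20 = (1 / (Fintype.card α : ℝ) ^ 5) ^ 2 := by
    rw [div_pow, one_pow, show 20 = 2 * 10 by norm_num, pow_mul, Real.sq_sqrt hn'.le]
    rw [div_pow, one_pow, ← pow_mul]
  exact abs_le_of_sq_le_sq (h1.trans (h2.trans h3.le)) (by positivity)

lemma sum_not_mixing_le {L K : ℕ} (hn : 3 ≤ Fintype.card α) (hLK : 6 * L ≤ K)
    (hK : K < Fintype.card α) (hq : (K : ℝ) * (2 * K / (Fintype.card α - K)) ≤ 1) :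
    ∑ F : Bool → Perm α, ind (¬ Mixing (L * 20) F) ≤ Real.sqrt (Fintype.card α) *
      (((Fintype.card α : ℝ) ^ 3 / 2 ^ L + ((Fintype.card α : ℝ) ^ 3 *
        (3 * ((K : ℝ) * (2 * K / (Fintype.card α - K))) ^ 4 +
        1 / ((Fintype.card α : ℝ) - K) ^ 3) - 1)) * Fintype.card (Bool → Perm α)) := by
  have hn' : (0 : ℝ) < Fintype.card α := by exact_mod_cast (by omega)
  have hs : 0 < Real.sqrt (Fintype.card α) := Real.sqrt_pos.2 hn'
  have hN : 0 < Fintype.card (Fin 3 ↪ α) := card_emb_pos (s := 2) (by omega)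
  have hnK : (0 : ℝ) < (Fintype.card α : ℝ) - K := by rw [sub_pos]; exact_mod_cast hK
  have hNle : (Fintype.card (Fin 3 ↪ α) : ℝ) ≤ (Fintype.card α : ℝ) ^ 3 := by
    rw [Fintype.card_embedding_eq, Fintype.card_fin]
    exact_mod_cast Nat.descFactorial_le_pow _ _
  have h1 : ∀ F : Bool → Perm α, ind (¬ Mixing (L * 20) F) ≤
      Real.sqrt (Fintype.card α) * devSq 3 L F := by
    intro F
    by_cases h : Mixing (L * 20) F
    · rw [ind_neg (not_not.2 h)]; exact mul_nonneg hs.le (devSq_nonneg _ _ _)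
    · rw [ind_pos h]
      have : 1 / Real.sqrt (Fintype.card α) < devSq 3 L F := by
        by_contra hc
        exact h (mixing_of_devSq_le hn (not_lt.1 hc))
      rw [div_lt_iff₀ hs] at this
      linarith
  refine (Finset.sum_le_sum fun F _ => h1 F).trans ?_
  rw [← Finset.mul_sum]
  refine mul_le_mul_of_nonneg_left ?_ hs.le
  refine (sum_devSq_le hN (by simpa using hLK) hK hq).trans ?_
  gcongr

/-- The expected number of words of length `K` sending `x` into `Y`. -/
lemma sum_word_mem (K : ℕ) (F : Bool → Perm α) (x : Fin 3 ↪ α) (Y : Finset (Fin 3 ↪ α)) :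
    ∑ W : Fin K → Bool, ind (word F W • x ∈ Y) = 2 ^ K * ∑ y ∈ Y, trans 3 K F x y := by
  simp only [trans]
  rw [← Finset.sum_div, mul_div_cancel₀ _ (by positivity), Finset.sum_comm]
  refine Finset.sum_congr rfl fun W _ => ?_
  simp [ind_eq_ite]

lemma Mixing.le_sum_word_mem {K : ℕ} {F : Bool → Perm α} (h : Mixing K F) (x : Fin 3 ↪ α)
    (Y : Finset (Fin 3 ↪ α)) :
    2 ^ K * (Y.card * (1 / (Fintype.card (Fin 3 ↪ α) : ℝ) - 1 / (Fintype.card α : ℝ) ^ 5)) ≤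
      ∑ W : Fin K → Bool, ind (word F W • x ∈ Y) := by
  rw [sum_word_mem]
  gcongr
  rw [← nsmul_eq_mul]
  refine card_nsmul_le_sum _ _ _ fun y _ => ?_
  have := (abs_le.1 (h x y)).1
  rw [dev] at this
  linarith

lemma Mixing.sum_word_mem_le {K : ℕ} {F : Bool → Perm α} (h : Mixing K F) (x : Fin 3 ↪ α)
    (Y : Finset (Fin 3 ↪ α)) :
    ∑ W : Fin K → Bool, ind (word F W • x ∈ Y) ≤
      2 ^ K * (Y.card * (1 / (Fintype.card (Fin 3 ↪ α) : ℝ) + 1 / (Fintype.card α : ℝ) ^ 5)) := by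
  rw [sum_word_mem]
  gcongr
  rw [← nsmul_eq_mul]
  refine sum_le_card_nsmul _ _ _ fun y _ => ?_
  have := (abs_le.1 (h x y)).2
  rw [dev] at this
  linarith

/-- A triple of distinct points. -/
def triple (p q r : α) (hpq : p ≠ q) (hpr : p ≠ r) (hqr : q ≠ r) : Fin 3 ↪ α where
  toFun := ![p, q, r]
  inj' := by
    intro i j h
    fin_cases i <;> fin_cases j <;> simp_all

lemma card_split_two_ge (S : Finset α) :
    (Sᶜ.card * S.card) * (Fintype.card α - 2) ≤
      (univ.filter fun y : Fin 3 ↪ α => y 0 ∉ S ∧ y 1 ∈ S).card := by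
  have h1 : ((Sᶜ ×ˢ S).sigma fun pq => ({pq.1, pq.2} : Finset α)ᶜ).card =
      (Sᶜ.card * S.card) * (Fintype.card α - 2) := by
    rw [card_sigma, ← card_product, ← smul_eq_mul, ← sum_const]
    refine Finset.sum_congr rfl fun pq h => ?_
    rw [mem_product, mem_compl] at h
    rw [card_compl, card_pair]
    rintro h'
    exact h.1 (h' ▸ h.2)
  rw [← h1]
  refine card_le_card_of_surjOn (fun y => ⟨(y 0, y 1), y 2⟩) ?_
  rintro ⟨⟨p, q⟩, r⟩ h
  simp only [coe_sigma, Set.mem_sigma_iff, mem_coe, mem_product, mem_compl, mem_insert,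
    mem_singleton, not_or] at h
  obtain ⟨⟨hp, hq⟩, hr⟩ := h
  refine ⟨triple p q r (fun h => hp (h ▸ hq)) (Ne.symm hr.1) (Ne.symm hr.2), ?_, rfl⟩
  simp only [coe_filter, mem_univ, true_and, Set.mem_ofPred_eq]
  exact ⟨hp, hq⟩

lemma card_split_three_le (S : Finset α) :
    (univ.filter fun y : Fin 3 ↪ α => y 0 ∉ S ∧ y 1 ∈ S ∧ y 2 ∈ S).card ≤
      Sᶜ.card * (S.card * S.card - S.card) := by
  rw [← offDiag_card, ← card_product]
  refine card_le_card_of_injOn (fun y => (y 0, y 1, y 2)) ?_ ?_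
  · intro y hy
    have hy := (mem_filter.1 hy).2
    simp [hy.1, hy.2.1, hy.2.2]
  · intro y _ y' _ h
    simp only [Prod.mk.injEq] at h
    ext i
    fin_cases i
    exacts [h.1, h.2.1, h.2.2]

/-- `x` is a product of at most `D` of the generators and their inverses. -/
def Reach (F : Bool → Perm α) (D : ℕ) (x : Perm α) : Prop :=
  ∃ l : List (Perm α), (∀ s ∈ l, s = F true ∨ s = F false ∨ s = (F true)⁻¹ ∨ s = (F false)⁻¹) ∧
    l.prod = x ∧ l.length ≤ D

omit [Fintype α] [DecidableEq α] in
lemma Reach.mono {F : Bool → Perm α} {D D' : ℕ} {x : Perm α} (h : Reach F D x) (hD : D ≤ D') :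
    Reach F D' x := by
  obtain ⟨l, h1, h2, h3⟩ := h
  exact ⟨l, h1, h2, h3.trans hD⟩

omit [Fintype α] [DecidableEq α] in
lemma reach_one (F : Bool → Perm α) : Reach F 0 1 := ⟨[], by simp⟩

omit [Fintype α] [DecidableEq α] in
lemma reach_apply (F : Bool → Perm α) (b : Bool) : Reach F 1 (F b) :=
  ⟨[F b], by cases b <;> simp⟩

omit [Fintype α] [DecidableEq α] in
lemma Reach.mul {F : Bool → Perm α} {D D' : ℕ} {x y : Perm α} (hx : Reach F D x)
    (hy : Reach F D' y) : Reach F (D + D') (x * y) := by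
  obtain ⟨l, h1, rfl, h3⟩ := hx
  obtain ⟨l', h1', rfl, h3'⟩ := hy
  refine ⟨l ++ l', fun s hs => ?_, by simp, by simp; omega⟩
  exact (List.mem_append.1 hs).elim (h1 s) (h1' s)

omit [Fintype α] [DecidableEq α] in
lemma Reach.inv {F : Bool → Perm α} {D : ℕ} {x : Perm α} (hx : Reach F D x) :
    Reach F D x⁻¹ := by
  obtain ⟨l, h1, rfl, h3⟩ := hx
  refine ⟨(l.map fun s => s⁻¹).reverse, fun s hs => ?_, by rw [List.prod_inv_reverse], by simpa⟩
  simp only [List.mem_reverse, List.mem_map] at hs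
  obtain ⟨t, ht, rfl⟩ := hs
  rcases h1 t ht with h | h | h | h <;> simp [h]

omit [Fintype α] [DecidableEq α] in
lemma Reach.pow {F : Bool → Perm α} {D : ℕ} {x : Perm α} (hx : Reach F D x) (k : ℕ) :
    Reach F (k * D) (x ^ k) := by
  induction k with
  | zero => simpa using reach_one F
  | succ k ih => rw [pow_succ, add_mul, one_mul]; exact ih.mul hx

omit [Fintype α] [DecidableEq α] in
lemma reach_word {K : ℕ} (F : Bool → Perm α) (W : Fin K → Bool) : Reach F K (word F W) := by
  have : ∀ (V : ℕ → Bool) (k : ℕ), Reach F k (walk F V k) := by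
    intro V k
    induction k with
    | zero => exact reach_one F
    | succ k ih => rw [walk, add_comm]; exact (reach_apply F _).mul ih
  exact this _ _

lemma split_inequality {n k N η P : ℝ} (hn : 200 ≤ n) (hk2 : 2 ≤ k) (hkn : k < n) (hN : 0 < N)
    (hP : 0 < P) (hη0 : 0 ≤ η) (hη : N * η ≤ 1 / 1000)
    (h : 51 * k ^ 2 * (P * ((n - k) * k * (n - 2) * (1 / N - η))) ≤
      50 * n * ((k - 2) * (P * ((n - k) * (k * k - k) * (1 / N + η))))) : False := by
  have hNi : N * (1 / N) = 1 := mul_one_div_cancel hN.ne'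
  have f2 : 51 * k ^ 2 * ((n - 2) * (N * (1 / N - η))) ≤
      50 * n * ((k - 2) * ((k - 1) * (N * (1 / N + η)))) := by
    have hpos : 0 < P * ((n - k) * k) := by
      have : 0 < n - k := by linarith
      positivity
    refine le_of_mul_le_mul_left ?_ hpos
    have := mul_le_mul_of_nonneg_left h hN.le
    calc _ = N * (51 * k ^ 2 * (P * ((n - k) * k * (n - 2) * (1 / N - η)))) := by ring
      _ ≤ _ := this
      _ = _ := by ring
  rw [mul_sub, mul_add, hNi] at f2
  have hδ0 : 0 ≤ N * η := by positivity
  generalize N * η = δ at *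
  have g1 : 51 * k ^ 2 * ((n - 2) * (1 - 1 / 1000)) ≤ 51 * k ^ 2 * ((n - 2) * (1 - δ)) := by
    have : (0 : ℝ) ≤ n - 2 := by linarith
    gcongr
  have g2 : 50 * n * ((k - 2) * ((k - 1) * (1 + δ))) ≤ 50 * n * (k * (k * (1 + 1 / 1000))) := by
    have : 0 ≤ k - 2 := by linarith
    have : 0 ≤ k - 1 := by linarith
    have : 0 ≤ n := by linarith
    gcongr <;> linarith
  have g3 : 0 < k ^ 2 * (51 * ((n - 2) * (1 - 1 / 1000)) - 50 * n * (1 + 1 / 1000)) :=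
    mul_pos (by positivity) (by linarith)
  nlinarith

lemma exists_word_split {K : ℕ} {F : Bool → Perm α} (hF : Mixing K F)
    (hn : 200 ≤ Fintype.card α) {S : Finset α} (hS : S.card < Fintype.card α) {x₀ x₁ : α}
    (h₀ : x₀ ∈ S) (h₁ : x₁ ∈ S) (hne : x₀ ≠ x₁) :
    ∃ W : Fin K → Bool, word F W x₀ ∉ S ∧ word F W x₁ ∈ S ∧
      50 * (((S.erase x₀).erase x₁).filter fun z => word F W z ∈ S).card * Fintype.card α ≤
        51 * S.card ^ 2 := by
  by_contra hcon
  push Not at hcon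
  set T := (S.erase x₀).erase x₁ with hT
  set n := Fintype.card α with hndef
  have hTc : T.card + 2 = S.card := by
    have h1 := card_erase_add_one h₀
    have h2 : T.card + 1 = _ := card_erase_add_one (mem_erase.2 ⟨hne.symm, h₁⟩)
    omega
  obtain ⟨z₀, hz₀⟩ : ∃ z₀, z₀ ∉ ({x₀, x₁} : Finset α) := by
    by_contra! h
    have h3 : Fintype.card α ≤ 2 := by
      rw [← card_univ]
      exact (card_le_card fun z _ => h z).trans card_le_two
    omega
  simp only [mem_insert, mem_singleton, not_or] at hz₀
  set Y₂ := univ.filter fun y : Fin 3 ↪ α => y 0 ∉ S ∧ y 1 ∈ S with hY₂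
  set Y₃ := univ.filter fun y : Fin 3 ↪ α => y 0 ∉ S ∧ y 1 ∈ S ∧ y 2 ∈ S with hY₃
  set E : (Fin K → Bool) → Prop := fun W => word F W x₀ ∉ S ∧ word F W x₁ ∈ S with hE
  have hTne : ∀ z : T, x₀ ≠ z ∧ x₁ ≠ z := by
    rintro ⟨z, hz⟩
    simp only [hT, mem_erase] at hz
    exact ⟨Ne.symm hz.2.1, Ne.symm hz.1⟩
  have low := hF.le_sum_word_mem (triple x₀ x₁ z₀ hne (Ne.symm hz₀.1) (Ne.symm hz₀.2)) Y₂
  have lowE : ∀ W : Fin K → Bool,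
      ind (word F W • triple x₀ x₁ z₀ hne (Ne.symm hz₀.1) (Ne.symm hz₀.2) ∈ Y₂) = ind (E W) := by
    intro W
    refine ind_congr ?_
    rw [hY₂, mem_filter]
    simp only [mem_univ, true_and]
    rfl
  simp only [lowE] at low
  have up := Finset.sum_le_sum fun (z : T) (_ : z ∈ univ) =>
    hF.sum_word_mem_le (triple x₀ x₁ z hne (hTne z).1 (hTne z).2) Y₃
  have upE : ∀ (z : T) (W : Fin K → Bool),
      ind (word F W • triple x₀ x₁ z hne (hTne z).1 (hTne z).2 ∈ Y₃) =
        ind (E W) * ind (word F W z ∈ S) := by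
    intro z W
    rw [← ind_and]
    refine ind_congr ?_
    rw [hY₃, mem_filter]
    simp only [mem_univ, true_and, hE, and_assoc]
    rfl
  simp only [upE] at up
  rw [Finset.sum_comm] at up
  have mid : ∀ W : Fin K → Bool, 51 * (S.card : ℝ) ^ 2 * ind (E W) ≤
      50 * n * ∑ z : T, ind (E W) * ind (word F W z ∈ S) := by
    intro W
    by_cases h : E W
    · simp only [ind_pos h, mul_one, one_mul]
      rw [sum_coe_sort T fun z => ind (word F W z ∈ S), sum_ind]
      have := hcon W h.1 h.2
      have : (51 * S.card ^ 2 : ℝ) ≤ 50 * (T.filter fun z => word F W z ∈ S).card * n := by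
        exact_mod_cast this.le
      linarith
    · simp [ind_neg h]
  have mid' := Finset.sum_le_sum fun W (_ : W ∈ univ) => mid W
  rw [← Finset.mul_sum, ← Finset.mul_sum] at mid'
  have c2 := card_split_two_ge S
  have c3 := card_split_three_le S
  rw [← hY₂] at c2
  rw [← hY₃] at c3
  have hSc : S.card ≤ S.card * S.card := Nat.le_mul_self _
  have hn' : (200 : ℝ) ≤ n := by exact_mod_cast hn
  set N : ℝ := (Fintype.card (Fin 3 ↪ α) : ℝ) with hN
  have hNv : N = n * ((n : ℝ) - 1) * ((n : ℝ) - 2) := card_triples (by omega)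
  have hNpos : 0 < N := by
    rw [hNv]; exact mul_pos (mul_pos (by linarith) (by linarith)) (by linarith)
  have hη : N * (1 / (n : ℝ) ^ 5) ≤ 1 / 1000 := by
    rw [mul_one_div, div_le_div_iff₀ (by positivity) (by norm_num), hNv]
    have : (n : ℝ) * (n - 1) * (n - 2) ≤ n * n * n := by
      gcongr <;> linarith
    have h5 : (n : ℝ) * n * n * 1000 ≤ n * n * n * (n * n) := by
      gcongr
      nlinarith
    nlinarith
  have hSc' : (Sᶜ.card : ℝ) = n - S.card := by
    rw [card_compl, Nat.cast_sub hS.le]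
  have hkn : (S.card : ℝ) < n := by exact_mod_cast hS
  have hk2 : (2 : ℝ) ≤ S.card := by
    rw [← hTc]; push_cast; linarith [(Nat.cast_nonneg T.card : (0:ℝ) ≤ _)]
  have hTk : (Fintype.card T : ℝ) = S.card - 2 := by
    rw [Fintype.card_coe, ← hTc]; push_cast; ring
  set k : ℝ := (S.card : ℝ) with hk
  have c2' : (n - k) * k * (n - 2) ≤ (Y₂.card : ℝ) := by
    have h : ((Sᶜ.card * S.card * (n - 2) : ℕ) : ℝ) ≤ Y₂.card := by exact_mod_cast c2
    push_cast [Nat.cast_sub (by omega : 2 ≤ n)] at h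
    rwa [hSc'] at h
  have c3' : (Y₃.card : ℝ) ≤ (n - k) * (k * k - k) := by
    have h : (Y₃.card : ℝ) ≤ ((Sᶜ.card * (S.card * S.card - S.card) : ℕ) : ℝ) := by
      exact_mod_cast c3
    push_cast [Nat.cast_sub hSc] at h
    rwa [hSc'] at h
  rw [sum_const, card_univ, nsmul_eq_mul, hTk] at up
  set η : ℝ := 1 / (n : ℝ) ^ 5 with hηdef
  have h2K : (0 : ℝ) < 2 ^ K := by positivity
  have hη0 : 0 ≤ η := by positivity
  have hlo : 0 ≤ 1 / N - η := by
    have : 0 ≤ N * (1 / N - η) := by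
      rw [mul_sub, mul_one_div_cancel hNpos.ne']; linarith
    exact nonneg_of_mul_nonneg_right this hNpos
  have hk2' : 0 ≤ k - 2 := by linarith
  refine split_inequality hn' hk2 hkn hNpos h2K hη0 hη ?_
  calc _ ≤ 51 * k ^ 2 * (2 ^ K * (Y₂.card * (1 / N - η))) := by gcongr
    _ ≤ _ := mul_le_mul_of_nonneg_left low (by positivity)
    _ ≤ _ := mid'
    _ ≤ _ := mul_le_mul_of_nonneg_left up (by positivity)
    _ ≤ _ := by gcongr

omit [Fintype α] [DecidableEq α] in
lemma apply_inv_apply (a : Perm α) (y : α) : a (a⁻¹ y) = y := by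
  rw [← Perm.mul_apply, mul_inv_cancel, Perm.one_apply]

lemma support_commutator_subset (a b : Perm α) :
    (a * b * a⁻¹ * b⁻¹).support ⊆ (a.support ∩ b.support) ∪
      ((a.support ∩ b.support).image a ∪ (a.support ∩ b.support).image b) := by
  intro y hy
  by_contra hc
  simp only [mem_union, mem_image, not_or, not_exists, not_and] at hc
  obtain ⟨h1, h2, h3⟩ := hc
  have h2 := fun h h' => h2 (a⁻¹ y) (mem_inter.2 ⟨h, h'⟩) (by simp)
  have h3 := fun h h' => h3 (b⁻¹ y) (mem_inter.2 ⟨h, h'⟩) (by simp)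
  simp only [mem_inter, not_and] at h1
  rw [Perm.mem_support] at hy
  refine hy ?_
  simp only [Perm.mul_apply]
  by_cases hT : y ∈ b.support
  · have hb : b⁻¹ y ∉ a.support := fun h => h3 h (by
      rw [← Perm.support_inv, Perm.apply_mem_support, Perm.support_inv]; exact hT)
    have ha : a⁻¹ (b⁻¹ y) = b⁻¹ y := by
      rw [← Perm.support_inv, Perm.notMem_support] at hb; exact hb
    rw [ha, apply_inv_apply]
    by_contra hay
    exact h1 (Perm.mem_support.2 hay) hT
  · have hb : b⁻¹ y = y := by
      rw [← Perm.support_inv, Perm.notMem_support] at hT; exact hT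
    rw [hb]
    have hz : a⁻¹ y ∉ b.support := by
      intro h
      by_cases hS : a⁻¹ y ∈ a.support
      · exact h2 hS h
      · rw [Perm.notMem_support, apply_inv_apply] at hS
        exact hT (hS ▸ h)
    rw [Perm.notMem_support.1 hz, apply_inv_apply]

/-- Commutators with a conjugate under a suitable word shrink the support. -/
lemma exists_smaller {K : ℕ} {F : Bool → Perm α} (hF : Mixing K F) (hn : 200 ≤ Fintype.card α)
    {a : Perm α} (ha : a ≠ 1) (hcard : a.support.card < Fintype.card α) {D : ℕ}
    (hD : Reach F D a) :
    ∃ c : Perm α, c ≠ 1 ∧ Perm.sign c = 1 ∧ Reach F (4 * D + 4 * K) c ∧ ∃ m : ℕ,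
      50 * m * Fintype.card α ≤ 51 * a.support.card ^ 2 ∧ c.support.card ≤ 3 * (1 + m) := by
  obtain ⟨x₀, hx₀⟩ : ∃ x, a x ≠ x := by
    by_contra! h
    exact ha (Perm.ext h)
  have h₀ : x₀ ∈ a.support := Perm.mem_support.2 hx₀
  have h₁ : a x₀ ∈ a.support := Perm.apply_mem_support.2 h₀
  obtain ⟨W, hW₀, hW₁, hm⟩ := exists_word_split hF hn hcard h₀ h₁ (Ne.symm hx₀)
  set u := word F W with hu
  set b := u⁻¹ * a * u with hb
  have hbs : ∀ z, z ∈ b.support ↔ u z ∈ a.support := by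
    intro z
    rw [Perm.mem_support, Perm.mem_support, hb, Perm.mul_apply, Perm.mul_apply, ne_eq, ne_eq,
      Perm.inv_eq_iff_eq]
  have hru : Reach F K u := reach_word F W
  have hrb : Reach F (K + D + K) b := (hru.inv.mul hD).mul hru
  refine ⟨a * b * a⁻¹ * b⁻¹, ?_, ?_, ?_, _, hm, ?_⟩
  · intro h
    have hcomm : a * b = b * a := by
      rwa [mul_inv_eq_one, mul_inv_eq_iff_eq_mul] at h
    have h2 := congrArg (fun σ : Perm α => σ x₀) hcomm
    simp only [Perm.mul_apply] at h2
    have hbx : b x₀ = x₀ := by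
      by_contra hc
      exact hW₀ ((hbs _).1 (Perm.mem_support.2 hc))
    rw [hbx] at h2
    exact Perm.mem_support.1 ((hbs _).2 hW₁) h2.symm
  · simp only [map_mul, map_inv]
    rw [mul_comm (Perm.sign a), mul_inv_cancel_right, mul_inv_cancel]
  · exact (((hD.mul hrb).mul hD.inv).mul hrb.inv).mono (by omega)
  · set T := ((a.support.erase x₀).erase (a x₀)).filter fun z => u z ∈ a.support with hT
    have hI : a.support ∩ b.support ⊆ insert (a x₀) T := by
      intro z hz
      rw [mem_inter, hbs] at hz
      rw [mem_insert, hT, mem_filter, mem_erase, mem_erase]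
      by_cases hz1 : z = a x₀
      · exact Or.inl hz1
      · exact Or.inr ⟨⟨hz1, fun h => hW₀ (h ▸ hz.2), hz.1⟩, hz.2⟩
    have hIc := (card_le_card hI).trans (card_insert_le _ _)
    refine (card_le_card (support_commutator_subset a b)).trans ?_
    refine (card_union_le _ _).trans ?_
    have h1 := card_union_le ((a.support ∩ b.support).image a) ((a.support ∩ b.support).image b)
    have h2 : ((a.support ∩ b.support).image a).card ≤ _ := card_image_le
    have h3 : ((a.support ∩ b.support).image b).card ≤ _ := card_image_le
    omega

lemma isThreeCycle_of_card_support_le {c : Perm α} (h1 : c ≠ 1) (hs : Perm.sign c = 1)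
    (h : c.support.card ≤ 3) : c.IsThreeCycle := by
  rw [← card_support_eq_three_iff]
  have h2 := Perm.two_le_card_support_of_ne_one h1
  have h3 : c.support.card ≠ 2 := by
    intro hc
    rw [(Perm.card_support_eq_two.1 hc).sign_eq] at hs
    exact absurd hs (by decide)
  omega

lemma exists_isThreeCycle {K : ℕ} {F : Bool → Perm α} (hF : Mixing K F)
    (hn : 200 ≤ Fintype.card α) (j : ℕ) : ∀ (a : Perm α) (D : ℕ), a ≠ 1 →
      4 * a.support.card ≤ Fintype.card α → Reach F D a →
      (3.9 * (a.support.card : ℝ) / Fintype.card α) ^ (2 ^ (j + 1)) * Fintype.card α ≤ 49 →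
      ∃ c : Perm α, c.IsThreeCycle ∧ Reach F (4 ^ (j + 2) * (D + 2 * K)) c := by
  have hn0 : (0 : ℝ) < Fintype.card α := by exact_mod_cast (by omega)
  have small : ∀ (j : ℕ) (a : Perm α) (D : ℕ), a ≠ 1 → 4 * a.support.card ≤ Fintype.card α →
      Reach F D a → 10 * a.support.card ^ 2 ≤ 36 * Fintype.card α →
      ∃ c : Perm α, c.IsThreeCycle ∧ Reach F (4 ^ (j + 2) * (D + 2 * K)) c := by
    intro j a D ha hk hD hs
    obtain ⟨b, hb1, -, hbD, m, hm, hbm⟩ := exists_smaller hF hn ha (by omega) hD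
    have hm3 : m ≤ 3 := by
      by_contra hc
      have : 50 * 4 * Fintype.card α ≤ 50 * m * Fintype.card α := by gcongr; omega
      omega
    have hb12 : b.support.card ≤ 12 := by omega
    obtain ⟨c, hc1, hcs, hcD, m', hm', hcm⟩ := exists_smaller hF hn hb1 (by omega) hbD
    have hm0 : m' = 0 := by
      by_contra hc
      have h1 : 50 * 1 * Fintype.card α ≤ 50 * m' * Fintype.card α := by gcongr; omega
      have h2 : b.support.card ^ 2 ≤ 12 ^ 2 := Nat.pow_le_pow_left hb12 2
      omega
    refine ⟨c, isThreeCycle_of_card_support_le hc1 hcs (by omega), hcD.mono ?_⟩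
    have : 4 ^ 2 * (D + 2 * K) ≤ 4 ^ (j + 2) * (D + 2 * K) := by
      gcongr <;> omega
    omega
  induction j with
  | zero =>
    intro a D ha hk hD h
    refine small 0 a D ha hk hD ?_
    norm_num at h
    rw [div_pow, div_mul_eq_mul_div, div_le_iff₀ (by positivity)] at h
    have h' : (10 * (a.support.card : ℝ) ^ 2) ≤ 36 * Fintype.card α := by
      have : (39 / 10 * (a.support.card : ℝ)) ^ 2 ≤ 49 * Fintype.card α := by
        refine le_of_mul_le_mul_right (h.trans_eq ?_) hn0
        ring
      nlinarith
    exact_mod_cast h'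
  | succ j ih =>
    intro a D ha hk hD h
    by_cases hs : 10 * a.support.card ^ 2 ≤ 36 * Fintype.card α
    · exact small (j + 1) a D ha hk hD hs
    obtain ⟨b, hb1, -, hbD, m, hm, hbm⟩ := exists_smaller hF hn ha (by omega) hD
    have hsize : 10 * b.support.card * Fintype.card α ≤ 39 * a.support.card ^ 2 := by
      have : b.support.card * Fintype.card α ≤ 3 * (1 + m) * Fintype.card α := by gcongr
      nlinarith
    have hsq : (3.9 * (b.support.card : ℝ) / Fintype.card α) ≤
        (3.9 * (a.support.card : ℝ) / Fintype.card α) ^ 2 := by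
      have h' : (10 * b.support.card * Fintype.card α : ℝ) ≤ 39 * a.support.card ^ 2 := by
        exact_mod_cast hsize
      rw [div_pow, div_le_div_iff₀ hn0 (by positivity)]
      nlinarith
    have hb4 : 4 * b.support.card ≤ Fintype.card α := by
      have h1 : 16 * a.support.card ^ 2 ≤ Fintype.card α * Fintype.card α := by
        calc 16 * a.support.card ^ 2 = (4 * a.support.card) * (4 * a.support.card) := by ring
          _ ≤ _ := Nat.mul_le_mul hk hk
      refine le_of_mul_le_mul_right ?_ (by omega : 0 < Fintype.card α)
      nlinarith
    obtain ⟨c, hc, hcD⟩ := ih b _ hb1 hb4 hbD <| by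
      refine le_trans ?_ h
      rw [pow_succ 2 (j + 1), mul_comm (2 ^ (j + 1)) 2, pow_mul]
      gcongr
    refine ⟨c, hc, hcD.mono ?_⟩
    calc 4 ^ (j + 2) * (4 * D + 4 * K + 2 * K) ≤ 4 ^ (j + 2) * (4 * (D + 2 * K)) := by
          gcongr; omega
      _ = 4 ^ (j + 1 + 2) * (D + 2 * K) := by ring

lemma Reach.conj_word {K D : ℕ} {F : Bool → Perm α} {c : Perm α} (h : Reach F D c)
    (W : Fin K → Bool) : Reach F (D + 2 * K) (word F W * c * (word F W)⁻¹) :=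
  (((reach_word F W).mul h).mul (reach_word F W).inv).mono (by omega)

/-- If one three-cycle is short, all of them are. -/
lemma Reach.of_isThreeCycle {K D : ℕ} {F : Bool → Perm α} (hF : Mixing K F)
    (hn : 3 ≤ Fintype.card α) {c : Perm α} (hc : c.IsThreeCycle) (h : Reach F D c)
    (y : Fin 3 ↪ α) : Reach F (D + 2 * K) (swap (y 0) (y 1) * swap (y 1) (y 2)) := by
  obtain ⟨x, rfl⟩ : ∃ x : Fin 3 ↪ α, c = swap (x 0) (x 1) * swap (x 1) (x 2) := by
    obtain ⟨a, ha⟩ : c.support.Nonempty := by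
      rw [← card_pos, hc.card_support]; norm_num
    have hnd := hc.nodup_iff_mem_support.2 ha
    simp only [List.nodup_cons, List.mem_cons, List.not_mem_nil, or_false, not_or] at hnd
    exact ⟨triple a (c a) (c (c a)) hnd.1.1 hnd.1.2 hnd.2.1,
      hc.eq_swap_mul_swap_iff_mem_support.2 ha⟩
  have hn3 : (3 : ℝ) ≤ Fintype.card α := by exact_mod_cast hn
  have hpos : 0 < (2 : ℝ) ^ K * ((({y} : Finset (Fin 3 ↪ α)).card : ℝ) *
      (1 / (Fintype.card (Fin 3 ↪ α) : ℝ) - 1 / (Fintype.card α : ℝ) ^ 5)) := by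
    have hN : (0 : ℝ) < Fintype.card (Fin 3 ↪ α) := by
      exact_mod_cast card_emb_pos (s := 2) (by omega)
    rw [card_singleton, Nat.cast_one, one_mul]
    refine mul_pos (by positivity) (sub_pos.2 (one_div_lt_one_div_of_lt hN ?_))
    calc (Fintype.card (Fin 3 ↪ α) : ℝ) ≤ (Fintype.card α : ℝ) ^ 3 := by
          rw [Fintype.card_embedding_eq, Fintype.card_fin]
          exact_mod_cast Nat.descFactorial_le_pow _ _
      _ < _ := pow_lt_pow_right₀ (by linarith) (by norm_num)
  obtain ⟨W, -, hW⟩ := exists_ne_zero_of_sum_ne_zero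
    (hpos.trans_le (hF.le_sum_word_mem x {y})).ne'
  have hWy := mem_singleton.1 (ne_zero_of_ind hW)
  have hi : ∀ i, y i = word F W (x i) := fun i => by
    rw [← hWy]; rfl
  have := h.conj_word W
  convert this using 1
  rw [hi, hi, hi, swap_apply_apply, swap_apply_apply]
  group

lemma Reach.of_sign_eq_one {D : ℕ} {F : Bool → Perm α}
    (h : ∀ y : Fin 3 ↪ α, Reach F D (swap (y 0) (y 1) * swap (y 1) (y 2))) (k : ℕ) :
    ∀ x : Perm α, Perm.sign x = 1 → x.support.card ≤ k → Reach F (k * D) x := by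
  induction k with
  | zero =>
    intro x _ hx
    rw [Nat.le_zero, Perm.card_support_eq_zero] at hx
    rw [hx, zero_mul]
    exact reach_one F
  | succ k ih =>
    intro x hsign hx
    by_cases h1 : x = 1
    · rw [h1]
      exact (reach_one F).mono (Nat.zero_le _)
    obtain ⟨p, hp⟩ : ∃ p, x p ≠ p := by
      by_contra! hc
      exact h1 (Perm.ext hc)
    have hpS : p ∈ x.support := Perm.mem_support.2 hp
    have hqS : x p ∈ x.support := Perm.apply_mem_support.2 hpS
    have h3 : 3 ≤ x.support.card := by
      by_contra hc
      have h4 := isThreeCycle_of_card_support_le h1 hsign (by omega)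
      have := h4.card_support
      omega
    obtain ⟨r, hr, hrp⟩ : ∃ r ∈ x.support, r ∉ ({p, x p} : Finset α) := by
      by_contra! hc
      have : x.support.card ≤ 2 := (card_le_card fun z hz => hc z hz).trans card_le_two
      omega
    simp only [mem_insert, mem_singleton, not_or] at hrp
    set t := swap (x p) p * swap p r with ht
    have htr : Reach F D t := h (triple (x p) p r hp (Ne.symm hrp.2) (Ne.symm hrp.1))
    have hts : Perm.sign (t * x) = 1 := by
      rw [ht, map_mul, map_mul, Perm.sign_swap hp, Perm.sign_swap (Ne.symm hrp.1), hsign]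
      decide
    have hsub : (t * x).support ⊆ x.support.erase p := by
      intro z hz
      rw [Perm.mem_support, Perm.mul_apply] at hz
      rw [mem_erase]
      refine ⟨?_, ?_⟩
      · rintro rfl
        apply hz
        rw [ht, Perm.mul_apply, swap_apply_of_ne_of_ne hp (Ne.symm hrp.2), swap_apply_left]
      · by_contra hzS
        rw [Perm.notMem_support.1 hzS] at hz
        apply hz
        have hne : ∀ w ∈ x.support, z ≠ w := fun w hw hzw => hzS (hzw ▸ hw)
        rw [ht, Perm.mul_apply, swap_apply_of_ne_of_ne (hne _ hpS) (hne _ hr),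
          swap_apply_of_ne_of_ne (hne _ hqS) (hne _ hpS)]
    have hcard := card_le_card hsub
    rw [card_erase_of_mem hpS] at hcard
    have := htr.inv.mul (ih (t * x) hts (by omega))
    rw [inv_mul_cancel_left] at this
    exact this.mono (by rw [add_mul]; omega)

lemma Reach.of_mem_closure {D : ℕ} {F : Bool → Perm α}
    (h : ∀ y : Fin 3 ↪ α, Reach F D (swap (y 0) (y 1) * swap (y 1) (y 2))) {x : Perm α}
    (hx : x ∈ Subgroup.closure {F true, F false}) :
    Reach F (Fintype.card α * D + 1) x := by
  have even : ∀ z : Perm α, Perm.sign z = 1 → Reach F (Fintype.card α * D) z := fun z hz =>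
    Reach.of_sign_eq_one h _ z hz (card_le_univ _)
  by_cases hs : Perm.sign x = 1
  · exact (even x hs).mono (by omega)
  obtain ⟨b, hb⟩ : ∃ b, Perm.sign (F b) ≠ 1 := by
    by_contra! hc
    refine hs ?_
    have : Subgroup.closure {F true, F false} ≤ (Perm.sign : Perm α →* ℤˣ).ker := by
      rw [Subgroup.closure_le]
      rintro _ (rfl | rfl) <;> exact hc _
    exact this hx
  have hx' := (Int.units_eq_one_or (Perm.sign x)).resolve_left hs
  have hb' := (Int.units_eq_one_or (Perm.sign (F b))).resolve_left hb
  have := (even (x * (F b)⁻¹) (by rw [map_mul, map_inv, hx', hb']; decide)).mul (reach_apply F b)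
  rwa [inv_mul_cancel_right] at this

lemma Reach.of_hasSmallPower {K k j : ℕ} {F : Bool → Perm α} (hF : Mixing K F)
    (hn : 200 ≤ Fintype.card α) (hP : HasSmallPower k (F true) (F false))
    (hj : (0.975 : ℝ) ^ (2 ^ (j + 1)) * Fintype.card α ≤ 49) {x : Perm α}
    (hx : x ∈ Subgroup.closure {F true, F false}) :
    Reach F (Fintype.card α *
      (4 ^ (j + 2) * (Fintype.card α * k + 2 * K) + 2 * K) + 1) x := by
  obtain ⟨i, hi, c, hc, hne, hsupp⟩ := hP
  have hn0 : (0 : ℝ) < Fintype.card α := by exact_mod_cast (by omega)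
  have hR : Reach F (Fintype.card α * k) ((F false ^ i * F true) ^ c) :=
    ((((reach_apply F false).pow i).mul (reach_apply F true)).pow c).mono
      (Nat.mul_le_mul hc (by omega))
  obtain ⟨t, ht, htR⟩ := exists_isThreeCycle hF hn j _ _ hne hsupp hR <| by
    refine le_trans ?_ hj
    gcongr
    rw [div_le_iff₀ hn0]
    have : (4 * ((F false ^ i * F true) ^ c).support.card : ℝ) ≤ Fintype.card α := by
      exact_mod_cast hsupp
    linarith
  exact Reach.of_mem_closure (Reach.of_isThreeCycle hF (by omega) ht htR) hx

lemma log_le_lam {n : ℕ} (hn : 0 < n) : Real.log n ≤ (Nat.log 2 n + 1 : ℕ) := by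
  have h1 : (n : ℝ) ≤ 2 ^ (Nat.log 2 n + 1) := by
    exact_mod_cast (Nat.lt_pow_succ_log_self (by norm_num) n).le
  have h2 := Real.log_le_log (by exact_mod_cast hn) h1
  rw [Real.log_pow] at h2
  have h3 : Real.log 2 ≤ 1 := by linarith [Real.log_two_lt_d9]
  have h4 : (0 : ℝ) ≤ (Nat.log 2 n + 1 : ℕ) := Nat.cast_nonneg _
  nlinarith

lemma lam_le_log {n : ℕ} (hn : 3 ≤ n) : ((Nat.log 2 n + 1 : ℕ) : ℝ) ≤ 3 * Real.log n := by
  have hn3 : (3 : ℝ) ≤ n := by exact_mod_cast hn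
  have h1 : (2 : ℝ) ^ (Nat.log 2 n) ≤ n := by
    exact_mod_cast Nat.pow_log_le_self 2 (by omega : n ≠ 0)
  have h2 := Real.log_le_log (by positivity) h1
  rw [Real.log_pow] at h2
  have h3 := Real.log_two_gt_d9
  have h4 : 1 ≤ Real.log n := by
    rw [Real.le_log_iff_exp_le (by linarith)]
    linarith [Real.exp_one_lt_d9]
  have h5 : (0 : ℝ) ≤ Nat.log 2 n := Nat.cast_nonneg _
  push_cast
  nlinarith

lemma exists_lam_pow_le {δ : ℝ} (hδ : 0 < δ) :
    ∃ N : ℕ, ∀ n : ℕ, N ≤ n → ((Nat.log 2 n + 1 : ℕ) : ℝ) ^ 8 / Real.sqrt n ≤ δ := by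
  have h := (isLittleO_log_rpow_rpow_atTop (8 : ℝ) (by norm_num : (0 : ℝ) < 1 / 2)).bound
    (show 0 < δ / 3 ^ 8 by positivity)
  obtain ⟨N, hN⟩ := Filter.eventually_atTop.1 (tendsto_natCast_atTop_atTop.eventually h)
  refine ⟨max N 3, fun n hn => ?_⟩
  have hn3 : 3 ≤ n := le_trans (le_max_right _ _) hn
  have hn0 : (0 : ℝ) < n := by exact_mod_cast (by omega)
  have h1 := hN n (le_trans (le_max_left _ _) hn)
  rw [Real.norm_eq_abs, Real.norm_eq_abs, ← Real.sqrt_eq_rpow, abs_of_nonneg (Real.sqrt_nonneg _)]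
    at h1
  have h2 := (le_abs_self _).trans h1
  rw [show (8 : ℝ) = (8 : ℕ) by norm_num, Real.rpow_natCast] at h2
  rw [div_le_iff₀ (Real.sqrt_pos.2 hn0)]
  calc ((Nat.log 2 n + 1 : ℕ) : ℝ) ^ 8 ≤ (3 * Real.log n) ^ 8 := by
        gcongr; exact lam_le_log hn3
    _ = 3 ^ 8 * Real.log n ^ 8 := by ring
    _ ≤ 3 ^ 8 * (δ / 3 ^ 8 * Real.sqrt n) := by gcongr
    _ = _ := by ring

lemma error_le {n R l k r P : ℝ} (hR : R * R = n) (hR1 : 1 ≤ R) (hl : 1 ≤ l) (hk0 : 0 < k)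
    (hkl : k ≤ l) (hr : R ≤ 2 * r) (hrR : r ≤ R) (hl48 : 48 * l ≤ n) (hlog : Real.log n ≤ l)
    (hn : 16 ≤ n) (hP : n ^ 4 ≤ P) :
    (10 ^ 4 * (1 / k + corrError 9 k n k) + k * ((4 / 3) * (1 + Real.log n) / r + r / (n - r))) +
      R * (n ^ 3 / P + (n ^ 3 * (3 * ((24 * l) * (2 * (24 * l) / (n - 24 * l))) ^ 4 +
        1 / (n - 24 * l) ^ 3) - 1)) ≤ 110000 / k + 10 ^ 16 * (l ^ 8 / R) := by
  have hR0 : 0 < R := by linarith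
  have hn0 : 0 < n := by linarith
  have hl0 : 0 < l := by linarith
  have hr0 : 0 < r := by linarith
  have hR4 : 4 ≤ R := by nlinarith
  set s := l ^ 8 / R with hs
  have pow_le : ∀ m ≤ 8, l ^ m / R ≤ s := fun m hm => by
    rw [hs]; gcongr
  have hnR : 1 / n ≤ 1 / R := by
    apply one_div_le_one_div_of_le hR0; nlinarith
  have t1 : k * (4 * k) / (n - k) ≤ 8 * s := by
    calc k * (4 * k) / (n - k) ≤ l * (4 * l) / (n / 2) := by
          gcongr; linarith
      _ = 8 * l ^ 2 * (1 / n) := by field_simp; ring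
      _ ≤ 8 * l ^ 2 * (1 / R) := by gcongr
      _ = 8 * (l ^ 2 / R) := by ring
      _ ≤ _ := by gcongr; exact pow_le 2 (by norm_num)
  have t2 : k / (n - 1) ≤ 2 * s := by
    calc k / (n - 1) ≤ l / (n / 2) := by gcongr; linarith
      _ = 2 * l ^ 1 * (1 / n) := by field_simp
      _ ≤ 2 * l ^ 1 * (1 / R) := by gcongr
      _ = 2 * (l ^ 1 / R) := by ring
      _ ≤ _ := by gcongr; exact pow_le 1 (by norm_num)
  have hlog0 : 0 ≤ Real.log n := Real.log_nonneg (by linarith)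
  have t3 : k * ((4 / 3) * (1 + Real.log n) / r) ≤ 6 * s := by
    calc k * ((4 / 3) * (1 + Real.log n) / r) ≤ l * ((4 / 3) * (l + l) / (R / 2)) := by
          gcongr; linarith
      _ = 16 / 3 * (l ^ 2 / R) := by field_simp; ring
      _ ≤ 6 * s := by
        have := pow_le 2 (by norm_num)
        have : 0 ≤ l ^ 2 / R := by positivity
        linarith
  have t4 : k * (r / (n - r)) ≤ 2 * s := by
    calc k * (r / (n - r)) ≤ l * (R / (n / 2)) := by
          have : n / 2 ≤ n - r := by nlinarith
          have : 0 ≤ r / (n - r) := div_nonneg hr0.le (by linarith)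
          gcongr
      _ = 2 * (l ^ 1 / R) := by rw [← hR]; field_simp
      _ ≤ _ := by gcongr; exact pow_le 1 (by norm_num)
  have hs0 : 0 ≤ s := by positivity
  have t5 : R * (n ^ 3 / P) ≤ s := by
    calc R * (n ^ 3 / P) ≤ R * (n ^ 3 / n ^ 4) := by gcongr
      _ = l ^ 0 / R := by rw [← hR]; field_simp
      _ ≤ s := pow_le 0 (by norm_num)
  have hnl : n / 2 ≤ n - 24 * l := by linarith
  have t6 : R * (n ^ 3 * (3 * ((24 * l) * (2 * (24 * l) / (n - 24 * l))) ^ 4)) ≤ 10 ^ 14 * s := by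
    calc R * (n ^ 3 * (3 * ((24 * l) * (2 * (24 * l) / (n - 24 * l))) ^ 4)) ≤
        R * (n ^ 3 * (3 * ((24 * l) * (2 * (24 * l) / (n / 2))) ^ 4)) := by
          have : 0 ≤ 24 * l * (2 * (24 * l) / (n - 24 * l)) :=
            mul_nonneg (by positivity) (div_nonneg (by positivity) (by linarith))
          gcongr
      _ = 768 * 24 ^ 8 * s := by rw [hs, ← hR]; field_simp; ring
      _ ≤ _ := by gcongr; norm_num
  have t7 : R * (n ^ 3 * (1 / (n - 24 * l) ^ 3) - 1) ≤ 400 * s := by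
    set t := 24 * l / n with ht
    have ht0 : 0 ≤ t := by positivity
    have ht1 : t ≤ 1 / 2 := by rw [ht, div_le_iff₀ hn0]; linarith
    have h1 : n / (n - 24 * l) ≤ 1 + 2 * t := by
      have he : n - 24 * l = n * (1 - t) := by rw [ht]; field_simp
      rw [he, div_le_iff₀ (mul_pos hn0 (by linarith))]
      have : 0 ≤ t * (1 - 2 * t) := mul_nonneg ht0 (by linarith)
      nlinarith
    have h2 : n ^ 3 * (1 / (n - 24 * l) ^ 3) ≤ (1 + 2 * t) ^ 3 := by
      rw [mul_one_div, ← div_pow]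
      have : 0 ≤ n / (n - 24 * l) := div_nonneg hn0.le (by linarith)
      gcongr
    have h3 : (1 + 2 * t) ^ 3 - 1 ≤ 14 * t := by
      have : 0 ≤ t * (1 - 2 * t) := mul_nonneg ht0 (by linarith)
      nlinarith
    calc R * (n ^ 3 * (1 / (n - 24 * l) ^ 3) - 1) ≤ R * (14 * t) := by gcongr; linarith
      _ = 336 * (l ^ 1 / R) := by rw [ht, ← hR]; field_simp; ring
      _ ≤ 336 * s := by gcongr; exact pow_le 1 (by norm_num)
      _ ≤ _ := by linarith
  have e1 : corrError 9 k n k = 10 * (1 / k) + 10 * (k * (4 * k) / (n - k)) +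
      100 * (k / (n - 1)) := by
    rw [corrError]; ring
  have e2 : (110000 : ℝ) / k = 110000 * (1 / k) := by ring
  rw [e1, e2]
  have e3 : R * (n ^ 3 / P + (n ^ 3 * (3 * ((24 * l) * (2 * (24 * l) / (n - 24 * l))) ^ 4 +
        1 / (n - 24 * l) ^ 3) - 1)) = R * (n ^ 3 / P) +
      R * (n ^ 3 * (3 * ((24 * l) * (2 * (24 * l) / (n - 24 * l))) ^ 4)) +
      R * (n ^ 3 * (1 / (n - 24 * l) ^ 3) - 1) := by ring
  rw [e3]
  linarith

lemma length_le {n : ℕ} (hn : 200 ≤ n) : ∃ j : ℕ,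
    (0.975 : ℝ) ^ (2 ^ (j + 1)) * n ≤ 49 ∧
      n * (4 ^ (j + 2) * (n * Nat.log 2 n + 2 * (4 * (Nat.log 2 n + 1) * 20)) +
        2 * (4 * (Nat.log 2 n + 1) * 20)) + 1 ≤ 60000 * n ^ 2 * (Nat.log 2 n + 1) ^ 3 := by
  set k := Nat.log 2 n with hk
  set l := k + 1 with hl
  have hlpos : 1 ≤ l := by omega
  have h1 : 0 < Nat.clog 2 (40 * l) := Nat.clog_pos (by norm_num) (by omega)
  obtain ⟨j, hj⟩ := Nat.exists_eq_succ_of_ne_zero h1.ne'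
  have hlow : 40 * l ≤ 2 ^ (j + 1) := by
    have := Nat.le_pow_clog (by norm_num : 1 < 2) (40 * l)
    rwa [hj] at this
  have hup : 2 ^ j < 40 * l := by
    have := Nat.pow_pred_clog_lt_self (by norm_num : 1 < 2) (by omega : 1 < 40 * l)
    rwa [hj] at this
  refine ⟨j, ?_, ?_⟩
  · have h2 : (0.975 : ℝ) ^ (2 ^ (j + 1)) ≤ (1 / 2) ^ l := by
      calc (0.975 : ℝ) ^ (2 ^ (j + 1)) ≤ 0.975 ^ (40 * l) :=
            pow_le_pow_of_le_one (by norm_num) (by norm_num) hlow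
        _ = (0.975 ^ 40) ^ l := pow_mul _ _ _
        _ ≤ _ := by gcongr; norm_num
    have h3 : (n : ℝ) ≤ 2 ^ l := by
      exact_mod_cast (Nat.lt_pow_succ_log_self (by norm_num) n).le
    calc _ ≤ (1 / 2 : ℝ) ^ l * 2 ^ l := by gcongr
      _ = 1 := by rw [← mul_pow]; norm_num
      _ ≤ _ := by norm_num
  · have h4 : 4 ^ (j + 2) ≤ 25600 * l ^ 2 := by
      calc 4 ^ (j + 2) = 16 * (2 ^ j) ^ 2 := by
            rw [← pow_mul, mul_comm j 2, pow_mul, pow_add]; norm_num; ring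
        _ ≤ 16 * (40 * l) ^ 2 := by gcongr
        _ = _ := by ring
    have hll : l ≤ l ^ 3 := Nat.le_self_pow (by norm_num) l
    calc n * (4 ^ (j + 2) * (n * k + 2 * (4 * l * 20)) + 2 * (4 * l * 20)) + 1
        ≤ n * (25600 * l ^ 2 * (n * l + n * l) + n * l) + n * (n * l) := by
          have e1 : 2 * (4 * l * 20) ≤ n * l := by nlinarith
          have e2 : 1 ≤ n * (n * l) := Nat.one_le_iff_ne_zero.2 (by positivity)
          gcongr
          omega
      _ = 51200 * n ^ 2 * l ^ 3 + 2 * n ^ 2 * l := by ring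
      _ ≤ 51200 * n ^ 2 * l ^ 3 + 2 * n ^ 2 * l ^ 3 := by gcongr
      _ ≤ _ := by nlinarith [Nat.zero_le (n ^ 2 * l ^ 3)]

/-- Every element of the generated group is a short product of generators. -/
def SmallDiameter {n : ℕ} (p : Perm (Fin n) × Perm (Fin n)) : Prop :=
  ∀ x ∈ Subgroup.closure ({p.1, p.2} : Set (Perm (Fin n))),
    ∃ l : List (Perm (Fin n)), (∀ s ∈ l, s = p.1 ∨ s = p.2 ∨ s = p.1⁻¹ ∨ s = p.2⁻¹) ∧
      l.prod = x ∧ (l.length : ℝ) ≤ 2 * 10 ^ 6 * (n : ℝ) ^ 2 * Real.log n ^ (3 : ℝ)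

lemma smallDiameter_of {n : ℕ} (hn : 200 ≤ n) {p : Perm (Fin n) × Perm (Fin n)}
    {F : Bool → Perm (Fin n)} (hF₂ : F true = p.2) (hF₁ : F false = p.1)
    (hP : HasSmallPower (Nat.log 2 n) p.2 p.1)
    (hF : Mixing (4 * (Nat.log 2 n + 1) * 20) F) : SmallDiameter p := by
  intro x hx
  obtain ⟨j, hj, hlen⟩ := length_le hn
  rw [← hF₂, ← hF₁] at hP
  rw [Set.pair_comm, ← hF₂, ← hF₁] at hx
  have hR := Reach.of_hasSmallPower (j := j) hF (by simpa using hn) hP (by simpa using hj) hx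
  rw [Fintype.card_fin] at hR
  obtain ⟨l, h1, h2, h3⟩ := hR.mono hlen
  rw [hF₂, hF₁] at h1
  refine ⟨l, fun s hs => ?_, h2, ?_⟩
  · have := h1 s hs
    tauto
  · have h4 := lam_le_log (n := n) (by omega)
    have hlog : 0 ≤ Real.log n := Real.log_natCast_nonneg n
    rw [show (3 : ℝ) = (3 : ℕ) by norm_num, Real.rpow_natCast]
    calc (l.length : ℝ) ≤ 60000 * (n : ℝ) ^ 2 * ((Nat.log 2 n + 1 : ℕ) : ℝ) ^ 3 := by
          exact_mod_cast h3
      _ ≤ 60000 * (n : ℝ) ^ 2 * (3 * Real.log n) ^ 3 := by gcongr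
      _ = 1620000 * ((n : ℝ) ^ 2 * Real.log n ^ 3) := by ring
      _ ≤ 2 * 10 ^ 6 * ((n : ℝ) ^ 2 * Real.log n ^ 3) := by gcongr; norm_num
      _ = _ := by ring

lemma le_ncard_smallDiameter {n : ℕ} (hn : 1000 ≤ n) {δ : ℝ} (hδ : δ ≤ 1 / 10 ^ 4)
    (h : ((Nat.log 2 n + 1 : ℕ) : ℝ) ^ 8 / Real.sqrt n ≤ δ) :
    (1 - (110000 / (Nat.log 2 n : ℝ) + 10 ^ 16 * δ)) * (n.factorial : ℝ) ^ 2 ≤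
      (Set.ncard {p : Perm (Fin n) × Perm (Fin n) | SmallDiameter p} : ℝ) := by
  set k := Nat.log 2 n with hk
  have hn1000 : (1000 : ℝ) ≤ n := by exact_mod_cast hn
  set l : ℝ := ((k + 1 : ℕ) : ℝ) with hl
  set R := Real.sqrt n with hR
  have hRR : R * R = n := Real.mul_self_sqrt (by linarith)
  have hR0 : 0 < R := Real.sqrt_pos.2 (by linarith)
  have hk1 : 1 ≤ k := Nat.log_pos (by norm_num) (by omega)
  have hk0 : (0 : ℝ) < k := by exact_mod_cast hk1
  have hl1 : 1 ≤ l := by rw [hl]; push_cast; linarith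
  have hl8 : 10 ^ 4 * l ^ 8 ≤ R := by
    have := (div_le_iff₀ hR0).1 (h.trans hδ)
    linarith
  have hl2 : l ^ 2 ≤ l ^ 8 := pow_le_pow_right₀ hl1 (by norm_num)
  have hR1 : 1 ≤ R := by nlinarith
  have hRn : R ≤ n := by nlinarith
  have hll : l ≤ l ^ 2 := le_self_pow₀ hl1 (by norm_num)
  have hl48 : 48 * l ≤ n := by linarith
  set r := Nat.sqrt n with hr
  have hrR : (r : ℝ) ≤ R := Real.nat_sqrt_le_real_sqrt
  have hRr : R ≤ 2 * r := by
    have h1 : R ≤ r + 1 := Real.real_sqrt_le_nat_sqrt_succ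
    have h2 : (1 : ℝ) ≤ r := by exact_mod_cast Nat.sqrt_pos.2 (by omega)
    linarith
  have hkn : k < n := Nat.log_lt_self 2 (by omega)
  have hrn : r < n := Nat.sqrt_lt_self (by omega)
  have hKn : 24 * (k + 1) < n := by
    have : (24 : ℝ) * (k + 1 : ℕ) < n := by rw [← hl]; linarith
    exact_mod_cast this
  have hP : (n : ℝ) ^ 4 ≤ 2 ^ (4 * (k + 1)) := by
    rw [mul_comm, pow_mul]
    gcongr
    exact_mod_cast (Nat.lt_pow_succ_log_self (by norm_num) n).le
  have herr := error_le hRR hR1 hl1 hk0 (by rw [hl]; push_cast; linarith) hRr hrR hl48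
    (log_le_lam (by omega)) (by linarith) hP
  have hsmall := sum_not_hasSmallPower_le (α := Fin n) k k r hk1 hk1 (by simpa using hkn)
    (by simpa using hn) (Nat.sqrt_pos.2 (by omega)) (by simpa using hrn)
  have hmix := sum_not_mixing_le (α := Fin n) (L := 4 * (k + 1)) (K := 24 * (k + 1))
    (by simp; omega) (by omega) (by simpa using hKn) (by
      have : (((24 * (k + 1) : ℕ)) : ℝ) = 24 * l := by rw [hl]; push_cast; ring
      rw [this, Fintype.card_fin, ← mul_div_assoc, div_le_one (by linarith)]
      nlinarith)
  simp only [Fintype.card_fin] at hsmall hmix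
  have hcard : (Fintype.card (Bool → Perm (Fin n)) : ℝ) = (n.factorial : ℝ) ^ 2 := by
    simp [Fintype.card_perm]
  rw [hcard, show (((24 * (k + 1) : ℕ)) : ℝ) = 24 * l by rw [hl]; push_cast; ring] at hmix
  classical
  have hcount : (Set.ncard {p : Perm (Fin n) × Perm (Fin n) | SmallDiameter p} : ℝ) =
      ∑ p : Perm (Fin n) × Perm (Fin n), ind (SmallDiameter p) := by
    rw [sum_ind, Set.ncard_eq_toFinset_card']
    congr 2
    ext p
    simp
  have hpt : ∀ p : Perm (Fin n) × Perm (Fin n), 1 - ind (¬ HasSmallPower k p.2 p.1) -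
      ind (¬ Mixing (4 * (k + 1) * 20) ((boolArrowEquivProd _).symm p)) ≤
        ind (SmallDiameter p) := by
    intro p
    by_cases h1 : HasSmallPower k p.2 p.1
    · by_cases h2 : Mixing (4 * (k + 1) * 20) ((boolArrowEquivProd _).symm p)
      · rw [ind_pos (smallDiameter_of (by omega) rfl rfl h1 h2)]
        linarith [ind_nonneg (¬ HasSmallPower k p.2 p.1),
          ind_nonneg (¬ Mixing (4 * (k + 1) * 20) ((boolArrowEquivProd _).symm p))]
      · rw [ind_pos h2]
        linarith [ind_nonneg (¬ HasSmallPower k p.2 p.1), ind_nonneg (SmallDiameter p)]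
    · rw [ind_pos h1]
      linarith [ind_nonneg (¬ Mixing (4 * (k + 1) * 20) ((boolArrowEquivProd _).symm p)),
        ind_nonneg (SmallDiameter p)]
  have hsum := Finset.sum_le_sum fun p (_ : p ∈ univ) => hpt p
  rw [Finset.sum_sub_distrib, Finset.sum_sub_distrib, ← hcount] at hsum
  have he : ∑ p, ind (¬ Mixing (4 * (k + 1) * 20) ((boolArrowEquivProd (Perm (Fin n))).symm p)) =
      ∑ F : Bool → Perm (Fin n), ind (¬ Mixing (4 * (k + 1) * 20) F) :=
    (boolArrowEquivProd (Perm (Fin n))).symm.sum_comp fun F => ind (¬ Mixing _ F)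
  have hone : ∑ _p : Perm (Fin n) × Perm (Fin n), (1 : ℝ) = (n.factorial : ℝ) ^ 2 := by
    simp [Fintype.card_perm, sq]
  rw [hone, he, Fintype.sum_prod_type] at hsum
  have hf : (0 : ℝ) ≤ (n.factorial : ℝ) ^ 2 := by positivity
  have herr' := mul_le_mul_of_nonneg_right herr hf
  have h' : 10 ^ 16 * (l ^ 8 / R) * (n.factorial : ℝ) ^ 2 ≤
      10 ^ 16 * δ * (n.factorial : ℝ) ^ 2 := by gcongr
  linarith

end RandomGenerators

/-- **Random generators of the symmetric group: diameter.**
There exist absolute constants `c, C > 0` such that, with probability `1 - o(1)` for a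
random pair `(g, h) ∈ Sym(n) × Sym(n)`, every element of `G = ⟨g, h⟩` is a product of at
most `C·n²·(log n)^c` elements of `S = {g, h, g⁻¹, h⁻¹}`. -/
theorem random_generators_diameter :
    ∃ c C : ℝ, 0 < c ∧ 0 < C ∧
      ∀ ε : ℝ, 0 < ε → ∃ N : ℕ, ∀ n : ℕ, N ≤ n →
        (1 - ε) * (Nat.factorial n : ℝ) ^ 2 ≤
          (Set.ncard {p : Perm (Fin n) × Perm (Fin n) |
              ∀ x ∈ Subgroup.closure ({p.1, p.2} : Set (Perm (Fin n))),
                ∃ l : List (Perm (Fin n)),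
                  (∀ s ∈ l, s = p.1 ∨ s = p.2 ∨ s = p.1⁻¹ ∨ s = p.2⁻¹) ∧
                  l.prod = x ∧
                  (l.length : ℝ) ≤ C * (n : ℝ) ^ 2 * Real.log n ^ c} : ℝ) := by
  refine ⟨3, 2 * 10 ^ 6, by norm_num, by norm_num, fun ε hε => ?_⟩
  set δ := min (1 / 10 ^ 4) (ε / 2 / 10 ^ 16) with hδ
  obtain ⟨N₁, hN₁⟩ := RandomGenerators.exists_lam_pow_le (δ := δ) (by positivity)
  obtain ⟨M, hM⟩ := exists_nat_gt (220000 / ε)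
  have hM0 : (0 : ℝ) < M := lt_trans (by positivity) hM
  refine ⟨max 1000 (max N₁ (2 ^ M)), fun n hn => ?_⟩
  have hn1 : 1000 ≤ n := (le_max_left _ _).trans hn
  have hn2 : N₁ ≤ n := (le_max_left _ _).trans ((le_max_right _ _).trans hn)
  have hn3 : 2 ^ M ≤ n := (le_max_right _ _).trans ((le_max_right _ _).trans hn)
  have hMk : M ≤ Nat.log 2 n := Nat.le_log_of_pow_le (by norm_num) hn3
  refine le_trans ?_
    (RandomGenerators.le_ncard_smallDiameter hn1 (min_le_left _ _) (hN₁ n hn2))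
  have h1 : 110000 / (Nat.log 2 n : ℝ) ≤ ε / 2 := by
    calc 110000 / (Nat.log 2 n : ℝ) ≤ 110000 / (M : ℝ) := by gcongr
      _ ≤ ε / 2 := by
        rw [div_lt_iff₀ hε] at hM
        rw [div_le_iff₀ hM0]
        linarith
  have h2 : 10 ^ 16 * δ ≤ ε / 2 := by
    have := min_le_right (1 / 10 ^ 4 : ℝ) (ε / 2 / 10 ^ 16)
    rw [← hδ, le_div_iff₀ (by norm_num)] at this
    linarith
  gcongr
  linarith
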